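/- Let q ∈ ℂ× be not a root of unity. Let 𝒜 be the Weyl algebra with the ℤ/2-action generated by the automorphism ε with ε(x) = −x, ε(p) = −p; let 𝔸 be the trigonometric Weyl algebra with the ℤ/2-action generated by ε with ε(X) = X^{−1}, ε(p) = −p; let 𝐀 be the q-Weyl algebra with the ℤ/2-action generated by ε with ε(X) = X^{−1}, ε(P) = P^{−1}. Then: HH^i(ℂ[ℤ/2] ⋉ 𝒜) = HH^i(ℂ[ℤ/2] ⋉ 𝔸) = HH^i(ℂ[ℤ/2] ⋉ 𝐀) = 0 for all i ≠ 0, 2; HH^0(ℂ[ℤ/2] ⋉ 𝒜) ≅ HH^0(ℂ[ℤ/2] ⋉ 𝔸) ≅ HH^0(ℂ[ℤ/2] ⋉ 𝐀) ≅ ℂ; HH^2(ℂ[ℤ/2] ⋉ 𝒜) ≅ ℂ; HH^2(ℂ[ℤ/2] ⋉ 𝔸) ≅ ℂ²; and HH^2(ℂ[ℤ/2] ⋉ 𝐀) ≅ ℂ⁵. -/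

import Mathlib

open TensorProduct CategoryTheory MulOpposite

noncomputable section

/-- The enveloping algebra `S ⊗[ℂ] Sᵐᵒᵖ` of a `ℂ`-algebra `S`. -/
abbrev env (S : Type) [Ring S] [Algebra ℂ S] : Type := S ⊗[ℂ] Sᵐᵒᵖ

/-- `S` as a left module over its enveloping algebra (via `(x ⊗ yᵒᵖ) • s = x * s * y`). -/
abbrev envBimod (S : Type) [Ring S] [Algebra ℂ S] : ModuleCat (env S) :=
  @ModuleCat.of (env S) _ S _ (TensorProduct.Algebra.module)

/-- Hochschild cohomology with coefficients: `HH^i(S, N) = Ext^i_{S^e}(S, N)`. -/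
abbrev HHext (S : Type) [Ring S] [Algebra ℂ S] (i : ℕ) (N : ModuleCat (env S)) : ModuleCat ℂ :=
  ((Ext ℂ (ModuleCat (env S)) i).obj (Opposite.op (envBimod S))).obj N

/-- Hochschild cohomology `HH^i(S) = Ext^i_{S^e}(S, S)`. -/
abbrev HHcoh (S : Type) [Ring S] [Algebra ℂ S] (i : ℕ) : ModuleCat ℂ :=
  HHext S i (envBimod S)

/-- The defining relation of the Weyl algebra: `x p = p x + 1`
(generators: `0 ↦ x`, `1 ↦ p`). -/
inductive weylRel : FreeAlgebra ℂ (Fin 2) → FreeAlgebra ℂ (Fin 2) → Prop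
  | rel : weylRel (FreeAlgebra.ι ℂ 0 * FreeAlgebra.ι ℂ 1)
      (FreeAlgebra.ι ℂ 1 * FreeAlgebra.ι ℂ 0 + 1)

/-- The Weyl algebra `𝒜`: the quotient of the free algebra on `x, p`
by the two-sided ideal generated by `xp - px - 1`. -/
abbrev Weyl : Type := RingQuot weylRel

/-- The generator `x` of the Weyl algebra. -/
def Weyl.x : Weyl := RingQuot.mkAlgHom ℂ weylRel (FreeAlgebra.ι ℂ 0)

/-- The generator `p` of the Weyl algebra. -/
def Weyl.p : Weyl := RingQuot.mkAlgHom ℂ weylRel (FreeAlgebra.ι ℂ 1)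

/-- The defining relations of the trigonometric Weyl algebra
(generators: `0 ↦ X`, `1 ↦ X⁻¹`, `2 ↦ p`): `X X⁻¹ = 1`, `X⁻¹ X = 1`, `X p = p X + X`. -/
inductive trigWeylRel : FreeAlgebra ℂ (Fin 3) → FreeAlgebra ℂ (Fin 3) → Prop
  | relXXinv : trigWeylRel (FreeAlgebra.ι ℂ 0 * FreeAlgebra.ι ℂ 1) 1
  | relXinvX : trigWeylRel (FreeAlgebra.ι ℂ 1 * FreeAlgebra.ι ℂ 0) 1
  | relXp : trigWeylRel (FreeAlgebra.ι ℂ 0 * FreeAlgebra.ι ℂ 2)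
      (FreeAlgebra.ι ℂ 2 * FreeAlgebra.ι ℂ 0 + FreeAlgebra.ι ℂ 0)

/-- The trigonometric Weyl algebra `𝔸`. -/
abbrev TrigWeyl : Type := RingQuot trigWeylRel

/-- The generator `X` of the trigonometric Weyl algebra. -/
def TrigWeyl.X : TrigWeyl := RingQuot.mkAlgHom ℂ trigWeylRel (FreeAlgebra.ι ℂ 0)

/-- The generator `X⁻¹` of the trigonometric Weyl algebra. -/
def TrigWeyl.Xinv : TrigWeyl := RingQuot.mkAlgHom ℂ trigWeylRel (FreeAlgebra.ι ℂ 1)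

/-- The generator `p` of the trigonometric Weyl algebra. -/
def TrigWeyl.p : TrigWeyl := RingQuot.mkAlgHom ℂ trigWeylRel (FreeAlgebra.ι ℂ 2)

/-- The defining relations of the `q`-Weyl algebra
(generators: `0 ↦ X`, `1 ↦ X⁻¹`, `2 ↦ P`, `3 ↦ P⁻¹`):
`X X⁻¹ = 1`, `X⁻¹ X = 1`, `P P⁻¹ = 1`, `P⁻¹ P = 1`, `X P = q P X`. -/
inductive qWeylRel (q : ℂ) : FreeAlgebra ℂ (Fin 4) → FreeAlgebra ℂ (Fin 4) → Prop
  | relXXinv : qWeylRel q (FreeAlgebra.ι ℂ 0 * FreeAlgebra.ι ℂ 1) 1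
  | relXinvX : qWeylRel q (FreeAlgebra.ι ℂ 1 * FreeAlgebra.ι ℂ 0) 1
  | relPPinv : qWeylRel q (FreeAlgebra.ι ℂ 2 * FreeAlgebra.ι ℂ 3) 1
  | relPinvP : qWeylRel q (FreeAlgebra.ι ℂ 3 * FreeAlgebra.ι ℂ 2) 1
  | relXP : qWeylRel q (FreeAlgebra.ι ℂ 0 * FreeAlgebra.ι ℂ 2)
      (algebraMap ℂ (FreeAlgebra ℂ (Fin 4)) q * (FreeAlgebra.ι ℂ 2 * FreeAlgebra.ι ℂ 0))

/-- The `q`-Weyl algebra `𝐀`. -/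
abbrev QWeyl (q : ℂ) : Type := RingQuot (qWeylRel q)

/-- The generator `X` of the `q`-Weyl algebra. -/
def QWeyl.X (q : ℂ) : QWeyl q := RingQuot.mkAlgHom ℂ (qWeylRel q) (FreeAlgebra.ι ℂ 0)

/-- The generator `X⁻¹` of the `q`-Weyl algebra. -/
def QWeyl.Xinv (q : ℂ) : QWeyl q := RingQuot.mkAlgHom ℂ (qWeylRel q) (FreeAlgebra.ι ℂ 1)

/-- The generator `P` of the `q`-Weyl algebra. -/
def QWeyl.P (q : ℂ) : QWeyl q := RingQuot.mkAlgHom ℂ (qWeylRel q) (FreeAlgebra.ι ℂ 2)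

/-- The generator `P⁻¹` of the `q`-Weyl algebra. -/
def QWeyl.Pinv (q : ℂ) : QWeyl q := RingQuot.mkAlgHom ℂ (qWeylRel q) (FreeAlgebra.ι ℂ 3)

/-! ### Length-two projective resolutions -/

namespace ThreeTerm

open Limits ZeroObject

lemma comm_of_eq {C : Type*} [Category* C] {X Y : C} {f g : X ⟶ Y} (h : f = g) :
    𝟙 X ≫ g = f ≫ 𝟙 Y := by
  rw [Category.id_comp, Category.comp_id, h]

variable {C : Type*} [Category* C] [Abelian C] {P₂ P₁ P₀ M : C}
  (d₂ : P₂ ⟶ P₁) (d₁ : P₁ ⟶ P₀) (w : d₂ ≫ d₁ = 0)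

/-- The objects of the complex `0 ⟶ P₂ ⟶ P₁ ⟶ P₀`. -/
def obj (P₂ P₁ P₀ : C) : ℕ → C
  | 0 => P₀
  | 1 => P₁
  | 2 => P₂
  | _ + 3 => 0

/-- The differentials of the complex `0 ⟶ P₂ ⟶ P₁ ⟶ P₀`. -/
def diff : ∀ n, obj P₂ P₁ P₀ (n + 1) ⟶ obj P₂ P₁ P₀ n
  | 0 => d₁
  | 1 => d₂
  | _ + 2 => 0

lemma diff_comp (w : d₂ ≫ d₁ = 0) : ∀ n, diff d₂ d₁ (n + 1) ≫ diff d₂ d₁ n = 0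
  | 0 => w
  | 1 => zero_comp
  | _ + 2 => zero_comp

/-- The chain complex `0 ⟶ P₂ ⟶ P₁ ⟶ P₀`. -/
def complex : ChainComplex C ℕ :=
  ChainComplex.of (obj P₂ P₁ P₀) (diff d₂ d₁) (diff_comp d₂ d₁ w)

lemma complex_d (n : ℕ) : (complex d₂ d₁ w).d (n + 1) n = diff d₂ d₁ n :=
  ChainComplex.of_d _ _ _

lemma isZero_complex (n : ℕ) : IsZero ((complex d₂ d₁ w).X (n + 3)) :=
  isZero_zero C

/-- An exact sequence `0 ⟶ P₂ ⟶ P₁ ⟶ P₀ ⟶ M ⟶ 0` with projective `Pᵢ` is a projective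
resolution of `M`. -/
def resolution [Projective P₀] [Projective P₁] [Projective P₂] (e : P₀ ⟶ M) (we : d₁ ≫ e = 0)
    [Mono d₂] [Epi e] (ex₁ : (ShortComplex.mk d₂ d₁ w).Exact)
    (ex₀ : (ShortComplex.mk d₁ e we).Exact) : ProjectiveResolution M where
  complex := complex d₂ d₁ w
  projective n := match n with
    | 0 => ‹Projective P₀›
    | 1 => ‹Projective P₁›
    | 2 => ‹Projective P₂›
    | _ + 3 => inferInstanceAs (Projective (0 : C))
  π := (ChainComplex.toSingle₀Equiv _ _).symm ⟨e, by rw [complex_d]; exact we⟩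
  quasiIso := ⟨fun n => by
    match n with
    | 0 =>
      rw [ChainComplex.quasiIsoAt₀_iff, ShortComplex.quasiIso_iff_of_zeros']
      · refine (ShortComplex.exact_and_epi_g_iff_of_iso ?_).2 ⟨ex₀, ‹Epi e›⟩
        exact ShortComplex.isoMk (Iso.refl _) (Iso.refl _) (Iso.refl _)
          (comm_of_eq (complex_d d₂ d₁ w 0))
          (comm_of_eq (ChainComplex.toSingle₀Equiv_symm_apply_f_zero _ _))
      all_goals rfl
    | 1 =>
      rw [quasiIsoAt_iff_exactAt' _ _ (ChainComplex.exactAt_succ_single_obj _ _)]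
      rw [HomologicalComplex.exactAt_iff' _ 2 1 0 (by simp) (by simp)]
      refine (ShortComplex.exact_iff_of_iso ?_).2 ex₁
      exact ShortComplex.isoMk (Iso.refl _) (Iso.refl _) (Iso.refl _)
          (comm_of_eq (complex_d d₂ d₁ w 1)) (comm_of_eq (complex_d d₂ d₁ w 0))
    | 2 =>
      rw [quasiIsoAt_iff_exactAt' _ _ (ChainComplex.exactAt_succ_single_obj _ _)]
      rw [HomologicalComplex.exactAt_iff' _ 3 2 1 (by simp) (by simp)]
      rw [ShortComplex.exact_iff_mono _ ((isZero_complex d₂ d₁ w 0).eq_of_src _ _)]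
      have h : Mono ((complex d₂ d₁ w).d 2 1) := by rw [complex_d]; exact ‹Mono d₂›
      exact h
    | n + 3 =>
      rw [quasiIsoAt_iff_exactAt' _ _ (ChainComplex.exactAt_succ_single_obj _ _)]
      exact ShortComplex.exact_of_isZero_X₂ _ (isZero_complex d₂ d₁ w n)⟩

end ThreeTerm
namespace ThreeTerm

open Limits

lemma nonempty_homology_iso_of_surjective {R : Type} [Ring R] (S : ShortComplex (ModuleCat.{0} R))
    {W : Type} [AddCommGroup W] [Module R W] (ψ : S.X₂ →ₗ[R] W)
    (hψ : ∀ x, S.g x = 0 → (ψ x = 0 ↔ ∃ y, S.f y = x)) (hs : ∀ w, ∃ x, S.g x = 0 ∧ ψ x = w) :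
    Nonempty (S.homology ≅ ModuleCat.of R W) := by
  let φ : LinearMap.ker S.g.hom →ₗ[R] W := ψ ∘ₗ (LinearMap.ker S.g.hom).subtype
  have hφ : Function.Surjective φ := fun w => by
    obtain ⟨x, hx, rfl⟩ := hs w
    exact ⟨⟨x, hx⟩, rfl⟩
  have hker : LinearMap.range S.moduleCatToCycles = LinearMap.ker φ := by
    ext ⟨x, hx⟩
    refine Iff.trans ?_ (hψ x hx).symm
    constructor
    · rintro ⟨y, hy⟩
      exact ⟨y, congrArg Subtype.val hy⟩
    · rintro ⟨y, hy⟩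
      exact ⟨y, Subtype.ext hy⟩
  exact ⟨S.moduleCatHomologyIso ≪≫ LinearEquiv.toModuleIso
    ((Submodule.quotEquivOfEq _ _ hker).trans (φ.quotKerEquivOfSurjective hφ))⟩

lemma nonempty_homology_iso_of_injective {R : Type} [Ring R] (S : ShortComplex (ModuleCat.{0} R))
    {W : Type} [AddCommGroup W] [Module R W] (hf : S.f = 0) (ψ : W →ₗ[R] S.X₂)
    (hi : Function.Injective ψ) (hψ : ∀ x, S.g x = 0 ↔ ∃ w, ψ w = x) :
    Nonempty (S.homology ≅ ModuleCat.of R W) := by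
  have hker : LinearMap.range ψ = LinearMap.ker S.g.hom := by
    ext x
    exact (hψ x).symm
  have hr : LinearMap.range S.moduleCatToCycles = ⊥ := by
    rw [LinearMap.range_eq_bot]
    ext y
    exact congr(($hf).hom y)
  exact ⟨S.moduleCatHomologyIso ≪≫ LinearEquiv.toModuleIso
    ((Submodule.quotEquivOfEqBot _ hr).trans
      (((LinearEquiv.ofInjective ψ hi).trans (LinearEquiv.ofEq _ _ hker)).symm))⟩

variable {R : Type} [CommRing R] {C : Type*} [Category.{0} C] [Abelian C] [EnoughProjectives C]
  [Linear R C] {P₂ P₁ P₀ M : C}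
  [Projective P₀] [Projective P₁] [Projective P₂] {d₂ : P₂ ⟶ P₁} {d₁ : P₁ ⟶ P₀} (w : d₂ ≫ d₁ = 0)
  (e : P₀ ⟶ M) (we : d₁ ≫ e = 0)
  [Mono d₂] [Epi e] (ex₁ : (ShortComplex.mk d₂ d₁ w).Exact)
  (ex₀ : (ShortComplex.mk d₁ e we).Exact) (N : C)

include ex₁ ex₀

lemma isZero_ext_of_three_le (n : ℕ) :
    IsZero (((Ext R C (n + 3)).obj (Opposite.op M)).obj N) := by
  refine IsZero.of_iso ?_ ((resolution d₂ d₁ w e we ex₁ ex₀).isoExt (n + 3) N)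
  rw [← HomologicalComplex.exactAt_iff_isZero_homology]
  refine ShortComplex.exact_of_isZero_X₂ _ ?_
  rw [IsZero.iff_id_eq_zero]
  ext (x : _ ⟶ _)
  exact (isZero_complex d₂ d₁ w n).eq_of_src _ _

/-- `Ext` is the homology of the short complex given by three consecutive `Hom` groups. -/
def extIso (i j k : ℕ) (hi : (ComplexShape.up ℕ).prev j = i) (hk : (ComplexShape.up ℕ).next j = k) :
    ((Ext R C j).obj (Opposite.op M)).obj N ≅
      (((complex d₂ d₁ w).linearYonedaObj R N).sc' i j k).homology :=
  (resolution d₂ d₁ w e we ex₁ ex₀).isoExt j N ≪≫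
    ShortComplex.homologyMapIso (((complex d₂ d₁ w).linearYonedaObj R N).isoSc' i j k hi hk)

lemma isZero_ext_one (h : ∀ f : P₁ ⟶ N, d₂ ≫ f = 0 → ∃ g : P₀ ⟶ N, d₁ ≫ g = f) :
    IsZero (((Ext R C 1).obj (Opposite.op M)).obj N) := by
  refine IsZero.of_iso ?_ (extIso w e we ex₁ ex₀ N 0 1 2 (by simp) (by simp))
  rw [← ShortComplex.exact_iff_isZero_homology, ShortComplex.moduleCat_exact_iff]
  intro x hx
  obtain ⟨g, hg⟩ := h x (Eq.trans (congrArg (· ≫ x) (complex_d d₂ d₁ w 1).symm) hx)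
  exact ⟨g, Eq.trans (congrArg (· ≫ g) (complex_d d₂ d₁ w 0)) hg⟩

lemma nonempty_ext_zero_iso {W : Type} [AddCommGroup W] [Module R W] (ψ : W →ₗ[R] (P₀ ⟶ N))
    (hi : Function.Injective ψ) (h : ∀ f : P₀ ⟶ N, d₁ ≫ f = 0 ↔ ∃ v, ψ v = f) :
    Nonempty (((Ext R C 0).obj (Opposite.op M)).obj N ≅ ModuleCat.of R W) := by
  obtain ⟨i⟩ := nonempty_homology_iso_of_injective
    (((complex d₂ d₁ w).linearYonedaObj R N).sc' 0 0 1)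
    (((complex d₂ d₁ w).linearYonedaObj R N).shape 0 0 (by simp)) ψ hi (fun x => by
      refine Iff.trans ?_ (h x)
      exact Iff.of_eq (congrArg (· = (0 : P₁ ⟶ N)) (congrArg (· ≫ x) (complex_d d₂ d₁ w 0))))
  exact ⟨extIso w e we ex₁ ex₀ N 0 0 1 (by simp) (by simp) ≪≫ i⟩

lemma nonempty_ext_two_iso {W : Type} [AddCommGroup W] [Module R W] (ψ : (P₂ ⟶ N) →ₗ[R] W)
    (hs : Function.Surjective ψ) (h : ∀ f : P₂ ⟶ N, ψ f = 0 ↔ ∃ g, d₂ ≫ g = f) :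
    Nonempty (((Ext R C 2).obj (Opposite.op M)).obj N ≅ ModuleCat.of R W) := by
  obtain ⟨i⟩ := nonempty_homology_iso_of_surjective
    (((complex d₂ d₁ w).linearYonedaObj R N).sc' 1 2 3) ψ (fun x _ => by
      refine Iff.trans (h x) ?_
      exact exists_congr fun g => Iff.of_eq (congrArg (· = x)
        (congrArg (· ≫ g) (complex_d d₂ d₁ w 1).symm))) (fun v => by
      obtain ⟨x, hx⟩ := hs v
      exact ⟨x, (isZero_complex d₂ d₁ w 0).eq_of_src _ _, hx⟩)
  exact ⟨extIso w e we ex₁ ex₀ N 1 2 3 (by simp) (by simp) ≪≫ i⟩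

end ThreeTerm
/-! ### Koszul complexes with idempotents -/

section RightFixed

variable {T : Type} [Ring T]

/-- The left ideal `T f` for an idempotent `f`, as the set of all `t` with `t * f = t`. -/
def rightFixed (f : T) : Submodule T T where
  carrier := {t | t * f = t}
  add_mem' {a b} ha hb := by
    change (a + b) * f = a + b
    rw [add_mul, show a * f = a from ha, show b * f = b from hb]
  zero_mem' := zero_mul f
  smul_mem' c x hx := by
    change c * x * f = c * x
    rw [mul_assoc, show x * f = x from hx]

lemma mem_rightFixed {f t : T} : t ∈ rightFixed f ↔ t * f = t := Iff.rfl

lemma rightFixed_projective {f : T} (hf : f * f = f) : Module.Projective T (rightFixed f) := by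
  refine Module.Projective.of_split (rightFixed f).subtype
    (LinearMap.codRestrict (rightFixed f) (LinearMap.toSpanSingleton T T f) fun t => ?_) ?_
  · rw [LinearMap.toSpanSingleton_apply, smul_eq_mul, mem_rightFixed, mul_assoc, hf]
  · ext ⟨t, ht⟩
    exact ht

/-- Right multiplication by `u` as a map `T f → T f'`, where `f u = u f'`. -/
def rightFixedMul {f f' : T} (u : T) (h : f * u = u * f') : rightFixed f →ₗ[T] rightFixed f' :=
  LinearMap.codRestrict _ (LinearMap.toSpanSingleton T T u ∘ₗ (rightFixed f).subtype) fun t => by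
    change t.1 * u * f' = t.1 * u
    rw [mul_assoc, ← h, ← mul_assoc, show t.1 * f = t.1 from t.2]

lemma rightFixedMul_coe {f f' : T} (u : T) (h : f * u = u * f') (t : rightFixed f) :
    (rightFixedMul u h t : T) = t * u := rfl

/-- The map `T f → N` given by `t ↦ t • n`. -/
def rightFixedToModule {N : Type} [AddCommGroup N] [Module T N] (f : T) (n : N) :
    rightFixed f →ₗ[T] N :=
  LinearMap.toSpanSingleton T N n ∘ₗ (rightFixed f).subtype

/-- The canonical generator of `T f`. -/
def rightFixedGen {f : T} (hf : f * f = f) : rightFixed f := ⟨f, hf⟩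

lemma apply_eq_smul_gen {N : Type} [AddCommGroup N] [Module T N] {f : T} (hf : f * f = f)
    (φ : rightFixed f →ₗ[T] N) (t : rightFixed f) : φ t = (t : T) • φ (rightFixedGen hf) := by
  rw [← map_smul]
  congr 1
  exact Subtype.ext t.2.symm

lemma smul_apply_gen {N : Type} [AddCommGroup N] [Module T N] {f : T} (hf : f * f = f)
    (φ : rightFixed f →ₗ[T] N) : f • φ (rightFixedGen hf) = φ (rightFixedGen hf) :=
  (apply_eq_smul_gen hf φ (rightFixedGen hf)).symm

end RightFixed

/-- Two commuting elements `u`, `v` of a ring `T`, semi-invariant under idempotents, such that the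
idempotent part of the Koszul complex of right multiplications by `u`, `v` resolves `M`. -/
structure KoszulData (T : Type) [Ring T] (M : Type) [AddCommGroup M] [Module T M] where
  (u v f₀ fa fb f₂ : T)
  (m₀ : M)
  hf₀ : f₀ * f₀ = f₀
  hfa : fa * fa = fa
  hfb : fb * fb = fb
  hf₂ : f₂ * f₂ = f₂
  comm : u * v = v * u
  fau : fa * u = u * f₀
  fbv : fb * v = v * f₀
  f₂u : f₂ * u = u * fb
  f₂v : f₂ * v = v * fa
  um : u • m₀ = 0
  vm : v • m₀ = 0
  f₀m : f₀ • m₀ = m₀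
  surj : ∀ m : M, ∃ t : T, t • m₀ = m
  ker : ∀ t : T, t • m₀ = 0 → ∃ a b, t * f₀ = a * u + b * v
  inj : ∀ t : T, t * u = 0 → t * v = 0 → t = 0
  ex : ∀ a b : T, a * u + b * v = 0 → ∃ t, a = -(t * v) ∧ b = t * u

namespace KoszulData

open Limits

variable {T : Type} [Ring T] {M : Type} [AddCommGroup M] [Module T M] (K : KoszulData T M)

/-- The last differential of the Koszul complex. -/
def d₂ : ModuleCat.of T (rightFixed K.f₂) ⟶
    ModuleCat.of T (rightFixed K.fa × rightFixed K.fb) :=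
  ModuleCat.ofHom ((-rightFixedMul K.v K.f₂v).prod (rightFixedMul K.u K.f₂u))

/-- The first differential of the Koszul complex. -/
def d₁ : ModuleCat.of T (rightFixed K.fa × rightFixed K.fb) ⟶
    ModuleCat.of T (rightFixed K.f₀) :=
  ModuleCat.ofHom ((rightFixedMul K.u K.fau).coprod (rightFixedMul K.v K.fbv))

/-- The augmentation of the Koszul complex. -/
def aug : ModuleCat.of T (rightFixed K.f₀) ⟶ ModuleCat.of T M :=
  ModuleCat.ofHom (rightFixedToModule K.f₀ K.m₀)

lemma d₂_apply (t : rightFixed K.f₂) :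
    K.d₂ t = (-rightFixedMul K.v K.f₂v t, rightFixedMul K.u K.f₂u t) := rfl

lemma d₁_apply (t : rightFixed K.fa × rightFixed K.fb) :
    K.d₁ t = rightFixedMul K.u K.fau t.1 + rightFixedMul K.v K.fbv t.2 := rfl

lemma d₂_d₁ : K.d₂ ≫ K.d₁ = 0 := by
  ext t
  change -(t.1 * K.v) * K.u + t.1 * K.u * K.v = 0
  rw [neg_mul, mul_assoc, mul_assoc, K.comm, neg_add_cancel]

lemma d₁_aug : K.d₁ ≫ K.aug = 0 := by
  ext t
  · change (t.1 * K.u + 0 * K.v) • K.m₀ = 0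
    rw [add_smul, mul_smul, mul_smul, K.um, K.vm, smul_zero, smul_zero, add_zero]
  · change (0 * K.u + t.1 * K.v) • K.m₀ = 0
    rw [add_smul, mul_smul, mul_smul, K.um, K.vm, smul_zero, smul_zero, add_zero]

instance mono_d₂ : Mono K.d₂ := by
  rw [ModuleCat.mono_iff_ker_eq_bot, LinearMap.ker_eq_bot']
  intro t ht
  have h := Prod.ext_iff.1 ((K.d₂_apply t).symm.trans ht)
  refine Subtype.ext (K.inj t.1 ?_ ?_)
  · exact congrArg Subtype.val h.2
  · exact congrArg Subtype.val (neg_eq_zero.1 h.1)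

instance epi_aug : Epi K.aug := by
  rw [ModuleCat.epi_iff_surjective]
  intro m
  obtain ⟨t, ht⟩ := K.surj m
  refine ⟨⟨t * K.f₀, ?_⟩, ?_⟩
  · rw [mem_rightFixed, mul_assoc, K.hf₀]
  · change (t * K.f₀) • K.m₀ = m
    rw [mul_smul, K.f₀m, ht]

lemma exact₁ : (ShortComplex.mk _ _ K.d₂_d₁).Exact := by
  rw [ShortComplex.moduleCat_exact_iff]
  rintro ⟨⟨a, ha⟩, ⟨b, hb⟩⟩ h
  obtain ⟨t, rfl, rfl⟩ := K.ex a b (congrArg Subtype.val h)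
  rw [mem_rightFixed] at ha hb
  refine ⟨⟨t * K.f₂, ?_⟩, ?_⟩
  · rw [mem_rightFixed, mul_assoc, K.hf₂]
  · refine Prod.ext (Subtype.ext ?_) (Subtype.ext ?_)
    · change -(t * K.f₂ * K.v) = -(t * K.v)
      rw [mul_assoc, K.f₂v, ← mul_assoc, ← neg_mul, ha]
    · change t * K.f₂ * K.u = t * K.u
      rw [mul_assoc, K.f₂u, ← mul_assoc, hb]

lemma exact₀ : (ShortComplex.mk _ _ K.d₁_aug).Exact := by
  rw [ShortComplex.moduleCat_exact_iff]
  rintro ⟨t, ht⟩ h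
  obtain ⟨a, b, hab⟩ := K.ker t h
  rw [mem_rightFixed] at ht
  refine ⟨(⟨a * K.fa, ?_⟩, ⟨b * K.fb, ?_⟩), Subtype.ext ?_⟩
  · rw [mem_rightFixed, mul_assoc, K.hfa]
  · rw [mem_rightFixed, mul_assoc, K.hfb]
  · change a * K.fa * K.u + b * K.fb * K.v = t
    rw [mul_assoc, mul_assoc, K.fau, K.fbv, ← mul_assoc, ← mul_assoc, ← add_mul, ← hab, mul_assoc,
      K.hf₀, ht]

instance : Projective (ModuleCat.of T (rightFixed K.f₀)) :=
  (IsProjective.iff_projective _).1 (rightFixed_projective K.hf₀)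

instance : Projective (ModuleCat.of T (rightFixed K.f₂)) :=
  (IsProjective.iff_projective _).1 (rightFixed_projective K.hf₂)

instance : Projective (ModuleCat.of T (rightFixed K.fa × rightFixed K.fb)) :=
  have := rightFixed_projective K.hfa
  have := rightFixed_projective K.hfb
  (IsProjective.iff_projective _).1 inferInstance

variable [Algebra ℂ T]

include K in
lemma isZero_ext_of_three_le (N : ModuleCat T) (n : ℕ) :
    IsZero (((Ext ℂ (ModuleCat T) (n + 3)).obj (Opposite.op (ModuleCat.of T M))).obj N) :=
  ThreeTerm.isZero_ext_of_three_le _ _ _ K.exact₁ K.exact₀ N n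

lemma isZero_ext_one (N : ModuleCat T)
    (h : ∀ a b : N, K.u • b = K.v • a → ∃ n : N, K.fa • a = K.u • K.f₀ • n ∧
      K.fb • b = K.v • K.f₀ • n) :
    IsZero (((Ext ℂ (ModuleCat T) 1).obj (Opposite.op (ModuleCat.of T M))).obj N) := by
  refine ThreeTerm.isZero_ext_one _ _ _ K.exact₁ K.exact₀ N fun φ hφ => ?_
  let φa : rightFixed K.fa →ₗ[T] N := φ.hom ∘ₗ LinearMap.inl _ _ _
  let φb : rightFixed K.fb →ₗ[T] N := φ.hom ∘ₗ LinearMap.inr _ _ _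
  have key : ∀ s t, φ.hom (s, t) = φa s + φb t := fun s t => by
    simp only [φa, φb, LinearMap.comp_apply, LinearMap.inl_apply, LinearMap.inr_apply, ← map_add,
      Prod.mk_add_mk, add_zero, zero_add]
  obtain ⟨n, hna, hnb⟩ := h (φa (rightFixedGen K.hfa)) (φb (rightFixedGen K.hfb)) (by
    have h1 : φ.hom (K.d₂ (rightFixedGen K.hf₂)) = 0 := congr($(hφ).hom (rightFixedGen K.hf₂))
    rw [d₂_apply, key, map_neg, apply_eq_smul_gen K.hfa, apply_eq_smul_gen K.hfb,
      rightFixedMul_coe, rightFixedMul_coe] at h1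
    change -((K.f₂ * K.v) • _) + (K.f₂ * K.u) • _ = _ at h1
    rw [K.f₂v, K.f₂u, mul_smul, mul_smul, smul_apply_gen, smul_apply_gen] at h1
    exact (neg_add_eq_zero.1 h1).symm)
  rw [smul_apply_gen] at hna hnb
  refine ⟨ModuleCat.ofHom (rightFixedToModule K.f₀ (K.f₀ • n)), ?_⟩
  refine ModuleCat.hom_ext (LinearMap.ext fun ⟨s, t⟩ => ?_)
  change (s.1 * K.u + t.1 * K.v) • _ = φ.hom (s, t)
  rw [key, apply_eq_smul_gen K.hfa, apply_eq_smul_gen K.hfb, add_smul, mul_smul, mul_smul, ← hna,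
    ← hnb]

lemma nonempty_ext_zero_iso (N : ModuleCat T) (n₀ : N) (hn₀ : n₀ ≠ 0) (hf : K.f₀ • n₀ = n₀)
    (h : ∀ n : N, K.u • n = 0 ∧ K.v • n = 0 ↔ ∃ c : ℂ, algebraMap ℂ T c • n₀ = n) :
    Nonempty (((Ext ℂ (ModuleCat T) 0).obj (Opposite.op (ModuleCat.of T M))).obj N ≅
      ModuleCat.of ℂ ℂ) := by
  let φ₀ : ModuleCat.of T (rightFixed K.f₀) ⟶ N := ModuleCat.ofHom (rightFixedToModule K.f₀ n₀)
  have hφ₀ : ∀ (c : ℂ) t, (c • φ₀).hom t = (algebraMap ℂ T c) • ((t : T) • n₀) := fun _ _ => rfl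
  refine ThreeTerm.nonempty_ext_zero_iso _ _ _ K.exact₁ K.exact₀ N
    (LinearMap.toSpanSingleton ℂ _ φ₀) ?_ fun φ => ?_
  · rw [← LinearMap.ker_eq_bot, LinearMap.ker_eq_bot']
    intro c hc
    by_contra hne
    refine hn₀ ?_
    have h1 := hφ₀ c (rightFixedGen K.hf₀)
    rw [show c • φ₀ = 0 from hc] at h1
    have h2 : algebraMap ℂ T c • n₀ = 0 := by
      rw [← hf]
      exact h1.symm
    rw [← one_smul T n₀, ← map_one (algebraMap ℂ T), ← inv_mul_cancel₀ hne, map_mul, mul_smul, h2,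
      smul_zero]
  · have h3 : K.d₁ ≫ φ = 0 ↔
        K.u • φ.hom (rightFixedGen K.hf₀) = 0 ∧ K.v • φ.hom (rightFixedGen K.hf₀) = 0 := by
      constructor
      · intro h0
        have ha : φ.hom (K.d₁ (rightFixedGen K.hfa, 0)) = 0 :=
          congr($(h0).hom (rightFixedGen K.hfa, 0))
        have hb : φ.hom (K.d₁ (0, rightFixedGen K.hfb)) = 0 :=
          congr($(h0).hom (0, rightFixedGen K.hfb))
        rw [d₁_apply, apply_eq_smul_gen K.hf₀] at ha hb
        change (K.fa * K.u + 0 * K.v) • _ = _ at ha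
        change (0 * K.u + K.fb * K.v) • _ = _ at hb
        rw [zero_mul, add_zero, K.fau, mul_smul, smul_apply_gen] at ha
        rw [zero_mul, zero_add, K.fbv, mul_smul, smul_apply_gen] at hb
        exact ⟨ha, hb⟩
      · rintro ⟨ha, hb⟩
        refine ModuleCat.hom_ext (LinearMap.ext fun ⟨s, t⟩ => ?_)
        change φ.hom (K.d₁ (s, t)) = 0
        rw [apply_eq_smul_gen K.hf₀]
        change (s.1 * K.u + t.1 * K.v) • _ = _
        rw [add_smul, mul_smul, mul_smul, ha, hb, smul_zero, smul_zero, add_zero]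
    rw [h3, h]
    refine exists_congr fun c => ⟨fun hc => ?_, fun hc => ?_⟩
    · refine ModuleCat.hom_ext (LinearMap.ext fun t => ?_)
      rw [apply_eq_smul_gen K.hf₀ φ.hom, ← hc]
      refine (hφ₀ c t).trans ?_
      rw [← mul_smul, ← mul_smul, Algebra.commutes]
    · rw [← hc]
      refine Eq.trans ?_ (hφ₀ c _).symm
      change _ = _ • K.f₀ • n₀
      rw [hf]

lemma nonempty_ext_two_iso (N : ModuleCat T) {W : Type} [AddCommGroup W] [Module ℂ W]
    (Θ : N →+ W) (hΘ : ∀ (c : ℂ) n, Θ (algebraMap ℂ T c • n) = c • Θ n)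
    (hs : Function.Surjective Θ) (hf : ∀ n, Θ (K.f₂ • n) = Θ n)
    (h : ∀ n, Θ n = 0 ↔ ∃ a b, K.u • b - K.v • a = n) :
    Nonempty (((Ext ℂ (ModuleCat T) 2).obj (Opposite.op (ModuleCat.of T M))).obj N ≅
      ModuleCat.of ℂ W) := by
  let ψ : (ModuleCat.of T (rightFixed K.f₂) ⟶ N) →ₗ[ℂ] W :=
    { toFun := fun φ => Θ (φ.hom (rightFixedGen K.hf₂))
      map_add' := fun φ φ' => map_add Θ _ _
      map_smul' := fun c φ => hΘ c _ }
  refine ThreeTerm.nonempty_ext_two_iso _ _ _ K.exact₁ K.exact₀ N ψ (fun w => ?_) fun φ => ?_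
  · obtain ⟨n, rfl⟩ := hs w
    exact ⟨ModuleCat.ofHom (rightFixedToModule K.f₂ n), hf n⟩
  · refine (h _).trans ⟨?_, ?_⟩
    · rintro ⟨a, b, hab⟩
      refine ⟨ModuleCat.ofHom ((rightFixedToModule K.fa a).coprod (rightFixedToModule K.fb b)),
        ModuleCat.hom_ext (LinearMap.ext fun t => ?_)⟩
      rw [apply_eq_smul_gen K.hf₂ φ.hom, ← hab]
      change (-(t.1 * K.v)) • a + (t.1 * K.u) • b = _
      rw [smul_sub, mul_smul, neg_smul, mul_smul, neg_add_eq_sub]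
    · rintro ⟨g, rfl⟩
      refine ⟨g.hom (rightFixedGen K.hfa, 0), g.hom (0, rightFixedGen K.hfb), ?_⟩
      change _ = g.hom (K.d₂ (rightFixedGen K.hf₂))
      rw [d₂_apply, ← map_smul, ← map_smul, ← map_sub]
      congr 1
      refine Prod.ext (Subtype.ext ?_) (Subtype.ext ?_)
      · change K.u * 0 - K.v * K.fa = -(K.f₂ * K.v)
        rw [mul_zero, zero_sub, K.f₂v]
      · change K.u * K.fb - K.v * 0 = K.f₂ * K.u
        rw [mul_zero, sub_zero, K.f₂u]

end KoszulData

/-! ### Difference operators on finitely supported functions -/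

section ShiftOp

variable {ι W : Type} [AddCommGroup W] [Module ℂ W]

/-- The operator sending `w` in position `i` to `α w` in position `i` minus `β w` in position
`s i`. -/
def shiftOp (s : ι → ι) (α β : W →ₗ[ℂ] W) : (ι →₀ W) →ₗ[ℂ] ι →₀ W :=
  Finsupp.lsum ℂ fun i => Finsupp.lsingle i ∘ₗ α - Finsupp.lsingle (s i) ∘ₗ β

@[simp]
lemma shiftOp_single (s : ι → ι) (α β : W →ₗ[ℂ] W) (i : ι) (w : W) :
    shiftOp s α β (Finsupp.single i w) =
      Finsupp.single i (α w) - Finsupp.single (s i) (β w) := by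
  simp [shiftOp]

lemma shiftOp_apply {s : ι → ι} (hs : Function.Injective s) (α β : W →ₗ[ℂ] W) (F : ι →₀ W)
    (i : ι) : shiftOp s α β F (s i) = α (F (s i)) - β (F i) := by
  classical
  induction F using Finsupp.induction_linear with
  | zero => simp
  | add F G hF hG =>
    rw [map_add, Finsupp.add_apply, hF, hG, Finsupp.add_apply, Finsupp.add_apply, map_add, map_add]
    abel
  | single j w =>
    rw [shiftOp_single, Finsupp.sub_apply, Finsupp.single_apply, Finsupp.single_apply,
      Finsupp.single_apply, Finsupp.single_apply]
    simp only [hs.eq_iff]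
    split_ifs <;> simp

lemma eq_zero_of_shiftOp_eq_zero {s : ι → ι} (hs : Function.Injective s) (deg : ι → ℤ)
    (hdeg : ∀ i, deg i < deg (s i)) {α β : W →ₗ[ℂ] W} (hβ : ∀ w, β w = 0 → w = 0) {F : ι →₀ W}
    (hF : shiftOp s α β F = 0) : F = 0 := by
  by_contra h
  obtain ⟨i, hi, hmax⟩ := F.support.exists_max_image deg (Finsupp.support_nonempty_iff.2 h)
  have h1 : F (s i) = 0 := by
    by_contra h2
    exact absurd (hmax _ (Finsupp.mem_support_iff.2 h2)) (not_le.2 (hdeg i))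
  have h3 := shiftOp_apply hs α β F i
  rw [hF, h1, map_zero, zero_sub, Finsupp.zero_apply, zero_eq_neg] at h3
  exact Finsupp.mem_support_iff.1 hi (hβ _ h3)

end ShiftOp

/-! ### Koszul data from involutions -/

section Involution

variable {T : Type} [Ring T] [Algebra ℂ T]

/-- The idempotent attached to an involution. -/
def halfSum (γ : T) : T := (2⁻¹ : ℂ) • (1 + γ)

lemma halfSum_mul_self {γ : T} (h : γ * γ = 1) : halfSum γ * halfSum γ = halfSum γ := by
  rw [halfSum, smul_mul_smul_comm, mul_add, add_mul, add_mul, h, one_mul, one_mul, mul_one,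
    add_comm γ 1, ← two_smul ℂ (1 + γ), smul_smul]
  norm_num

lemma halfSum_mul_comm {γ δ u : T} (h : γ * u = u * δ) : halfSum γ * u = u * halfSum δ := by
  rw [halfSum, halfSum, smul_mul_assoc, mul_smul_comm, mul_add, add_mul, h, one_mul, mul_one]

lemma halfSum_neg_mul_comm {γ δ u : T} (h : γ * u = -(u * δ)) :
    halfSum (-γ) * u = u * halfSum δ :=
  halfSum_mul_comm (by rw [neg_mul, h, neg_neg])

/-- Elements giving rise to an idempotent part of a Koszul complex: an involution `γ₀` and
twists `A`, `B` of it. -/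
structure KoszulInvolution (u v γ₀ A B : T) : Prop where
  γγ : γ₀ * γ₀ = 1
  AγAγ : A * γ₀ * (A * γ₀) = 1
  BγBγ : B * γ₀ * (B * γ₀) = 1
  AB : A * B = B * A
  uv : u * v = v * u
  Aγu : A * γ₀ * u = -(u * γ₀)
  Bγv : B * γ₀ * v = -(v * γ₀)
  Av : A * v = v * A
  Bu : B * u = u * B

/-- The exactness statements for right multiplication by `u` and `v` on `T`, augmented by
`t ↦ t • m₀`. -/
structure KoszulExact {M : Type} [AddCommGroup M] [Module T M] (u v γ₀ : T) (m₀ : M) : Prop where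
  um : u • m₀ = 0
  vm : v • m₀ = 0
  γm : γ₀ • m₀ = m₀
  surj : ∀ m : M, ∃ t : T, t • m₀ = m
  ker : ∀ t : T, t • m₀ = 0 → ∃ a b, t * halfSum γ₀ = a * u + b * v
  inj : ∀ t, t * u = 0 → t = 0
  reg : ∀ b t, b * v = t * u → ∃ a, b = a * u

variable {M : Type} [AddCommGroup M] [Module T M] [Module ℂ M] [IsScalarTower ℂ T M]

lemma halfSum_smul (γ : T) (m : M) : halfSum γ • m = (2⁻¹ : ℂ) • (m + γ • m) := by
  rw [halfSum, smul_assoc, add_smul, one_smul]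

omit [Algebra ℂ T] in
lemma KoszulInvolution.ABγABγ {u v γ₀ A B : T} (h : KoszulInvolution u v γ₀ A B) :
    A * B * γ₀ * (A * B * γ₀) = 1 := by
  have hA : γ₀ * A * γ₀ * A = 1 := by
    have := congr(γ₀ * $(h.AγAγ) * γ₀)
    calc _ = γ₀ * A * γ₀ * A * (γ₀ * γ₀) := by rw [h.γγ, mul_one]
      _ = γ₀ * (A * γ₀ * (A * γ₀)) * γ₀ := by noncomm_ring
      _ = _ := by rw [h.AγAγ, mul_one, h.γγ]
  calc A * B * γ₀ * (A * B * γ₀) = A * (B * (γ₀ * A * (γ₀ * γ₀)) * B * γ₀) := by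
        rw [h.γγ]; noncomm_ring
    _ = A * B * (γ₀ * A * γ₀) * (γ₀ * B * γ₀) := by noncomm_ring
    _ = B * A * (γ₀ * A * γ₀ * (γ₀ * B * γ₀)) := by rw [h.AB, mul_assoc _ (γ₀ * A * γ₀)]
    _ = B * (A * γ₀ * (A * γ₀)) * (γ₀ * B * γ₀) := by noncomm_ring
    _ = B * γ₀ * (B * γ₀) := by rw [h.AγAγ]; noncomm_ring
    _ = 1 := h.BγBγ

/-- The Koszul data attached to involutions. -/
def KoszulInvolution.koszulData {u v γ₀ A B : T} (h : KoszulInvolution u v γ₀ A B) {m₀ : M}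
    (he : KoszulExact u v γ₀ m₀) : KoszulData T M where
  u := u
  v := v
  f₀ := halfSum γ₀
  fa := halfSum (-(A * γ₀))
  fb := halfSum (-(B * γ₀))
  f₂ := halfSum (A * B * γ₀)
  m₀ := m₀
  hf₀ := halfSum_mul_self h.γγ
  hfa := halfSum_mul_self (by rw [neg_mul_neg, h.AγAγ])
  hfb := halfSum_mul_self (by rw [neg_mul_neg, h.BγBγ])
  hf₂ := halfSum_mul_self h.ABγABγ
  comm := h.uv
  fau := halfSum_neg_mul_comm h.Aγu
  fbv := halfSum_neg_mul_comm h.Bγv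
  f₂u := halfSum_mul_comm (by
    rw [h.AB, mul_assoc B A, mul_assoc, h.Aγu, mul_neg, mul_neg, ← mul_assoc, ← mul_assoc, h.Bu])
  f₂v := halfSum_mul_comm (by
    rw [mul_assoc A B, mul_assoc, h.Bγv, mul_neg, mul_neg, ← mul_assoc, ← mul_assoc, h.Av])
  um := he.um
  vm := he.vm
  f₀m := by
    rw [halfSum_smul, he.γm, ← two_smul ℂ, smul_smul]
    norm_num
  surj := he.surj
  ker := he.ker
  inj := fun t ht _ => he.inj t ht
  ex := fun a b hab => by
    obtain ⟨t, rfl⟩ := he.reg b (-a) (by rw [neg_mul, eq_neg_iff_add_eq_zero, add_comm, hab])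
    refine ⟨t, eq_neg_of_add_eq_zero_left (he.inj _ ?_), rfl⟩
    rw [add_mul, mul_assoc t v u, ← h.uv, ← mul_assoc, hab]

end Involution

/-! ### The Koszul complex of an algebra with a monomial basis -/

section Bimodule

variable {D : Type} [Ring D] [Algebra ℂ D]

/-- The left factor of the enveloping algebra. -/
def envL (a : D) : env D := a ⊗ₜ 1

/-- The right factor of the enveloping algebra. -/
def envR (a : D) : env D := 1 ⊗ₜ op a

lemma envL_mul (a b : D) : envL (a * b) = envL a * envL b := by
  simp [envL, Algebra.TensorProduct.tmul_mul_tmul]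

lemma envR_mul (a b : D) : envR (a * b) = envR b * envR a := by
  simp [envR, Algebra.TensorProduct.tmul_mul_tmul]

lemma envL_mul_envR (a b : D) : envL a * envR b = a ⊗ₜ op b := by
  simp [envL, envR, Algebra.TensorProduct.tmul_mul_tmul]

lemma envR_mul_envL (a b : D) : envR b * envL a = a ⊗ₜ op b := by
  simp [envL, envR, Algebra.TensorProduct.tmul_mul_tmul]

lemma envL_one : envL (1 : D) = 1 := rfl

lemma envR_one : envR (1 : D) = 1 := rfl

/-- The element `y x ⊗ 1 - y ⊗ x` of the enveloping algebra. -/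
def envComm (x y : D) : env D := envL y * (envL x - envR x)

lemma tmul_mul_envComm (a d x y : D) :
    (a ⊗ₜ op d : env D) * envComm x y = (a * y * x) ⊗ₜ op d - (a * y) ⊗ₜ op (x * d) := by
  simp [envComm, envL, envR, mul_sub, Algebra.TensorProduct.tmul_mul_tmul, mul_assoc]

lemma envComm_eq (x y : D) : envComm x y = (y * x) ⊗ₜ op 1 - y ⊗ₜ op x := by
  rw [← one_mul (envComm x y), ← envL_one, envL, ← op_one, tmul_mul_envComm, one_mul, mul_one]

/-- The elements `d` with `d ⊗ 1 - 1 ⊗ d` in a given left ideal form a subalgebra. -/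
def diffSubalgebra (J : Ideal (env D)) : Subalgebra ℂ D where
  carrier := {d | envL d - envR d ∈ J}
  mul_mem' {a b} ha hb := by
    change envL (a * b) - envR (a * b) ∈ J
    have h : envL (a * b) - envR (a * b) =
        envL a * (envL b - envR b) + envR b * (envL a - envR a) := by
      rw [envL_mul, envR_mul, mul_sub, mul_sub, envL_mul_envR, envR_mul_envL]
      abel
    rw [h]
    exact J.add_mem (J.mul_mem_left _ hb) (J.mul_mem_left _ ha)
  add_mem' {a b} ha hb := by
    change envL (a + b) - envR (a + b) ∈ J
    have h : envL (a + b) - envR (a + b) = envL a - envR a + (envL b - envR b) := by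
      rw [envL, envR, TensorProduct.add_tmul, MulOpposite.op_add, TensorProduct.tmul_add, envL,
        envR, envL,
        envR]
      abel
    rw [h]
    exact J.add_mem ha hb
  algebraMap_mem' c := by
    change envL (algebraMap ℂ D c) - envR (algebraMap ℂ D c) ∈ J
    rw [envL, envR, Algebra.algebraMap_eq_smul_one, op_smul, op_one, TensorProduct.smul_tmul,
      sub_self]
    exact J.zero_mem

lemma mem_diffSubalgebra {J : Ideal (env D)} {d : D} :
    d ∈ diffSubalgebra J ↔ envL d - envR d ∈ J := Iff.rfl

lemma inv_mem_diffSubalgebra {J : Ideal (env D)} {x y : D} (hy : y = 1 ∨ y * x = 1 ∧ x * y = 1)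
    (hx : x ∈ diffSubalgebra J) : y ∈ diffSubalgebra J := by
  rcases hy with rfl | ⟨h1, h2⟩
  · exact one_mem _
  · have h : envL y - envR y = -(envL y * envR y * (envL x - envR x)) := by
      rw [mul_sub, mul_assoc, mul_assoc, ← envR_mul, h2, envR_one, envR_mul_envL,
        ← envL_mul_envR, ← mul_assoc, ← envL_mul, h1, envL_one]
      noncomm_ring
    rw [mem_diffSubalgebra, h]
    exact neg_mem (Ideal.mul_mem_left _ _ hx)

lemma mem_diffSubalgebra_of_envComm_mem {J : Ideal (env D)} {x y : D}
    (hy : y = 1 ∨ y * x = 1 ∧ x * y = 1) (h : envComm x y ∈ J) : x ∈ diffSubalgebra J := by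
  have hyy : ∃ y' : D, y' * y = 1 := by
    rcases hy with rfl | ⟨-, h⟩
    exacts [⟨1, one_mul 1⟩, ⟨x, h⟩]
  obtain ⟨y', hy'⟩ := hyy
  have hx : envL x - envR x = envL y' * envComm x y := by
    rw [envComm, ← mul_assoc, ← envL_mul, hy', envL_one, one_mul]
  rw [mem_diffSubalgebra, hx]
  exact J.mul_mem_left _ h

/-- A basis of `D` consisting of products of "powers of `x`" and elements permuted by left
multiplication by `p`. -/
structure MonomialBasis (x y p : D) (K J : Type) where
  b : Module.Basis (K × J) ℂ D
  sK : K → K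
  sJ : J → J
  degK : K → ℤ
  degJ : J → ℤ
  hsK : Function.Injective sK
  hsJ : Function.Injective sJ
  hdegK : ∀ k, degK k < degK (sK k)
  hdegJ : ∀ j, degJ j < degJ (sJ j)
  k₀ : K
  xs : K → D
  xs_mem : ∀ k, xs k ∈ Algebra.adjoin ℂ {x, y}
  xs_zero : xs k₀ = 1
  x_mul_xs : ∀ k, x * xs k = xs (sK k)
  xs_mul_x : ∀ k, xs k * x = xs (sK k)
  xs_mul_b : ∀ k j, xs k * b (k₀, j) = b (k, j)
  p_mul_b : ∀ j, p * b (k₀, j) = b (k₀, sJ j)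

namespace MonomialBasis

variable {x y p z : D} {K J : Type} (m : MonomialBasis x y p K J)

include m

lemma x_mul_b (k : K) (j : J) : x * m.b (k, j) = m.b (m.sK k, j) := by
  rw [← m.xs_mul_b, ← mul_assoc, m.x_mul_xs, m.xs_mul_b]

/-- The basis of the opposite algebra. -/
def opBasis : Module.Basis (K × J) ℂ Dᵐᵒᵖ := m.b.map (opLinearEquiv ℂ)

lemma opBasis_apply (i : K × J) : m.opBasis i = op (m.b i) := by
  simp [opBasis]

/-- Coordinates on the enveloping algebra. -/
def coord : env D ≃ₗ[ℂ] (K × J →₀ D) := by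
  classical
  exact TensorProduct.equivFinsuppOfBasisRight m.opBasis

lemma coord_symm_single (i : K × J) (a : D) :
    m.coord.symm (Finsupp.single i a) = a ⊗ₜ op (m.b i) := by
  classical
  rw [coord, TensorProduct.equivFinsuppOfBasisRight_symm_apply, Finsupp.sum_single_index,
    opBasis_apply]
  exact TensorProduct.zero_tmul _ _

lemma coord_tmul (i : K × J) (a : D) : m.coord (a ⊗ₜ op (m.b i)) = Finsupp.single i a := by
  rw [← coord_symm_single, LinearEquiv.apply_symm_apply]

lemma env_induction {P : env D → Prop} (t : env D) (h0 : P 0) (hadd : ∀ s t, P s → P t → P (s + t))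
    (hb : ∀ a k j, P (a ⊗ₜ op (m.b (k, j)))) : P t := by
  rw [← m.coord.symm_apply_apply t]
  induction m.coord t using Finsupp.induction_linear with
  | zero => rwa [map_zero]
  | add F G hF hG => rw [map_add]; exact hadd _ _ hF hG
  | single i a => rw [m.coord_symm_single]; exact hb a i.1 i.2

lemma eq_zero_of_mul_envComm (hy : ∀ a : D, a * y = 0 → a = 0) (t : env D)
    (ht : t * envComm x y = 0) : t = 0 := by
  have key : ∀ t : env D, m.coord (t * envComm x y) =
      shiftOp (fun i : K × J => (m.sK i.1, i.2)) (LinearMap.mulRight ℂ (y * x))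
        (LinearMap.mulRight ℂ y) (m.coord t) := by
    intro t
    induction t using m.env_induction with
    | h0 => simp
    | hadd s t hs ht => rw [add_mul, map_add, hs, ht, map_add, map_add]
    | hb a k j =>
      rw [tmul_mul_envComm, m.x_mul_b, map_sub, m.coord_tmul, m.coord_tmul, m.coord_tmul,
        shiftOp_single]
      simp [mul_assoc]
  refine (LinearEquiv.map_eq_zero_iff m.coord).1 (eq_zero_of_shiftOp_eq_zero
    (s := fun i : K × J => (m.sK i.1, i.2)) (fun i j h => ?_) (fun i => m.degK i.1)
    (fun i => m.hdegK i.1) (fun w hw => hy w hw) ((key t).symm.trans (by rw [ht, map_zero])))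
  exact Prod.ext (m.hsK (Prod.ext_iff.1 h).1) (Prod.ext_iff.1 h).2

omit m in
lemma adjoin_le_diffSubalgebra (hy : y = 1 ∨ y * x = 1 ∧ x * y = 1) :
    Algebra.adjoin ℂ {x, y} ≤ diffSubalgebra (Ideal.span {envComm x y}) := by
  have hx := mem_diffSubalgebra_of_envComm_mem hy (Ideal.mem_span_singleton_self (envComm x y))
  refine Algebra.adjoin_le ?_
  rintro d (rfl | rfl)
  exacts [hx, inv_mem_diffSubalgebra hy hx]

/-- The quotient of the enveloping algebra by the left ideal generated by `x ⊗ 1 - 1 ⊗ x`. -/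
def proj : env D →ₗ[ℂ] J →₀ D :=
  (Finsupp.lsum ℂ fun i : K × J => Finsupp.lsingle i.2 ∘ₗ LinearMap.mulRight ℂ (m.xs i.1)) ∘ₗ
    m.coord.toLinearMap

lemma proj_tmul (a : D) (k : K) (j : J) :
    m.proj (a ⊗ₜ op (m.b (k, j))) = Finsupp.single j (a * m.xs k) := by
  rw [proj, LinearMap.comp_apply, LinearEquiv.coe_coe, coord_tmul]
  simp

lemma proj_mul_envComm (t : env D) : m.proj (t * envComm x y) = 0 := by
  induction t using m.env_induction with
  | h0 => simp
  | hadd s t hs ht => rw [add_mul, map_add, hs, ht, add_zero]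
  | hb a k j =>
    rw [tmul_mul_envComm, m.x_mul_b, map_sub, proj_tmul, proj_tmul, mul_assoc _ x, m.x_mul_xs,
      sub_self]

/-- A section of `proj`. -/
def lift : (J →₀ D) →ₗ[ℂ] env D :=
  m.coord.symm.toLinearMap ∘ₗ Finsupp.lmapDomain D ℂ fun j => (m.k₀, j)

lemma lift_single (a : D) (j : J) :
    m.lift (Finsupp.single j a) = a ⊗ₜ op (m.b (m.k₀, j)) := by
  rw [lift, LinearMap.comp_apply, LinearEquiv.coe_coe, Finsupp.lmapDomain_apply,
    Finsupp.mapDomain_single, coord_symm_single]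

lemma sub_lift_proj_mem (hy : y = 1 ∨ y * x = 1 ∧ x * y = 1) (t : env D) :
    t - m.lift (m.proj t) ∈ Ideal.span {envComm x y} := by
  induction t using m.env_induction with
  | h0 => simp
  | hadd s t hs ht =>
    rw [map_add, map_add, add_sub_add_comm]
    exact add_mem hs ht
  | hb a k j =>
    rw [proj_tmul, lift_single, ← m.xs_mul_b]
    have h : (a ⊗ₜ op (m.xs k * m.b (m.k₀, j)) - (a * m.xs k) ⊗ₜ op (m.b (m.k₀, j)) : env D) =
        -((a ⊗ₜ op (m.b (m.k₀, j))) * (envL (m.xs k) - envR (m.xs k))) := by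
      simp [envL, envR, mul_sub, Algebra.TensorProduct.tmul_mul_tmul]
    rw [h]
    exact neg_mem (Ideal.mul_mem_left _ _ (adjoin_le_diffSubalgebra hy (m.xs_mem k)))

lemma exists_eq_mul_envComm (hy : y = 1 ∨ y * x = 1 ∧ x * y = 1)
    (hz : ∀ a : D, a * z = 0 → a = 0)
    (huv : envComm x y * envComm p z = envComm p z * envComm x y) (b t : env D)
    (h : b * envComm p z = t * envComm x y) : ∃ a, b = a * envComm x y := by
  have key : ∀ F : J →₀ D, m.proj (m.lift F * envComm p z) =
      shiftOp m.sJ (LinearMap.mulRight ℂ (z * p)) (LinearMap.mulRight ℂ z) F := by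
    intro F
    induction F using Finsupp.induction_linear with
    | zero => simp
    | add F G hF hG => rw [map_add, add_mul, map_add, hF, hG, map_add]
    | single j a =>
      rw [lift_single, tmul_mul_envComm, m.p_mul_b, map_sub, proj_tmul, proj_tmul, m.xs_zero,
        shiftOp_single]
      simp [mul_assoc]
  obtain ⟨s, hs⟩ := Ideal.mem_span_singleton'.1 (m.sub_lift_proj_mem hy b)
  have h0 : m.proj b = 0 := by
    refine eq_zero_of_shiftOp_eq_zero m.hsJ m.degJ m.hdegJ (fun w hw => hz w hw) ((key _).symm.trans ?_)
    have : m.lift (m.proj b) = b - s * envComm x y := by rw [hs, sub_sub_cancel]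
    rw [this, sub_mul, h, mul_assoc, huv, ← mul_assoc, map_sub, proj_mul_envComm,
      proj_mul_envComm, sub_zero]
  exact ⟨s, by rw [hs, h0, map_zero, sub_zero]⟩

end MonomialBasis

end Bimodule

/-! ### Crossed products with `ℤ/2` -/

/-- The crossed product of `B` with the group of order two generated by the involution `ε`. -/
structure CrossedProduct {B : Type} [Ring B] [Algebra ℂ B] (ε : B ≃ₐ[ℂ] B) (D : Type) [Ring D]
    [Algebra ℂ D] where
  i : B →ₐ[ℂ] D
  g : D
  gg : g * g = 1
  gi : ∀ b, g * i b = i (ε b) * g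
  equiv : (B × B) ≃ₗ[ℂ] D
  equiv_apply : ∀ a b, equiv (a, b) = i a + i b * g

section OfMonoidAlgebra

variable {B : Type} [Ring B] [Algebra ℂ B] {ε : B ≃ₐ[ℂ] B} {D : Type} [Ring D] [Algebra ℂ D]

lemma exists_crossedProduct_of_finsupp
    (e : (Multiplicative (ZMod 2) →₀ B) ≃ₗ[ℂ] D)
    (he : ∀ (g h : Multiplicative (ZMod 2)) (a b : B),
      e (Finsupp.single g a) * e (Finsupp.single h b)
        = e (Finsupp.single (g * h) (a * (if g = 1 then b else ε b)))) :
    Nonempty (CrossedProduct ε D) := by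
  have h0 : ∀ (h : Multiplicative (ZMod 2)) (a b : B),
      e (Finsupp.single 1 a) * e (Finsupp.single h b) = e (Finsupp.single h (a * b)) :=
    fun h a b => by rw [he, if_pos rfl, one_mul]
  obtain ⟨σ, hσ1, hσσ, hcases⟩ : ∃ σ : Multiplicative (ZMod 2),
      σ ≠ 1 ∧ σ * σ = 1 ∧ ∀ s : Multiplicative (ZMod 2), s = 1 ∨ s = σ :=
    ⟨Multiplicative.ofAdd 1, by decide, by decide, by decide⟩
  have h1 : e (Finsupp.single 1 1) = 1 := by
    have hl : ∀ d, e (Finsupp.single 1 1) * d = d := by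
      intro d
      rw [← e.apply_symm_apply d]
      induction e.symm d using Finsupp.induction_linear with
      | zero => rw [map_zero, mul_zero]
      | add f g hf hg => rw [map_add, mul_add, hf, hg]
      | single h b => rw [h0, one_mul]
    rw [← mul_one (e _), hl]
  let i : B →ₐ[ℂ] D := AlgHom.ofLinearMap (e.toLinearMap ∘ₗ Finsupp.lsingle 1) h1
    fun a b => (h0 1 a b).symm
  let eq : (B × B) ≃ₗ[ℂ] (Multiplicative (ZMod 2) →₀ B) :=
    LinearEquiv.ofLinearMap
      (LinearMap.coprod (Finsupp.lsingle 1) (Finsupp.lsingle σ))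
      (LinearMap.prod (Finsupp.lapply 1) (Finsupp.lapply σ))
      (by
        refine Finsupp.lhom_ext fun s b => ?_
        rcases hcases s with rfl | rfl
        · simp [hσ1.symm]
        · simp [hσ1])
      (by
        refine LinearMap.ext fun ⟨a, b⟩ => ?_
        simp [hσ1, hσ1.symm])
  refine ⟨⟨i, e (Finsupp.single σ 1), ?_, fun b => ?_, eq.trans e, fun a b => ?_⟩⟩
  · rw [he, if_neg hσ1, map_one, one_mul, hσσ, h1]
  · change _ * e (Finsupp.single 1 b) = e (Finsupp.single 1 (ε b)) * _
    rw [h0, he, if_neg hσ1, mul_one, one_mul, mul_one]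
  · change e (Finsupp.single 1 a + Finsupp.single σ b) =
      e (Finsupp.single 1 a) + e (Finsupp.single 1 b) * e (Finsupp.single σ 1)
    rw [h0, mul_one, map_add]

lemma exists_crossedProduct
    (e : MonoidAlgebra B (Multiplicative (ZMod 2)) ≃ₗ[ℂ] D)
    (he : ∀ (g h : Multiplicative (ZMod 2)) (a b : B),
      e (MonoidAlgebra.single g a) * e (MonoidAlgebra.single h b)
        = e (MonoidAlgebra.single (g * h) (a * (if g = 1 then b else ε b)))) :
    Nonempty (CrossedProduct ε D) :=
  exists_crossedProduct_of_finsupp ((MonoidAlgebra.coeffLinearEquiv ℂ).symm.trans e) he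

end OfMonoidAlgebra

/-! ### Koszul data for crossed products -/

/-- Either `x` is negated by `ε`, and `y = y' = 1`, or `x` is inverted by `ε`, with inverse `y`,
and `y' = x`. -/
def Reflected {B : Type} [Ring B] [Algebra ℂ B] (ε : B ≃ₐ[ℂ] B) (x y y' : B) : Prop :=
  (y = 1 ∧ y' = 1 ∧ ε x = -x) ∨ (y * x = 1 ∧ x * y = 1 ∧ y' = x ∧ ε x = y)

namespace Reflected

variable {B : Type} [Ring B] [Algebra ℂ B] {ε : B ≃ₐ[ℂ] B} {x y y' : B}

lemma mul_left (h : Reflected ε x y y') : y * y' = 1 := by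
  rcases h with ⟨rfl, rfl, -⟩ | ⟨h1, -, rfl, -⟩
  exacts [one_mul 1, h1]

lemma eq_one_or (h : Reflected ε x y y') : y = 1 ∨ y * x = 1 ∧ x * y = 1 := by
  rcases h with ⟨rfl, rfl, -⟩ | ⟨h1, h2, rfl, -⟩
  exacts [Or.inl rfl, Or.inr ⟨h1, h2⟩]

lemma map_right (h : Reflected ε x y y') : ε y' = y := by
  rcases h with ⟨rfl, rfl, -⟩ | ⟨-, -, rfl, h1⟩
  exacts [map_one ε, h1]

lemma map_left (h : Reflected ε x y y') : ε y = y' := by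
  have h1 : ε y * y = 1 := by rw [← h.map_right, ← map_mul, h.map_right, h.mul_left, map_one]
  rw [← mul_one (ε y), ← h.mul_left, ← mul_assoc, h1, one_mul]

end Reflected

namespace CrossedProduct

variable {B : Type} [Ring B] [Algebra ℂ B] {ε : B ≃ₐ[ℂ] B} {D : Type} [Ring D] [Algebra ℂ D]
  (C : CrossedProduct ε D)

lemma exists_eq (d : D) : ∃ a b, d = C.i a + C.i b * C.g :=
  ⟨(C.equiv.symm d).1, (C.equiv.symm d).2, by rw [← C.equiv_apply, LinearEquiv.apply_symm_apply]⟩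

/-- The map of enveloping algebras induced by the inclusion. -/
def envMap : env B →ₐ[ℂ] env D := Algebra.TensorProduct.map C.i (AlgHom.op C.i)

lemma envMap_tmul (a b : B) : C.envMap (a ⊗ₜ op b) = C.i a ⊗ₜ op (C.i b) := rfl

lemma envMap_envComm (x y : B) : C.envMap (envComm x y) = envComm (C.i x) (C.i y) := by
  rw [envComm_eq, envComm_eq, map_sub, envMap_tmul, envMap_tmul, map_mul, map_one]

/-- The action of the group element on bimodules. -/
def γ₀ : env D := C.g ⊗ₜ op C.g

/-- The twist of `γ₀`. -/
def twist (y y' : B) : env D := C.i y ⊗ₜ op (C.i y')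

lemma γ₀_mul_self : C.γ₀ * C.γ₀ = 1 := by
  rw [γ₀, Algebra.TensorProduct.tmul_mul_tmul, ← op_mul, C.gg]
  rfl

lemma twist_mul_γ₀ (y y' : B) : C.twist y y' * C.γ₀ = (C.i y * C.g) ⊗ₜ op (C.g * C.i y') := by
  rw [twist, γ₀, Algebra.TensorProduct.tmul_mul_tmul, ← op_mul]

variable {x y y' : B}

lemma twist_mul_γ₀_mul_self (h : Reflected ε x y y') :
    C.twist y y' * C.γ₀ * (C.twist y y' * C.γ₀) = 1 := by
  have h1 : C.i y * C.g * (C.i y * C.g) = 1 := by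
    rw [mul_assoc, ← mul_assoc C.g, C.gi, h.map_left, mul_assoc (C.i y'), C.gg, mul_one, ← map_mul,
      h.mul_left, map_one]
  have h2 : C.g * C.i y' * (C.g * C.i y') = 1 := by
    rw [C.gi, h.map_right, h1]
  rw [twist_mul_γ₀, Algebra.TensorProduct.tmul_mul_tmul, ← op_mul, h1, h2]
  rfl

lemma twist_mul_γ₀_mul_envComm (h : Reflected ε x y y') :
    C.twist y y' * C.γ₀ * envComm (C.i x) (C.i y) = -(envComm (C.i x) (C.i y) * C.γ₀) := by
  have hR : envComm (C.i x) (C.i y) * C.γ₀ =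
      (C.i y * C.i x * C.g) ⊗ₜ op C.g - (C.i y * C.g) ⊗ₜ op (C.g * C.i x) := by
    simp [envComm, envL, envR, γ₀, mul_sub, sub_mul, Algebra.TensorProduct.tmul_mul_tmul,
      mul_assoc]
  rw [hR, twist_mul_γ₀, tmul_mul_envComm, neg_sub]
  rcases h with ⟨rfl, rfl, h⟩ | ⟨h1, h2, rfl, h⟩
  · simp [C.gi, h, TensorProduct.neg_tmul, TensorProduct.tmul_neg]
    abel
  · have h3 : ε y = y' := Reflected.map_left (Or.inr ⟨h1, h2, rfl, h⟩)
    have e1 : C.i y * C.g * C.i y = C.g := by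
      rw [mul_assoc, C.gi, h3, ← mul_assoc, ← map_mul, h1, map_one, one_mul]
    have e2 : C.i y' * (C.g * C.i y') = C.g := by
      rw [C.gi, h, ← mul_assoc, ← map_mul, h2, map_one, one_mul]
    have e3 : C.i y * C.i y' * C.g = C.g := by
      rw [← map_mul, h1, map_one, one_mul]
    have e4 : C.g * C.i y' = C.i y * C.g := by rw [C.gi, h]
    rw [e1, e2, e3, e4]

end CrossedProduct

/-- An algebra generated by two elements (and possibly their inverses) with a monomial basis and
an involution, such that the Koszul complex makes sense for its crossed product. -/
structure KoszulAlgebra {B : Type} [Ring B] [Algebra ℂ B] (ε : B ≃ₐ[ℂ] B) where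
  (x y y' p z z' : B)
  hx : Reflected ε x y y'
  hp : Reflected ε p z z'
  gen : Algebra.adjoin ℂ {x, y, p, z} = ⊤
  (K J : Type)
  basis : MonomialBasis x y p K J
  uv : envComm x y * envComm p z = envComm p z * envComm x y
  AB : (y ⊗ₜ op y' : env B) * (z ⊗ₜ op z') = (z ⊗ₜ op z') * (y ⊗ₜ op y')
  Av : (y ⊗ₜ op y') * envComm p z = envComm p z * (y ⊗ₜ op y')
  Bu : (z ⊗ₜ op z') * envComm x y = envComm x y * (z ⊗ₜ op z')

namespace KoszulAlgebra

variable {B : Type} [Ring B] [Algebra ℂ B] {ε : B ≃ₐ[ℂ] B} (S : KoszulAlgebra ε)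
  {D : Type} [Ring D] [Algebra ℂ D] (C : CrossedProduct ε D)

lemma koszulInvolution : KoszulInvolution (envComm (C.i S.x) (C.i S.y))
    (envComm (C.i S.p) (C.i S.z)) C.γ₀ (C.twist S.y S.y') (C.twist S.z S.z') where
  γγ := C.γ₀_mul_self
  AγAγ := C.twist_mul_γ₀_mul_self S.hx
  BγBγ := C.twist_mul_γ₀_mul_self S.hp
  AB := by
    have := congrArg C.envMap S.AB
    rwa [map_mul, map_mul] at this
  uv := by
    have := congrArg C.envMap S.uv
    rwa [map_mul, map_mul, C.envMap_envComm, C.envMap_envComm] at this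
  Aγu := C.twist_mul_γ₀_mul_envComm S.hx
  Bγv := C.twist_mul_γ₀_mul_envComm S.hp
  Av := by
    have := congrArg C.envMap S.Av
    rwa [map_mul, map_mul, C.envMap_envComm] at this
  Bu := by
    have := congrArg C.envMap S.Bu
    rwa [map_mul, map_mul, C.envMap_envComm] at this

/-- The monomial basis of the crossed product. -/
def crossedBasis : MonomialBasis (C.i S.x) (C.i S.y) (C.i S.p) S.K (S.J ⊕ S.J) where
  b := ((S.basis.b.prod S.basis.b).map C.equiv).reindex (Equiv.prodSumDistrib S.K S.J S.J).symm
  sK := S.basis.sK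
  sJ := Sum.map S.basis.sJ S.basis.sJ
  degK := S.basis.degK
  degJ := Sum.elim S.basis.degJ S.basis.degJ
  hsK := S.basis.hsK
  hsJ := Function.Injective.sumMap S.basis.hsJ S.basis.hsJ
  hdegK := S.basis.hdegK
  hdegJ := by
    rintro (j | j)
    exacts [S.basis.hdegJ j, S.basis.hdegJ j]
  k₀ := S.basis.k₀
  xs k := C.i (S.basis.xs k)
  xs_mem k := by
    have h := S.basis.xs_mem k
    have h1 : Algebra.adjoin ℂ {C.i S.x, C.i S.y} =
        (Algebra.adjoin ℂ {S.x, S.y}).map C.i := by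
      rw [AlgHom.map_adjoin, Set.image_pair]
    rw [h1]
    exact ⟨_, h, rfl⟩
  xs_zero := by rw [S.basis.xs_zero, map_one]
  x_mul_xs k := by rw [← map_mul, S.basis.x_mul_xs]
  xs_mul_x k := by rw [← map_mul, S.basis.xs_mul_x]
  xs_mul_b := by
    rintro k (j | j)
    · simp [C.equiv_apply, ← map_mul, S.basis.xs_mul_b]
    · simp [C.equiv_apply, ← mul_assoc, ← map_mul, S.basis.xs_mul_b]
  p_mul_b := by
    rintro (j | j)
    · simp [C.equiv_apply, ← map_mul, S.basis.p_mul_b]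
    · simp [C.equiv_apply, ← mul_assoc, ← map_mul, S.basis.p_mul_b]

attribute [local instance] TensorProduct.Algebra.module

omit S C in
lemma tmul_smul (a b d : D) : (a ⊗ₜ op b : env D) • d = a * d * b := by
  rw [TensorProduct.Algebra.smul_def, mul_assoc]
  rfl

omit S C in
lemma envComm_smul (x y d : D) : envComm x y • d = y * x * d - y * d * x := by
  rw [envComm_eq, sub_smul, tmul_smul, tmul_smul, mul_one]

lemma diffSubalgebra_eq_top (J : Ideal (env D)) (hx : C.i S.x ∈ diffSubalgebra J)
    (hp : C.i S.p ∈ diffSubalgebra J) (hg : C.g ∈ diffSubalgebra J) : diffSubalgebra J = ⊤ := by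
  have hi : ∀ b, C.i b ∈ diffSubalgebra J := by
    have h : Algebra.adjoin ℂ {S.x, S.y, S.p, S.z} ≤ (diffSubalgebra J).comap C.i := by
      refine Algebra.adjoin_le ?_
      have hmap : ∀ {x y y' : B}, Reflected ε x y y' →
          C.i y = 1 ∨ C.i y * C.i x = 1 ∧ C.i x * C.i y = 1 := by
        intro x y y' h
        rcases h.eq_one_or with rfl | ⟨h1, h2⟩
        · exact Or.inl (map_one _)
        · exact Or.inr ⟨by rw [← map_mul, h1, map_one], by rw [← map_mul, h2, map_one]⟩
      rintro b (rfl | rfl | rfl | rfl)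
      exacts [hx, inv_mem_diffSubalgebra (hmap S.hx) hx, hp,
        inv_mem_diffSubalgebra (hmap S.hp) hp]
    rw [S.gen, top_le_iff] at h
    intro b
    have : b ∈ (diffSubalgebra J).comap C.i := h ▸ Algebra.mem_top
    exact this
  refine eq_top_iff.2 fun d _ => ?_
  obtain ⟨a, b, rfl⟩ := C.exists_eq d
  exact add_mem (hi a) (mul_mem (hi b) hg)

lemma mul_halfSum_mem (t : env D) (ht : t • (1 : D) = 0) :
    ∃ a b, t * halfSum C.γ₀ =
      a * envComm (C.i S.x) (C.i S.y) + b * envComm (C.i S.p) (C.i S.z) := by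
  let I : Ideal (env D) :=
    Ideal.span {envComm (C.i S.x) (C.i S.y), envComm (C.i S.p) (C.i S.z)}
  let J : Ideal (env D) := Submodule.comap (LinearMap.toSpanSingleton _ _ (halfSum C.γ₀)) I
  have hJ : ∀ s, s ∈ J ↔ s * halfSum C.γ₀ ∈ I := fun s => Iff.rfl
  have hmap : ∀ {x y y' : B}, Reflected ε x y y' → envComm (C.i x) (C.i y) ∈ I →
      C.i x ∈ diffSubalgebra J := by
    intro x y y' h hI
    refine mem_diffSubalgebra_of_envComm_mem (y := C.i y) ?_ ?_
    · rcases h.eq_one_or with rfl | ⟨h1, h2⟩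
      · exact Or.inl (map_one _)
      · exact Or.inr ⟨by rw [← map_mul, h1, map_one], by rw [← map_mul, h2, map_one]⟩
    · rw [hJ, ← halfSum_neg_mul_comm (C.twist_mul_γ₀_mul_envComm h)]
      exact I.mul_mem_left _ hI
  have htop : diffSubalgebra J = ⊤ := by
    refine S.diffSubalgebra_eq_top C J (hmap S.hx ?_) (hmap S.hp ?_) ?_
    · exact Ideal.subset_span (Or.inl rfl)
    · exact Ideal.subset_span (Or.inr rfl)
    · have h : (envL C.g - envR C.g) * halfSum C.γ₀ = 0 := by
        have h1 : (envL C.g - envR C.g) * C.γ₀ = -(envL C.g - envR C.g) := by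
          simp [envL, envR, CrossedProduct.γ₀, sub_mul, Algebra.TensorProduct.tmul_mul_tmul,
            ← op_mul, C.gg]
        rw [halfSum, mul_smul_comm, mul_add, h1, mul_one, add_neg_cancel, smul_zero]
      rw [mem_diffSubalgebra, hJ, h]
      exact I.zero_mem
  have key : ∀ t : env D, t - envR (t • (1 : D)) ∈ J := by
    intro t
    induction t using TensorProduct.induction_on with
    | zero =>
      have h : (0 : env D) • (1 : D) = 0 := zero_smul (env D) (1 : D)
      change (0 : env D) - _ ∈ J
      rw [h, envR, op_zero, TensorProduct.tmul_zero, sub_zero]; exact J.zero_mem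
    | add s t hs ht =>
      have h : s + t - envR ((s + t) • (1 : D)) =
          s - envR (s • (1 : D)) + (t - envR (t • (1 : D))) := by
        rw [add_smul, envR, MulOpposite.op_add, TensorProduct.tmul_add, envR, envR]
        abel
      rw [h]
      exact add_mem hs ht
    | tmul a b =>
      obtain ⟨b, rfl⟩ := MulOpposite.op_surjective b
      have h : (a ⊗ₜ op b : env D) - envR ((a ⊗ₜ op b : env D) • (1 : D)) =
          envR b * (envL a - envR a) := by
        rw [tmul_smul, mul_one, mul_sub, envR_mul_envL, envR_mul]
      rw [h]
      exact J.mul_mem_left _ (mem_diffSubalgebra.1 (htop ▸ Algebra.mem_top))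
  have h := key t
  rw [ht, envR, op_zero, TensorProduct.tmul_zero, sub_zero, hJ] at h
  obtain ⟨a, b, hab⟩ := Submodule.mem_span_pair.1 h
  exact ⟨a, b, hab.symm⟩

lemma koszulExact : KoszulExact (envComm (C.i S.x) (C.i S.y))
    (envComm (C.i S.p) (C.i S.z)) C.γ₀ (1 : D) := by
  have hcancel : ∀ {x y y' : B}, Reflected ε x y y' → ∀ a : D, a * C.i y = 0 → a = 0 := by
    intro x y y' h a ha
    rw [← mul_one a, ← map_one C.i, ← h.mul_left, map_mul, ← mul_assoc, ha, zero_mul]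
  exact
  { um := by rw [envComm_smul, mul_one, mul_one, sub_self]
    vm := by rw [envComm_smul, mul_one, mul_one, sub_self]
    γm := by rw [CrossedProduct.γ₀, tmul_smul, mul_one, C.gg]
    surj := fun d => ⟨d ⊗ₜ op 1, by rw [tmul_smul, mul_one, mul_one]⟩
    ker := S.mul_halfSum_mem C
    inj := (S.crossedBasis C).eq_zero_of_mul_envComm (hcancel S.hx)
    reg := (S.crossedBasis C).exists_eq_mul_envComm (by
      rcases S.hx.eq_one_or with h | ⟨h1, h2⟩
      · exact Or.inl (by rw [h, map_one])
      · exact Or.inr ⟨by rw [← map_mul, h1, map_one], by rw [← map_mul, h2, map_one]⟩)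
      (hcancel S.hp) (S.koszulInvolution C).uv }

end KoszulAlgebra

/-! ### Hochschild cohomology of crossed products from twisted commutators -/

section TwistedComm

variable {B : Type} [Ring B] [Algebra ℂ B]

/-- The twisted commutator `b ↦ y (x b - b x')`. -/
def twistedComm (x y x' : B) : B →ₗ[ℂ] B :=
  LinearMap.mulLeft ℂ (y * x) - LinearMap.mulLeft ℂ y ∘ₗ LinearMap.mulRight ℂ x'

lemma twistedComm_apply (x y x' b : B) : twistedComm x y x' b = y * x * b - y * b * x' := by
  simp [twistedComm, mul_assoc]

/-- The Koszul cohomology of the untwisted part: scalars in degree zero, at most classes of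
scalars in degree one, and `W` in degree two. -/
structure ScalarKoszul (U V : B →ₗ[ℂ] B) {W : Type} [AddCommGroup W] [Module ℂ W]
    (Θ : B →ₗ[ℂ] W) : Prop where
  zero : ∀ b, U b = 0 → V b = 0 → ∃ c : ℂ, b = algebraMap ℂ B c
  one : ∀ a b, U b = V a →
    ∃ n, ∃ c d : ℂ, a = U n + algebraMap ℂ B c ∧ b = V n + algebraMap ℂ B d
  surj : Function.Surjective Θ
  two : ∀ n, Θ n = 0 ↔ ∃ a b, U b - V a = n

/-- The Koszul cohomology of a regular pair of operators. -/
structure RegularKoszul {N : Type} [AddCommGroup N] [Module ℂ N] (U V : N →ₗ[ℂ] N) {W : Type}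
    [AddCommGroup W] [Module ℂ W] (Θ : N →ₗ[ℂ] W) : Prop where
  zero : ∀ b, U b = 0 → V b = 0 → b = 0
  one : ∀ a b, U b = V a → ∃ n, a = U n ∧ b = V n
  surj : Function.Surjective Θ
  two : ∀ n, Θ n = 0 ↔ ∃ a b, U b - V a = n

end TwistedComm

/-- The Koszul cohomology of the two components of a crossed product. -/
structure KoszulAlgebra.Cohomology {B : Type} [Ring B] [Algebra ℂ B] {ε : B ≃ₐ[ℂ] B}
    (S : KoszulAlgebra ε) (W₁ W₂ : Type) [AddCommGroup W₁] [Module ℂ W₁] [AddCommGroup W₂]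
    [Module ℂ W₂] where
  Θ₁ : B →ₗ[ℂ] W₁
  Θ₂ : B →ₗ[ℂ] W₂
  scalar : ScalarKoszul (twistedComm S.x S.y S.x) (twistedComm S.p S.z S.p) Θ₁
  regular : RegularKoszul (twistedComm S.x S.y (ε S.x)) (twistedComm S.p S.z (ε S.p)) Θ₂
  invariant₁ : ∀ b, Θ₁ (S.y * S.z * ε b * S.z' * S.y') = Θ₁ b
  invariant₂ : ∀ b, Θ₂ (S.y * S.z * ε b * S.z * S.y) = Θ₂ b

namespace KoszulAlgebra

variable {B : Type} [Ring B] [Algebra ℂ B] {ε : B ≃ₐ[ℂ] B} {S : KoszulAlgebra ε}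
  {W₁ W₂ : Type} [AddCommGroup W₁] [Module ℂ W₁] [AddCommGroup W₂] [Module ℂ W₂]
  (H : S.Cohomology W₁ W₂) {D : Type} [Ring D] [Algebra ℂ D] (C : CrossedProduct ε D)

attribute [local instance] TensorProduct.Algebra.module

/-- The actions of `ℂ` and of the enveloping algebra on `D` are compatible. -/
theorem isScalarTower_env (D : Type) [Ring D] [Algebra ℂ D] : IsScalarTower ℂ (env D) D where
  smul_assoc c t d := by
    induction t using TensorProduct.induction_on with
    | zero =>
      have h : (0 : env D) • d = 0 := zero_smul (env D) d
      have h1 : c • (0 : env D) = 0 := smul_zero c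
      exact ((congrArg (· • d) h1).trans h).trans ((smul_zero c).symm.trans (congrArg _ h.symm))
    | add s t hs ht =>
      have h : (s + t) • d = s • d + t • d := add_smul s t d
      have h1 : c • (s + t) = c • s + c • t := smul_add c s t
      have h2 : (c • s + c • t) • d = (c • s) • d + (c • t) • d := add_smul _ _ d
      have h3 : c • (s • d + t • d) = c • s • d + c • t • d := smul_add c (s • d : D) (t • d)
      rw [h1, h2, h, h3]
      exact congrArg₂ (· + ·) hs ht
    | tmul a b =>
      obtain ⟨b, rfl⟩ := MulOpposite.op_surjective b
      rw [TensorProduct.smul_tmul', tmul_smul, tmul_smul, smul_mul_assoc, smul_mul_assoc]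

attribute [local instance] isScalarTower_env

omit S in
lemma envComm_smul_equiv (x y a b : B) : envComm (C.i x) (C.i y) • C.equiv (a, b) =
    C.equiv (twistedComm x y x a, twistedComm x y (ε x) b) := by
  have h : C.i b * C.g * C.i x = C.i (b * ε x) * C.g := by
    rw [mul_assoc, C.gi, map_mul, mul_assoc]
  rw [envComm_smul, C.equiv_apply, C.equiv_apply, twistedComm_apply, twistedComm_apply, mul_add,
    mul_add, add_mul, mul_assoc (C.i y) (C.i b * C.g), h]
  simp only [map_sub, map_mul, sub_mul, mul_assoc]
  abel

variable (S)

/-- The Koszul data of the crossed product. -/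
def koszulData : KoszulData (env D) D := (S.koszulInvolution C).koszulData (S.koszulExact C)

lemma fa_smul_algebraMap (c : ℂ) : (S.koszulData C).fa • (algebraMap ℂ D c) = 0 ∧
    (S.koszulData C).fb • (algebraMap ℂ D c) = 0 := by
  have key : ∀ {x y y' : B}, Reflected ε x y y' →
      halfSum (-(C.twist y y' * C.γ₀)) • (algebraMap ℂ D c) = 0 := by
    intro x y y' h
    have h1 : C.i y * C.g * algebraMap ℂ D c * (C.g * C.i y') = algebraMap ℂ D c := by
      rw [← Algebra.commutes, mul_assoc, mul_assoc, ← mul_assoc C.g, C.gg, one_mul, ← map_mul,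
        h.mul_left, map_one, mul_one]
    rw [halfSum_smul, neg_smul, C.twist_mul_γ₀, tmul_smul, h1, add_neg_cancel, smul_zero]
  exact ⟨key S.hx, key S.hp⟩

variable {S}

include H C

lemma isZero_HHcoh_one : Limits.IsZero (HHcoh D 1) := by
  refine (S.koszulData C).isZero_ext_one (envBimod D) fun a b hab => ?_
  obtain ⟨⟨a₁, a₂⟩, rfl⟩ := C.equiv.surjective a
  obtain ⟨⟨b₁, b₂⟩, rfl⟩ := C.equiv.surjective b
  have h1 := envComm_smul_equiv C S.x S.y b₁ b₂
  have h2 := envComm_smul_equiv C S.p S.z a₁ a₂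
  have h3 := C.equiv.injective ((h1.symm.trans hab).trans h2)
  obtain ⟨n₁, c, d, hc, hd⟩ := H.scalar.one _ _ (Prod.ext_iff.1 h3).1
  obtain ⟨n₂, hc', hd'⟩ := H.regular.one _ _ (Prod.ext_iff.1 h3).2
  have hscal : ∀ (e₁ e₂ : B) (s : ℂ),
      C.equiv (e₁ + algebraMap ℂ B s, e₂) = C.equiv (e₁, e₂) + algebraMap ℂ D s := by
    intro e₁ e₂ s
    rw [C.equiv_apply, C.equiv_apply, map_add, AlgHom.commutes, add_right_comm]
  have ha : C.equiv (a₁, a₂) =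
      envComm (C.i S.x) (C.i S.y) • C.equiv (n₁, n₂) + algebraMap ℂ D c := by
    rw [envComm_smul_equiv, ← hscal, ← hc, ← hc']
  have hb : C.equiv (b₁, b₂) =
      envComm (C.i S.p) (C.i S.z) • C.equiv (n₁, n₂) + algebraMap ℂ D d := by
    rw [envComm_smul_equiv, ← hscal, ← hd, ← hd']
  refine ⟨C.equiv (n₁, n₂), ?_, ?_⟩
  · rw [ha]
    refine (smul_add (S.koszulData C).fa (_ : D) _).trans ?_
    rw [(S.fa_smul_algebraMap C c).1, add_zero, ← mul_smul]
    exact (congrArg (· • C.equiv (n₁, n₂)) (S.koszulData C).fau).trans (mul_smul _ _ _)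
  · rw [hb]
    refine (smul_add (S.koszulData C).fb (_ : D) _).trans ?_
    rw [(S.fa_smul_algebraMap C d).2, add_zero, ← mul_smul]
    exact (congrArg (· • C.equiv (n₁, n₂)) (S.koszulData C).fbv).trans (mul_smul _ _ _)

lemma isZero_HHcoh (i : ℕ) (h0 : i ≠ 0) (h2 : i ≠ 2) : Limits.IsZero (HHcoh D i) := by
  obtain rfl | ⟨n, rfl⟩ : i = 1 ∨ ∃ n, i = n + 3 := by
    rcases Nat.lt_or_ge i 3 with h | h
    · left; omega
    · exact Or.inr ⟨i - 3, by omega⟩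
  · exact isZero_HHcoh_one H C
  · exact (S.koszulData C).isZero_ext_of_three_le (envBimod D) n

lemma nonempty_HHcoh_zero_iso [Nontrivial B] : Nonempty (HHcoh D 0 ≅ ModuleCat.of ℂ ℂ) := by
  have hD : (1 : D) ≠ 0 := by
    intro h
    have h1 : C.equiv (1, 0) = C.equiv 0 := by
      rw [C.equiv_apply, map_one, map_zero, zero_mul, add_zero, h, map_zero]
    exact one_ne_zero (Prod.ext_iff.1 (C.equiv.injective h1)).1
  refine (S.koszulData C).nonempty_ext_zero_iso (envBimod D) (1 : D) hD (S.koszulData C).f₀m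
    fun n => ⟨?_, ?_⟩
  · obtain ⟨⟨a, b⟩, rfl⟩ := C.equiv.surjective n
    rintro ⟨hu, hv⟩
    have h1 := C.equiv.map_eq_zero_iff.1 ((envComm_smul_equiv C S.x S.y a b).symm.trans hu)
    have h2 := C.equiv.map_eq_zero_iff.1 ((envComm_smul_equiv C S.p S.z a b).symm.trans hv)
    obtain ⟨c, rfl⟩ := H.scalar.zero a (Prod.ext_iff.1 h1).1 (Prod.ext_iff.1 h2).1
    obtain rfl := H.regular.zero b (Prod.ext_iff.1 h1).2 (Prod.ext_iff.1 h2).2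
    refine ⟨c, ?_⟩
    rw [C.equiv_apply, map_zero, zero_mul, add_zero, AlgHom.commutes]
    exact (algebraMap_smul (env D) c (1 : D)).trans (Algebra.algebraMap_eq_smul_one c).symm
  · rintro ⟨c, rfl⟩
    constructor
    · rw [← mul_smul, ← Algebra.commutes, mul_smul]
      exact (congrArg _ (S.koszulData C).um).trans (smul_zero _)
    · rw [← mul_smul, ← Algebra.commutes, mul_smul]
      exact (congrArg _ (S.koszulData C).vm).trans (smul_zero _)

lemma nonempty_HHcoh_two_iso {W : Type} [AddCommGroup W] [Module ℂ W] (w : (W₁ × W₂) ≃ₗ[ℂ] W) :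
    Nonempty (HHcoh D 2 ≅ ModuleCat.of ℂ W) := by
  let Θ : D →ₗ[ℂ] W := w.toLinearMap ∘ₗ H.Θ₁.prodMap H.Θ₂ ∘ₗ C.equiv.symm.toLinearMap
  have hΘ : ∀ a b, Θ (C.equiv (a, b)) = w (H.Θ₁ a, H.Θ₂ b) := fun a b => by simp [Θ]
  refine (S.koszulData C).nonempty_ext_two_iso (envBimod D) Θ.toAddMonoidHom (fun c n => ?_)
    (fun t => ?_) (fun n => ?_) fun n => ?_
  · exact (congrArg Θ (algebraMap_smul (env D) c (n : D))).trans (map_smul Θ c n)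
  · obtain ⟨⟨s₁, s₂⟩, rfl⟩ := w.surjective t
    obtain ⟨a, rfl⟩ := H.scalar.surj s₁
    obtain ⟨b, rfl⟩ := H.regular.surj s₂
    exact ⟨C.equiv (a, b), hΘ a b⟩
  · obtain ⟨⟨a, b⟩, rfl⟩ := C.equiv.surjective n
    have h : (C.twist S.y S.y' * C.twist S.z S.z' * C.γ₀) • C.equiv (a, b) =
        C.equiv (S.y * S.z * ε a * S.z' * S.y', S.y * S.z * ε b * S.z * S.y) := by
      rw [CrossedProduct.twist, CrossedProduct.twist, CrossedProduct.γ₀,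
        Algebra.TensorProduct.tmul_mul_tmul, Algebra.TensorProduct.tmul_mul_tmul, ← op_mul,
        ← op_mul, tmul_smul, C.equiv_apply, C.equiv_apply, mul_add, add_mul]
      congr 1
      · rw [mul_assoc _ C.g, C.gi, mul_assoc _ _ (C.g * _), mul_assoc _ C.g (C.g * _),
          ← mul_assoc C.g C.g, C.gg, one_mul]
        simp only [map_mul, mul_assoc]
      · rw [← mul_assoc _ (C.i b), mul_assoc _ C.g (C.i b), C.gi, mul_assoc _ C.g,
          ← mul_assoc C.g C.g, C.gg, one_mul, mul_assoc _ (_ * C.g), mul_assoc _ C.g,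
          ← map_mul _ S.z',
          C.gi, map_mul, S.hx.map_right, S.hp.map_right]
        simp only [map_mul, mul_assoc]
    have h2 : Θ (halfSum (C.twist S.y S.y' * C.twist S.z S.z' * C.γ₀) • C.equiv (a, b)) =
        Θ (C.equiv (a, b)) := by
      rw [halfSum_smul, h, map_smul, map_add, hΘ, hΘ, H.invariant₁, H.invariant₂,
        ← two_smul ℂ, smul_smul]
      norm_num
    exact h2
  · obtain ⟨⟨m₁, m₂⟩, rfl⟩ := C.equiv.surjective n
    have h : Θ (C.equiv (m₁, m₂)) = 0 ↔ H.Θ₁ m₁ = 0 ∧ H.Θ₂ m₂ = 0 := by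
      rw [hΘ, w.map_eq_zero_iff, Prod.mk_eq_zero]
    refine h.trans ?_
    rw [H.scalar.two, H.regular.two]
    have hU : ∀ a b, (S.koszulData C).u • C.equiv (a, b) = _ := envComm_smul_equiv C S.x S.y
    have hV : ∀ a b, (S.koszulData C).v • C.equiv (a, b) = _ := envComm_smul_equiv C S.p S.z
    constructor
    · rintro ⟨⟨a₁, b₁, rfl⟩, a₂, b₂, rfl⟩
      refine ⟨C.equiv (a₁, a₂), C.equiv (b₁, b₂), ?_⟩
      refine (congrArg₂ (· - ·) (hU b₁ b₂) (hV a₁ a₂)).trans ?_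
      exact (map_sub C.equiv _ _).symm
    · rintro ⟨a, b, hab⟩
      obtain ⟨⟨a₁, a₂⟩, rfl⟩ := C.equiv.surjective a
      obtain ⟨⟨b₁, b₂⟩, rfl⟩ := C.equiv.surjective b
      have h3 := (congrArg₂ (· - ·) (hU b₁ b₂) (hV a₁ a₂)).symm.trans hab
      have h4 := C.equiv.injective ((map_sub C.equiv _ _).trans h3)
      exact ⟨⟨a₁, b₁, (Prod.ext_iff.1 h4).1⟩, a₂, b₂, (Prod.ext_iff.1 h4).2⟩

end KoszulAlgebra

/-! ### Bases of monomials from representations -/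

section MonomialModel

variable {B : Type} [Ring B] [Algebra ℂ B] {ι : Type}

lemma linearCombination_rep {G : Set B} (hG : Algebra.adjoin ℂ G = ⊤)
    (ρ : B →ₐ[ℂ] Module.End ℂ (ι →₀ ℂ)) (m : ι → B)
    (hm : ∀ g ∈ G, ∀ i, Finsupp.linearCombination ℂ m (ρ g (Finsupp.single i 1)) = g * m i)
    (b : B) (v : ι →₀ ℂ) :
    Finsupp.linearCombination ℂ m (ρ b v) = b * Finsupp.linearCombination ℂ m v := by
  have hb : b ∈ Algebra.adjoin ℂ G := hG ▸ Algebra.mem_top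
  induction hb using Algebra.adjoin_induction generalizing v with
  | mem g hg =>
    have h : Finsupp.linearCombination ℂ m ∘ₗ ρ g =
        LinearMap.mulLeft ℂ g ∘ₗ Finsupp.linearCombination ℂ m := by
      refine Finsupp.lhom_ext' fun i => LinearMap.ext_ring ?_
      simpa using hm g hg i
    exact LinearMap.congr_fun h v
  | algebraMap c =>
    rw [AlgHom.commutes, ← Algebra.smul_def, ← map_smul]
    rfl
  | add a b _ _ ha hb => rw [map_add, LinearMap.add_apply, map_add, ha, hb, add_mul]
  | mul a b _ _ ha hb => rw [map_mul, Module.End.mul_apply, ha, hb, mul_assoc]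

/-- A family of elements of an algebra is a basis if the algebra acts on the free module on the
index set by the rules that hold for left multiplication on the family. -/
def basisOfRep {G : Set B} (hG : Algebra.adjoin ℂ G = ⊤) (ρ : B →ₐ[ℂ] Module.End ℂ (ι →₀ ℂ))
    (m : ι → B)
    (hm : ∀ g ∈ G, ∀ i, Finsupp.linearCombination ℂ m (ρ g (Finsupp.single i 1)) = g * m i)
    (i₀ : ι) (h₀ : m i₀ = 1)
    (hρ : ∀ i, ρ (m i) (Finsupp.single i₀ 1) = Finsupp.single i 1) : Module.Basis ι ℂ B :=
  .ofRepr <| LinearEquiv.ofLinearMap (LinearMap.applyₗ (Finsupp.single i₀ 1) ∘ₗ ρ.toLinearMap)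
    (Finsupp.linearCombination ℂ m)
    (by
      refine Finsupp.lhom_ext' fun i => LinearMap.ext_ring ?_
      simpa using hρ i)
    (by
      ext b
      have := linearCombination_rep hG ρ m hm b (Finsupp.single i₀ 1)
      simpa [h₀] using this)

@[simp]
lemma basisOfRep_apply {G : Set B} (hG : Algebra.adjoin ℂ G = ⊤)
    (ρ : B →ₐ[ℂ] Module.End ℂ (ι →₀ ℂ)) (m : ι → B)
    (hm : ∀ g ∈ G, ∀ i, Finsupp.linearCombination ℂ m (ρ g (Finsupp.single i 1)) = g * m i)
    (i₀ : ι) (h₀ : m i₀ = 1)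
    (hρ : ∀ i, ρ (m i) (Finsupp.single i₀ 1) = Finsupp.single i 1) (i : ι) :
    basisOfRep hG ρ m hm i₀ h₀ hρ i = m i := by
  simp [basisOfRep]

/-- A quotient of a free algebra is generated by the images of the generators. -/
lemma adjoin_range_mkAlgHom {X : Type} (r : FreeAlgebra ℂ X → FreeAlgebra ℂ X → Prop) :
    Algebra.adjoin ℂ (Set.range fun i => RingQuot.mkAlgHom ℂ r (FreeAlgebra.ι ℂ i)) = ⊤ := by
  rw [← Function.comp_def, Set.range_comp, ← AlgHom.map_adjoin, FreeAlgebra.adjoin_range_ι,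
    Algebra.map_top, AlgHom.range_eq_top]
  exact RingQuot.mkAlgHom_surjective ℂ r

end MonomialModel

/-! ### Koszul cohomology of pairs of operators -/

section Koszul

variable {N M W : Type} [AddCommGroup N] [Module ℂ N] [AddCommGroup M] [Module ℂ M]
  [AddCommGroup W] [Module ℂ W]

namespace RegularKoszul

/-- A regular sequence of two operators gives a regular pair. -/
lemma of_quotient {U V : N →ₗ[ℂ] N} {V' : M →ₗ[ℂ] M} {Ψ : N →ₗ[ℂ] M} {Θ : M →ₗ[ℂ] W}
    (hUV : ∀ n, U (V n) = V (U n)) (hU : ∀ n, U n = 0 → n = 0) (hΨ : Function.Surjective Ψ)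
    (hker : ∀ n, Ψ n = 0 ↔ ∃ b, U b = n) (hV : ∀ n, Ψ (V n) = V' (Ψ n))
    (hV' : ∀ m, V' m = 0 → m = 0) (hΘ : Function.Surjective Θ)
    (hker' : ∀ m, Θ m = 0 ↔ ∃ b, V' b = m) : RegularKoszul U V (Θ ∘ₗ Ψ) where
  zero b hb _ := hU b hb
  one a b hab := by
    have h : Ψ a = 0 := hV' _ (by rw [← hV, ← hab]; exact (hker _).2 ⟨b, rfl⟩)
    obtain ⟨n, rfl⟩ := (hker a).1 h
    refine ⟨n, rfl, sub_eq_zero.1 (hU _ ?_)⟩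
    rw [map_sub, hab, hUV, sub_self]
  surj := hΘ.comp hΨ
  two n := by
    rw [LinearMap.comp_apply, hker']
    constructor
    · rintro ⟨m, hm⟩
      obtain ⟨a, rfl⟩ := hΨ m
      obtain ⟨b, hb⟩ := (hker (n - V a)).1 (by rw [map_sub, hV, hm, sub_self])
      exact ⟨-a, b, by rw [hb, map_neg]; abel⟩
    · rintro ⟨a, b, rfl⟩
      refine ⟨Ψ (-a), ?_⟩
      rw [← hV, map_sub, (hker (U b)).2 ⟨b, rfl⟩, zero_sub, ← map_neg, map_neg V]

lemma symm {U V : N →ₗ[ℂ] N} {Θ : N →ₗ[ℂ] W} (h : RegularKoszul U V Θ) :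
    RegularKoszul V U Θ where
  zero b hb hb' := h.zero b hb' hb
  one a b hab := by
    obtain ⟨n, h1, h2⟩ := h.one b a hab.symm
    exact ⟨n, h2, h1⟩
  surj := h.surj
  two n := by
    rw [h.two]
    constructor <;>
    · rintro ⟨a, b, rfl⟩
      exact ⟨-b, -a, by rw [map_neg, map_neg]; abel⟩

lemma transport (φ : M ≃ₗ[ℂ] N) {U V : N →ₗ[ℂ] N} {U' V' : M →ₗ[ℂ] M} {Θ : N →ₗ[ℂ] W}
    (h : RegularKoszul U V Θ) (hU : ∀ m, φ (U' m) = U (φ m)) (hV : ∀ m, φ (V' m) = V (φ m)) :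
    RegularKoszul U' V' (Θ ∘ₗ φ.toLinearMap) where
  zero b hb hb' := by
    refine φ.map_eq_zero_iff.1 (h.zero _ ?_ ?_)
    · rw [← hU, hb, map_zero]
    · rw [← hV, hb', map_zero]
  one a b hab := by
    obtain ⟨n, h1, h2⟩ := h.one (φ a) (φ b) (by rw [← hU, ← hV, hab])
    obtain ⟨n, rfl⟩ := φ.surjective n
    rw [← hU] at h1
    rw [← hV] at h2
    exact ⟨n, φ.injective h1, φ.injective h2⟩
  surj := h.surj.comp φ.surjective
  two n := by
    refine (h.two (φ n)).trans ⟨?_, ?_⟩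
    · rintro ⟨a, b, hab⟩
      obtain ⟨a, rfl⟩ := φ.surjective a
      obtain ⟨b, rfl⟩ := φ.surjective b
      rw [← hU, ← hV, ← map_sub] at hab
      exact ⟨a, b, φ.injective hab⟩
    · rintro ⟨a, b, rfl⟩
      exact ⟨φ a, φ b, by rw [map_sub, hU, hV]⟩

end RegularKoszul

/-- If `U` is surjective and `V` is surjective on its kernel up to scalars, then the scalar
part has no cohomology in degree two. -/
lemma ScalarKoszul.of_surjective {B : Type} [Ring B] [Algebra ℂ B] {U V : B →ₗ[ℂ] B}
    (hUV : ∀ n, U (V n) = V (U n))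
    (zero : ∀ b, U b = 0 → V b = 0 → ∃ c : ℂ, b = algebraMap ℂ B c)
    (hU : Function.Surjective U)
    (hker : ∀ w, U w = 0 → ∃ m, U m = 0 ∧ ∃ c : ℂ, w = V m + algebraMap ℂ B c) :
    ScalarKoszul U V (0 : B →ₗ[ℂ] PUnit) where
  zero := zero
  one a b hab := by
    obtain ⟨n, rfl⟩ := hU a
    obtain ⟨m, hm, c, hc⟩ := hker (b - V n) (by rw [map_sub, hab, hUV, sub_self])
    refine ⟨n + m, 0, c, ?_, ?_⟩
    · rw [map_add, hm, add_zero, map_zero, add_zero]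
    · rw [map_add, add_assoc, ← hc, add_sub_cancel]
  surj w := ⟨0, rfl⟩
  two n := by
    refine iff_of_true rfl ?_
    obtain ⟨b, rfl⟩ := hU n
    exact ⟨0, b, by rw [map_zero, sub_zero]⟩

end Koszul

/-! ### Diagonal and shift operators on finitely supported functions -/

section Diagonal

variable {K W W' : Type} [AddCommGroup W] [Module ℂ W] [AddCommGroup W'] [Module ℂ W']

/-- The diagonal operator with entries `α k`. -/
def diagOp (α : K → W →ₗ[ℂ] W') : (K →₀ W) →ₗ[ℂ] (K →₀ W') :=
  Finsupp.lsum ℂ fun k => Finsupp.lsingle k ∘ₗ α k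

@[simp]
lemma diagOp_single (α : K → W →ₗ[ℂ] W') (k : K) (w : W) :
    diagOp α (Finsupp.single k w) = Finsupp.single k (α k w) := by
  simp [diagOp]

@[simp]
lemma diagOp_apply (α : K → W →ₗ[ℂ] W') (F : K →₀ W) (k : K) : diagOp α F k = α k (F k) := by
  classical
  induction F using Finsupp.induction_linear with
  | zero => simp
  | add F G hF hG => simp [hF, hG]
  | single j w =>
    rw [diagOp_single]
    by_cases h : j = k
    · subst h; simp
    · simp [Finsupp.single_eq_of_ne' h]

lemma eq_zero_of_diagOp_eq_zero {α : K → W →ₗ[ℂ] W'} (hα : ∀ k w, α k w = 0 → w = 0) {F : K →₀ W}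
    (hF : diagOp α F = 0) : F = 0 := by
  ext k
  exact hα k _ (by rw [← diagOp_apply, hF, Finsupp.zero_apply])

lemma exists_diagOp_eq {α : K → W →ₗ[ℂ] W'} {F : K →₀ W'} (hF : ∀ k, ∃ w, α k w = F k) :
    ∃ G, diagOp α G = F := by
  rw [← LinearMap.mem_range, ← Finsupp.sum_single F]
  refine sum_mem fun k _ => ?_
  obtain ⟨w, hw⟩ := hF k
  exact ⟨Finsupp.single k w, by rw [diagOp_single, hw]⟩

lemma diagOp_surjective {α : K → W →ₗ[ℂ] W'} (hα : ∀ k, Function.Surjective (α k)) :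
    Function.Surjective (diagOp α) := fun _ => exists_diagOp_eq fun k => hα k _

lemma exists_diagOp_eq_iff {W'' : Type} [AddCommGroup W''] [Module ℂ W''] {α : K → W →ₗ[ℂ] W'}
    {β : K → W' →ₗ[ℂ] W''} (h : ∀ k w, β k w = 0 ↔ ∃ v, α k v = w) (F : K →₀ W') :
    diagOp β F = 0 ↔ ∃ G, diagOp α G = F := by
  constructor
  · intro hF
    refine exists_diagOp_eq fun k => (h k _).1 ?_
    rw [← diagOp_apply, hF, Finsupp.zero_apply]
  · rintro ⟨G, rfl⟩
    ext k
    rw [diagOp_apply, diagOp_apply, Finsupp.zero_apply]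
    exact (h k _).2 ⟨_, rfl⟩

variable (W) in
/-- The operator `e_k ↦ e_k - e_{k-2}`. -/
def subShift : (ℤ →₀ W) →ₗ[ℂ] (ℤ →₀ W) := shiftOp (· - 2) LinearMap.id LinearMap.id

@[simp]
lemma subShift_single (k : ℤ) (w : W) :
    subShift W (Finsupp.single k w) = Finsupp.single k w - Finsupp.single (k - 2) w := by
  simp [subShift]

variable (W) in
/-- The sum over parity classes. -/
def paritySum : (ℤ →₀ W) →ₗ[ℂ] (ZMod 2 →₀ W) := Finsupp.lmapDomain W ℂ Int.cast

@[simp]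
lemma paritySum_single (k : ℤ) (w : W) :
    paritySum W (Finsupp.single k w) = Finsupp.single (k : ZMod 2) w := by
  simp [paritySum]

lemma paritySum_surjective : Function.Surjective (paritySum W) :=
  Finsupp.mapDomain_surjective ZMod.intCast_surjective

lemma single_sub_single_mem_range {k l : ℤ} (h : (k : ZMod 2) = l) (w : W) :
    Finsupp.single k w - Finsupp.single l w ∈ LinearMap.range (subShift W) := by
  obtain ⟨n, hn⟩ := (ZMod.intCast_eq_intCast_iff_dvd_sub l k 2).1 h.symm
  obtain rfl : k = l + 2 * n := by push_cast at hn; omega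
  clear h hn
  induction n using Int.induction_on with
  | zero => simp
  | succ n ih =>
    have h : subShift W (Finsupp.single (l + 2 * (n + 1)) w) ∈ LinearMap.range (subShift W) :=
      LinearMap.mem_range_self _ _
    rw [subShift_single, show l + 2 * ((n : ℤ) + 1) - 2 = l + 2 * n by ring] at h
    simpa using add_mem h ih
  | pred n ih =>
    have h : subShift W (Finsupp.single (l + 2 * (-(n : ℤ))) w) ∈ LinearMap.range (subShift W) :=
      LinearMap.mem_range_self _ _
    rw [subShift_single, show l + 2 * (-(n : ℤ)) - 2 = l + 2 * (-(n : ℤ) - 1) by ring] at h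
    simpa using sub_mem ih h

lemma paritySum_eq_zero_iff (F : ℤ →₀ W) : paritySum W F = 0 ↔ ∃ G, subShift W G = F := by
  constructor
  · intro hF
    let lift : (ZMod 2 →₀ W) →ₗ[ℂ] (ℤ →₀ W) := Finsupp.lmapDomain W ℂ fun i => (i.val : ℤ)
    have h : ∀ F, F - lift (paritySum W F) ∈ LinearMap.range (subShift W) := by
      intro F
      induction F using Finsupp.induction_linear with
      | zero => simp
      | add F G hF hG =>
        rw [map_add, map_add, add_sub_add_comm]
        exact add_mem hF hG
      | single k w =>
        have : lift (paritySum W (Finsupp.single k w)) =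
            Finsupp.single ((k : ZMod 2).val : ℤ) w := by
          simp [lift, -ZMod.natCast_val]
        rw [this]
        refine single_sub_single_mem_range ?_ w
        simp
    have := h F
    rwa [hF, map_zero, sub_zero] at this
  · rintro ⟨G, rfl⟩
    have h : paritySum W ∘ₗ subShift W = 0 := by
      refine Finsupp.lhom_ext fun k w => ?_
      have h2 : (2 : ZMod 2) = 0 := rfl
      simp [h2]
    exact LinearMap.congr_fun h G

lemma eq_zero_of_subShift_eq_zero {F : ℤ →₀ W} (hF : subShift W F = 0) : F = 0 :=
  eq_zero_of_shiftOp_eq_zero (fun a b h => by simpa using h) (fun k => -k) (fun k => by simp)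
    (fun w h => h) hF

end Diagonal

/-! ### Algebras with a basis of monomials `x_k p^l` -/

section PolyModel

variable {B : Type} [Ring B] [Algebra ℂ B] {K : Type} {xs : K → B} {p : B}
  (b : Module.Basis (K × ℕ) ℂ B) (hb : ∀ k l, b (k, l) = xs k * p ^ l)

/-- The coefficients, polynomials in `p`, of the monomials `x_k`. -/
def polyCoeff : B ≃ₗ[ℂ] (K →₀ Polynomial ℂ) :=
  b.equiv (Finsupp.basis fun _ => Polynomial.basisMonomials ℂ) (Equiv.sigmaEquivProd K ℕ).symm

include hb

lemma polyCoeff_mul_aeval (k : K) (f : Polynomial ℂ) :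
    polyCoeff b (xs k * Polynomial.aeval p f) = Finsupp.single k f := by
  have h : (polyCoeff b).toLinearMap ∘ₗ LinearMap.mulLeft ℂ (xs k) ∘ₗ
      (Polynomial.aeval p).toLinearMap = Finsupp.lsingle k := by
    refine (Polynomial.basisMonomials ℂ).ext fun l => ?_
    have h1 : polyCoeff b (b (k, l)) =
        Finsupp.single k (Polynomial.monomial l (1 : ℂ)) := by
      simp [polyCoeff, Finsupp.coe_basis]
    rw [hb] at h1
    simpa [Polynomial.aeval_monomial] using h1
  exact LinearMap.congr_fun h f

lemma polyCoeff_symm_single (k : K) (f : Polynomial ℂ) :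
    (polyCoeff b).symm (Finsupp.single k f) = xs k * Polynomial.aeval p f := by
  rw [LinearEquiv.symm_apply_eq, polyCoeff_mul_aeval b hb]

lemma polyCoeff_comm {U : B →ₗ[ℂ] B} {U' : (K →₀ Polynomial ℂ) →ₗ[ℂ] (K →₀ Polynomial ℂ)}
    (h : ∀ k f, polyCoeff b (U (xs k * Polynomial.aeval p f)) = U' (Finsupp.single k f)) (a : B) :
    polyCoeff b (U a) = U' (polyCoeff b a) := by
  obtain ⟨F, rfl⟩ := (polyCoeff b).symm.surjective a
  rw [LinearEquiv.apply_symm_apply]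
  have h1 : (polyCoeff b).toLinearMap ∘ₗ U ∘ₗ (polyCoeff b).symm.toLinearMap = U' :=
    Finsupp.lhom_ext fun k f => by
      simpa [polyCoeff_symm_single b hb] using h k f
  exact LinearMap.congr_fun h1 F

end PolyModel

/-! ### The Weyl algebra -/

section WeylRelation

variable {B : Type} [Ring B] [Algebra ℂ B] {x p : B}

lemma mul_pow_of_weyl (hxp : x * p = p * x + 1) (k : ℕ) :
    p * x ^ k = x ^ k * p - (k : ℂ) • x ^ (k - 1) := by
  induction k with
  | zero => simp
  | succ k ih =>
    have h : p * x = x * p - 1 := by rw [hxp]; abel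
    have h2 : (k : ℂ) • (x ^ (k - 1) * x) = (k : ℂ) • x ^ k := by
      rcases k with _ | k
      · simp
      · rw [Nat.add_sub_cancel, pow_succ]
    rw [pow_succ, ← mul_assoc, ih, sub_mul, mul_assoc, h, smul_mul_assoc, h2, mul_sub, mul_one,
      Nat.add_sub_cancel, Nat.cast_succ, add_smul, one_smul, mul_assoc]
    abel

lemma aeval_mul_of_weyl (hxp : x * p = p * x + 1) (f : Polynomial ℂ) : Polynomial.aeval p f * x =
    x * Polynomial.aeval p f - Polynomial.aeval p (Polynomial.derivative f) := by
  have h : p * x = x * p - 1 := by rw [hxp]; abel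
  induction f using Polynomial.induction_on' with
  | add f g hf hg => simp only [map_add, add_mul, mul_add, hf, hg]; abel
  | monomial n c =>
    induction n with
    | zero => simp [Algebra.commutes]
    | succ n ih =>
      have h1 : Polynomial.monomial (n + 1) c = Polynomial.monomial n c * Polynomial.X := by
        rw [Polynomial.monomial_mul_X]
      rw [h1, map_mul, Polynomial.aeval_X, mul_assoc, h, mul_sub, ← mul_assoc, ih,
        Polynomial.derivative_mul, Polynomial.derivative_X, map_add, map_mul, map_mul,
        Polynomial.aeval_X, map_one, sub_mul, mul_assoc]
      abel

/-- Generators of the Weyl algebra for which the ordered monomials form a basis. -/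
structure WeylBasis {B : Type} [Ring B] [Algebra ℂ B] (x p : B) where
  rel : x * p = p * x + 1
  gen : Algebra.adjoin ℂ {x, p} = ⊤
  b : Module.Basis (ℕ × ℕ) ℂ B
  b_apply : ∀ k l, b (k, l) = x ^ k * p ^ l

namespace WeylBasis

variable (H : WeylBasis x p)

/-- The monomial basis of the Weyl algebra. -/
def monomialBasis (H : WeylBasis x p) : MonomialBasis x 1 p ℕ ℕ where
  b := H.b
  sK := Nat.succ
  sJ := Nat.succ
  degK := Nat.cast
  degJ := Nat.cast
  hsK := Nat.succ_injective
  hsJ := Nat.succ_injective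
  hdegK k := by simp
  hdegJ k := by simp
  k₀ := 0
  xs k := x ^ k
  xs_mem k := Subalgebra.pow_mem _ (Algebra.subset_adjoin (Set.mem_insert x _)) k
  xs_zero := pow_zero x
  x_mul_xs k := (pow_succ' x k).symm
  xs_mul_x k := (pow_succ x k).symm
  xs_mul_b k j := by simp [H.b_apply]
  p_mul_b j := by simp [H.b_apply, pow_succ']

variable {ε : B ≃ₐ[ℂ] B} (hx : ε x = -x) (hp : ε p = -p)

/-- The Koszul algebra structure of the Weyl algebra. -/
def koszulAlgebra : KoszulAlgebra ε where
  x := x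
  y := 1
  y' := 1
  p := p
  z := 1
  z' := 1
  hx := Or.inl ⟨rfl, rfl, hx⟩
  hp := Or.inl ⟨rfl, rfl, hp⟩
  gen := by
    refine eq_top_iff.2 (H.gen.symm.le.trans (Algebra.adjoin_mono ?_))
    rintro _ (rfl | rfl) <;> simp
  K := ℕ
  J := ℕ
  basis := H.monomialBasis
  uv := by
    simp only [envComm_eq, mul_sub, sub_mul, Algebra.TensorProduct.tmul_mul_tmul, ← op_mul,
      one_mul, mul_one, H.rel, TensorProduct.add_tmul, MulOpposite.op_add, TensorProduct.tmul_add]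
    abel
  AB := rfl
  Av := by
    have h : (1 : B) ⊗ₜ op (1 : B) = (1 : env B) := rfl
    rw [h, one_mul, mul_one]
  Bu := by
    have h : (1 : B) ⊗ₜ op (1 : B) = (1 : env B) := rfl
    rw [h, one_mul, mul_one]

end WeylBasis

end WeylRelation

namespace Weyl

lemma x_mul_p : x * p = p * x + 1 := by
  have := RingQuot.mkAlgHom_rel ℂ weylRel.rel
  simpa [x, p] using this

lemma adjoin_eq_top : Algebra.adjoin ℂ {x, p} = ⊤ := by
  rw [← adjoin_range_mkAlgHom weylRel]
  congr 1
  ext b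
  simp [x, p, Fin.exists_fin_two, eq_comm]

/-- The action of the generators on polynomials. -/
def genAction : Fin 2 → Module.End ℂ (ℕ × ℕ →₀ ℂ) :=
  ![Finsupp.linearCombination ℂ fun i => Finsupp.single (i.1 + 1, i.2) 1,
    Finsupp.linearCombination ℂ fun i => Finsupp.single (i.1, i.2 + 1) 1 -
      (i.1 : ℂ) • Finsupp.single (i.1 - 1, i.2) 1]

/-- The action of the Weyl algebra on polynomials. -/
def action : Weyl →ₐ[ℂ] Module.End ℂ (ℕ × ℕ →₀ ℂ) :=
  RingQuot.liftAlgHom ℂ ⟨FreeAlgebra.lift ℂ genAction, by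
    rintro _ _ ⟨⟩
    refine Finsupp.lhom_ext' fun ⟨k, l⟩ => LinearMap.ext_ring ?_
    rcases k with _ | k
    · simp [genAction]
    · simp [genAction]
      abel⟩

lemma action_x (k l : ℕ) :
    action x (Finsupp.single (k, l) 1) = Finsupp.single (k + 1, l) 1 := by
  simp [action, x, genAction]

lemma action_p (k l : ℕ) : action p (Finsupp.single (k, l) 1) =
    Finsupp.single (k, l + 1) 1 - (k : ℂ) • Finsupp.single (k - 1, l) 1 := by
  simp [action, p, genAction]

/-- The basis `x^k p^l` of the Weyl algebra. -/
def basis : Module.Basis (ℕ × ℕ) ℂ Weyl :=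
  basisOfRep adjoin_eq_top action (fun i => x ^ i.1 * p ^ i.2)
    (by
      rintro g (rfl | rfl) ⟨k, l⟩
      · simp [action_x, pow_succ', mul_assoc]
      · simp [action_p, pow_succ', ← mul_assoc, mul_pow_of_weyl x_mul_p, sub_mul])
    (0, 0) (by simp)
    (by
      have hp : ∀ l, action (p ^ l) (Finsupp.single (0, 0) 1) = Finsupp.single (0, l) 1 := by
        intro l
        induction l with
        | zero => simp
        | succ l ih => rw [pow_succ', map_mul, Module.End.mul_apply, ih, action_p]; simp
      have hx : ∀ k l, action (x ^ k) (Finsupp.single (0, l) 1) = Finsupp.single (k, l) 1 := by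
        intro k l
        induction k with
        | zero => simp
        | succ k ih => rw [pow_succ', map_mul, Module.End.mul_apply, ih, action_x]
      rintro ⟨k, l⟩
      rw [map_mul, Module.End.mul_apply, hp, hx])

lemma basis_apply (k l : ℕ) : basis (k, l) = x ^ k * p ^ l := basisOfRep_apply ..

/-- The monomial basis of the Weyl algebra. -/
def weylBasis : WeylBasis x p where
  rel := x_mul_p
  gen := adjoin_eq_top
  b := basis
  b_apply := basis_apply

end Weyl

/-! ### Cohomology of the Weyl algebra -/

lemma ScalarKoszul.of_model {B N : Type} [Ring B] [Algebra ℂ B] [AddCommGroup N] [Module ℂ N]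
    {U V : B →ₗ[ℂ] B} {U' V' : N →ₗ[ℂ] N} (φ : B ≃ₗ[ℂ] N) (hφU : ∀ b, φ (U b) = U' (φ b))
    (hφV : ∀ b, φ (V b) = V' (φ b)) (hUV : ∀ n, U' (V' n) = V' (U' n))
    (zero : ∀ n, U' n = 0 → V' n = 0 → ∃ c : ℂ, n = c • φ 1)
    (hU : Function.Surjective U')
    (hker : ∀ w, U' w = 0 → ∃ m, U' m = 0 ∧ ∃ c : ℂ, w = V' m + c • φ 1) :
    ScalarKoszul U V (0 : B →ₗ[ℂ] PUnit) := by
  have h1 : ∀ c : ℂ, φ (algebraMap ℂ B c) = c • φ 1 := fun c => by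
    rw [Algebra.algebraMap_eq_smul_one, map_smul]
  refine .of_surjective (fun n => φ.injective ?_) (fun b hb hb' => ?_) (fun w => ?_) fun w hw => ?_
  · rw [hφU, hφV, hφV, hφU, hUV]
  · obtain ⟨c, hc⟩ := zero (φ b) (by rw [← hφU, hb, map_zero]) (by rw [← hφV, hb', map_zero])
    exact ⟨c, φ.injective (by rw [hc, h1])⟩
  · obtain ⟨n, hn⟩ := hU (φ w)
    obtain ⟨b, rfl⟩ := φ.surjective n
    exact ⟨b, φ.injective (by rw [hφU, hn])⟩
  · obtain ⟨m, hm, c, hc⟩ := hker (φ w) (by rw [← hφU, hw, map_zero])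
    obtain ⟨m, rfl⟩ := φ.surjective m
    exact ⟨m, φ.map_eq_zero_iff.1 (by rw [hφU, hm]), c, φ.injective
      (by rw [hc, map_add, hφV, h1])⟩

lemma Polynomial.derivative_surjective :
    Function.Surjective (Polynomial.derivative : Polynomial ℂ →ₗ[ℂ] Polynomial ℂ) := by
  intro f
  induction f using Polynomial.induction_on' with
  | add f g hf hg =>
    obtain ⟨a, rfl⟩ := hf
    obtain ⟨b, rfl⟩ := hg
    exact ⟨a + b, map_add _ _ _⟩
  | monomial n c =>
    refine ⟨Polynomial.monomial (n + 1) (c / (n + 1)), ?_⟩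
    have : (n : ℂ) + 1 ≠ 0 := n.cast_add_one_ne_zero
    rw [Polynomial.derivative_monomial, Nat.add_sub_cancel]
    congr 1
    push_cast
    field_simp

/-- Half of the derivative. -/
def halfDeriv : Module.End ℂ (Polynomial ℂ) := (2⁻¹ : ℂ) • Polynomial.derivative

lemma halfDeriv_pow_mul (k : ℕ) (f : Polynomial ℂ) :
    (halfDeriv ^ k) (2 * Polynomial.X * f) =
      2 * Polynomial.X * (halfDeriv ^ k) f + (k : ℂ) • (halfDeriv ^ (k - 1)) f := by
  have h : ∀ f, halfDeriv (2 * Polynomial.X * f) = 2 * Polynomial.X * halfDeriv f + f := by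
    intro f
    have h2 : Polynomial.derivative (2 * Polynomial.X * f) =
        (2 : ℂ) • f + 2 * Polynomial.X * Polynomial.derivative f := by
      simp [Polynomial.derivative_mul, two_smul, ← two_mul]
    rw [halfDeriv, LinearMap.smul_apply, LinearMap.smul_apply, h2, smul_add, smul_smul,
      inv_mul_cancel₀ two_ne_zero, one_smul, mul_smul_comm, add_comm]
  induction k with
  | zero => simp
  | succ k ih =>
    have h3 : (k : ℂ) • halfDeriv ((halfDeriv ^ (k - 1)) f) = (k : ℂ) • (halfDeriv ^ k) f := by
      rcases k with _ | k
      · simp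
      · rw [Nat.add_sub_cancel, pow_succ', Module.End.mul_apply]
    rw [pow_succ', Module.End.mul_apply, ih, map_add, h, map_smul, h3, Module.End.mul_apply,
      Nat.add_sub_cancel, Nat.cast_succ, add_smul, one_smul]
    abel

/-! ### The twisted Koszul complex of the Weyl algebra on coefficients -/

namespace WeylModel

/-- The operator `x^k f ↦ 2 x^(k+1) f - x^k f'`. -/
def U : (ℕ →₀ Polynomial ℂ) →ₗ[ℂ] (ℕ →₀ Polynomial ℂ) :=
  -shiftOp Nat.succ Polynomial.derivative ((2 : ℂ) • LinearMap.id)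

/-- The operator `x^k f ↦ x^k (2 p f) - k x^(k-1) f`. -/
def V : (ℕ →₀ Polynomial ℂ) →ₗ[ℂ] (ℕ →₀ Polynomial ℂ) :=
  Finsupp.lsum ℂ fun k => Finsupp.lsingle k ∘ₗ LinearMap.mulLeft ℂ (2 * Polynomial.X) -
    (k : ℂ) • Finsupp.lsingle (k - 1)

/-- The cokernel of `U`. -/
def Ψ : (ℕ →₀ Polynomial ℂ) →ₗ[ℂ] Polynomial ℂ := Finsupp.lsum ℂ fun k => halfDeriv ^ k

lemma U_single : ∀ k f, U (Finsupp.single k f) =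
    (2 : ℂ) • Finsupp.single (k + 1) f - Finsupp.single k (Polynomial.derivative f) :=
  fun k f => by simp [U]

lemma V_single : ∀ k f, V (Finsupp.single k f) =
    Finsupp.single k (2 * Polynomial.X * f) - (k : ℂ) • Finsupp.single (k - 1) f :=
  fun k f => by
    simp only [V, Finsupp.lsum_single, LinearMap.sub_apply, LinearMap.comp_apply,
      LinearMap.smul_apply, LinearMap.mulLeft_apply, Finsupp.lsingle_apply]

lemma Ψ_single : ∀ k f, Ψ (Finsupp.single k f) = (halfDeriv ^ k) f := fun k f => by simp [Ψ]

lemma U_V : ∀ F, U (V F) = V (U F) := LinearMap.congr_fun (f := U ∘ₗ V) (g := V ∘ₗ U) <|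
  Finsupp.lhom_ext fun k f => by
    have h : (k : ℂ) • Finsupp.single (k - 1 + 1) f = (k : ℂ) • Finsupp.single k f := by
      rcases k with _ | k <;> simp
    have h2 : Polynomial.derivative (2 * Polynomial.X * f) =
        (2 : ℂ) • f + 2 * Polynomial.X * Polynomial.derivative f := by
      simp [Polynomial.derivative_mul, two_smul, ← two_mul]
    rw [LinearMap.comp_apply, LinearMap.comp_apply, V_single, U_single, map_sub, map_sub,
      map_smul, map_smul,
      U_single, U_single, V_single, V_single, h2, smul_sub, smul_comm (k : ℂ), h,
      Finsupp.single_add, Nat.add_sub_cancel,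
      Nat.cast_succ, add_smul, one_smul, smul_sub, smul_add, ← Finsupp.smul_single]
    abel

lemma Ψ_U : ∀ F, Ψ (U F) = 0 := LinearMap.congr_fun (f := Ψ ∘ₗ U) (g := 0) <|
  Finsupp.lhom_ext fun k f => by
    have h : (2 : ℂ) • halfDeriv f = Polynomial.derivative f := by
      rw [halfDeriv, LinearMap.smul_apply, smul_smul, mul_inv_cancel₀ two_ne_zero, one_smul]
    rw [LinearMap.comp_apply, U_single, map_sub, map_smul, Ψ_single, Ψ_single, pow_succ,
      Module.End.mul_apply,
      ← map_smul, h, sub_self, LinearMap.zero_apply]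

lemma sub_single_mem_range : ∀ F, F - Finsupp.single 0 (Ψ F) ∈ LinearMap.range U := by
  intro F
  induction F using Finsupp.induction_linear with
  | zero => simp
  | add F G hF hG =>
    rw [map_add, Finsupp.single_add, add_sub_add_comm]
    exact add_mem hF hG
  | single k f =>
    rw [Ψ_single]
    induction k generalizing f with
    | zero => simp
    | succ k ih =>
      have h : Finsupp.single (k + 1) f - Finsupp.single k (halfDeriv f) =
          U ((2⁻¹ : ℂ) • Finsupp.single k f) := by
        rw [map_smul, U_single, smul_sub, smul_smul, inv_mul_cancel₀ two_ne_zero, one_smul,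
          Finsupp.smul_single _ k]
        rfl
      have h2 := add_mem (LinearMap.mem_range_self U ((2⁻¹ : ℂ) • Finsupp.single k f))
        (ih (halfDeriv f))
      rwa [← h, sub_add_sub_cancel, ← Module.End.mul_apply, ← pow_succ] at h2

lemma eq_zero_of_U {F : ℕ →₀ Polynomial ℂ} (hF : U F = 0) : F = 0 := by
  have h : ∀ w : Polynomial ℂ, ((2 : ℂ) • LinearMap.id : Polynomial ℂ →ₗ[ℂ] Polynomial ℂ) w = 0 →
      w = 0 := fun w hw => by
    rw [LinearMap.smul_apply, LinearMap.id_apply] at hw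
    exact (smul_eq_zero.1 hw).resolve_left two_ne_zero
  have h2 : shiftOp Nat.succ Polynomial.derivative ((2 : ℂ) • LinearMap.id) F = 0 := by
    rwa [U, LinearMap.neg_apply, neg_eq_zero] at hF
  exact eq_zero_of_shiftOp_eq_zero Nat.succ_injective (fun k => (k : ℤ)) (fun k => by simp) h h2

lemma Ψ_V (F : ℕ →₀ Polynomial ℂ) : Ψ (V F) = LinearMap.mulLeft ℂ (2 * Polynomial.X) (Ψ F) := by
  refine LinearMap.congr_fun (f := Ψ ∘ₗ V) (g := LinearMap.mulLeft ℂ _ ∘ₗ Ψ)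
    (Finsupp.lhom_ext fun k f => ?_) F
  rw [LinearMap.comp_apply, LinearMap.comp_apply, V_single, map_sub, map_smul, Ψ_single, Ψ_single,
    Ψ_single, halfDeriv_pow_mul, add_sub_cancel_right, LinearMap.mulLeft_apply]

lemma Ψ_eq_zero_iff (F : ℕ →₀ Polynomial ℂ) : Ψ F = 0 ↔ ∃ G, U G = F := by
  constructor
  · intro hF
    have := sub_single_mem_range F
    rwa [hF, Finsupp.single_zero, sub_zero] at this
  · rintro ⟨G, rfl⟩
    exact Ψ_U G

lemma lcoeff_eq_zero_iff (f : Polynomial ℂ) :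
    Polynomial.lcoeff ℂ 0 f = 0 ↔ ∃ g, LinearMap.mulLeft ℂ (2 * Polynomial.X) g = f := by
  rw [Polynomial.lcoeff_apply, ← Polynomial.X_dvd_iff]
  constructor
  · rintro ⟨g, rfl⟩
    refine ⟨(2⁻¹ : ℂ) • g, ?_⟩
    rw [LinearMap.mulLeft_apply, mul_smul_comm, mul_assoc, two_mul, ← two_smul ℂ, smul_smul,
      inv_mul_cancel₀ two_ne_zero, one_smul]
  · rintro ⟨g, rfl⟩
    exact ⟨2 * g, by rw [LinearMap.mulLeft_apply]; ring⟩

lemma regularKoszul : RegularKoszul U V (Polynomial.lcoeff ℂ 0 ∘ₗ Ψ) :=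
  .of_quotient U_V (fun _ => eq_zero_of_U)
    (fun f => ⟨Finsupp.single 0 f, by rw [Ψ_single, pow_zero, Module.End.one_apply]⟩)
    Ψ_eq_zero_iff Ψ_V
    (fun _ hf => (mul_eq_zero.1 hf).resolve_left (mul_ne_zero two_ne_zero Polynomial.X_ne_zero))
    (fun c => ⟨Polynomial.C c, by simp⟩) lcoeff_eq_zero_iff

end WeylModel

namespace WeylBasis

variable {B : Type} [Ring B] [Algebra ℂ B] {x p : B} (H : WeylBasis x p)

include H

lemma polyCoeff_x_pow (k : ℕ) (f : Polynomial ℂ) :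
    polyCoeff H.b (x ^ k * Polynomial.aeval p f) = Finsupp.single k f :=
  polyCoeff_mul_aeval H.b H.b_apply k f

lemma polyCoeff_x_mul (k : ℕ) (f : Polynomial ℂ) :
    polyCoeff H.b (x * (x ^ k * Polynomial.aeval p f)) = Finsupp.single (k + 1) f := by
  rw [← mul_assoc, ← pow_succ', H.polyCoeff_x_pow]

lemma polyCoeff_mul_x (k : ℕ) (f : Polynomial ℂ) :
    polyCoeff H.b (x ^ k * Polynomial.aeval p f * x) =
      Finsupp.single (k + 1) f - Finsupp.single k (Polynomial.derivative f) := by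
  rw [mul_assoc, aeval_mul_of_weyl H.rel, mul_sub, ← mul_assoc, ← pow_succ, map_sub,
    H.polyCoeff_x_pow,
    H.polyCoeff_x_pow]

lemma polyCoeff_mul_p (k : ℕ) (f : Polynomial ℂ) :
    polyCoeff H.b (x ^ k * Polynomial.aeval p f * p) =
      Finsupp.single k (Polynomial.X * f) := by
  rw [← H.polyCoeff_x_pow, mul_comm Polynomial.X, map_mul (Polynomial.aeval p), Polynomial.aeval_X,
    mul_assoc]

lemma polyCoeff_p_mul (k : ℕ) (f : Polynomial ℂ) :
    polyCoeff H.b (p * (x ^ k * Polynomial.aeval p f)) =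
      Finsupp.single k (Polynomial.X * f) - (k : ℂ) • Finsupp.single (k - 1) f := by
  rw [← H.polyCoeff_x_pow, map_mul (Polynomial.aeval p), Polynomial.aeval_X, ← mul_assoc,
    mul_pow_of_weyl H.rel, sub_mul, map_sub,
    mul_assoc, smul_mul_assoc, map_smul, H.polyCoeff_x_pow (k - 1)]

lemma polyCoeff_one : polyCoeff H.b (1 : B) = Finsupp.single 0 1 := by
  rw [← H.polyCoeff_x_pow, pow_zero, map_one (Polynomial.aeval p), one_mul]

lemma scalarKoszul :
    ScalarKoszul (twistedComm x 1 x) (twistedComm p 1 p) (0 : B →ₗ[ℂ] PUnit) := by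
  let U : (ℕ →₀ Polynomial ℂ) →ₗ[ℂ] (ℕ →₀ Polynomial ℂ) :=
    diagOp fun _ => Polynomial.derivative
  let V : (ℕ →₀ Polynomial ℂ) →ₗ[ℂ] (ℕ →₀ Polynomial ℂ) :=
    Finsupp.lsum ℂ fun k => -(k : ℂ) • Finsupp.lsingle (k - 1)
  let P : (ℕ →₀ Polynomial ℂ) →ₗ[ℂ] (ℕ →₀ Polynomial ℂ) :=
    Finsupp.lsum ℂ fun k => -(k + 1 : ℂ)⁻¹ • Finsupp.lsingle (k + 1)
  have hU : ∀ k f, U (Finsupp.single k f) = Finsupp.single k (Polynomial.derivative f) :=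
    fun k f => diagOp_single _ _ _
  have hV : ∀ k f, V (Finsupp.single k f) = -((k : ℂ) • Finsupp.single (k - 1) f) :=
    fun k f => by simp [V]
  have hP : ∀ k f, P (Finsupp.single k f) = -((k + 1 : ℂ)⁻¹ • Finsupp.single (k + 1) f) :=
    fun k f => by simp [P]
  have hUV : ∀ F, U (V F) = V (U F) := LinearMap.congr_fun (f := U ∘ₗ V) (g := V ∘ₗ U) <|
    Finsupp.lhom_ext fun k f => by
      rw [LinearMap.comp_apply, LinearMap.comp_apply, hV, hU, hV, map_neg, map_smul, hU]
  have hUP : ∀ F, U (P F) = P (U F) := LinearMap.congr_fun (f := U ∘ₗ P) (g := P ∘ₗ U) <|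
    Finsupp.lhom_ext fun k f => by
      rw [LinearMap.comp_apply, LinearMap.comp_apply, hP, hU, hP, map_neg, map_smul, hU]
  have hVP : ∀ F, V (P F) = F := LinearMap.congr_fun (f := V ∘ₗ P) (g := LinearMap.id) <|
    Finsupp.lhom_ext fun k f => by
      have : (k : ℂ) + 1 ≠ 0 := k.cast_add_one_ne_zero
      rw [LinearMap.comp_apply, hP, map_neg, map_smul, hV, smul_neg, neg_neg, smul_smul,
        Nat.cast_succ, inv_mul_cancel₀ this, one_smul, Nat.add_sub_cancel, LinearMap.id_apply]
  have hV' : ∀ F k, V F k = -(k + 1 : ℂ) • F (k + 1) := by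
    intro F k
    induction F using Finsupp.induction_linear with
    | zero => simp
    | add F G hF hG => simp [hF, hG]
    | single j f =>
      rw [hV]
      rcases j with _ | j
      · simp
      · by_cases h : j = k
        · subst h
          simp [add_smul]
        · simp [h]
  refine .of_model (polyCoeff H.b) (U' := U) (V' := V)
    (polyCoeff_comm H.b H.b_apply fun k f => ?_)
    (polyCoeff_comm H.b H.b_apply fun k f => ?_) hUV (fun F hF hF' => ?_)
    (diagOp_surjective fun _ => Polynomial.derivative_surjective)
    fun F hF => ⟨P F, by rw [hUP, hF, map_zero], 0, by rw [hVP, zero_smul, add_zero]⟩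
  · rw [twistedComm_apply, one_mul, one_mul, map_sub, H.polyCoeff_x_mul, H.polyCoeff_mul_x,
      sub_sub_cancel, hU]
  · rw [twistedComm_apply, one_mul, one_mul, map_sub, H.polyCoeff_p_mul, H.polyCoeff_mul_p, hV]
    abel
  · have h0 : Polynomial.derivative (F 0) = 0 := by
      have := DFunLike.congr_fun hF 0
      rwa [diagOp_apply] at this
    refine ⟨(F 0).coeff 0, ?_⟩
    rw [H.polyCoeff_one]
    ext1 k
    rcases k with _ | k
    · have := Polynomial.eq_C_of_derivative_eq_zero h0
      simp only [Finsupp.smul_apply, Finsupp.single_eq_same]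
      rw [Polynomial.smul_eq_C_mul, mul_one]
      exact this
    · have h1 := DFunLike.congr_fun hF' k
      rw [hV', Finsupp.zero_apply, smul_eq_zero, neg_eq_zero] at h1
      rw [h1.resolve_left k.cast_add_one_ne_zero]
      simp

variable {ε : B ≃ₐ[ℂ] B} (hx : ε x = -x) (hp : ε p = -p)

/-- The degree two cohomology class of the twisted part. -/
def coinvariant : B →ₗ[ℂ] ℂ :=
  (Polynomial.lcoeff ℂ 0 ∘ₗ WeylModel.Ψ) ∘ₗ (polyCoeff H.b).toLinearMap

include hx hp

lemma regularKoszul :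
    RegularKoszul (twistedComm x 1 (ε x)) (twistedComm p 1 (ε p)) H.coinvariant := by
  refine WeylModel.regularKoszul.transport (polyCoeff H.b)
    (polyCoeff_comm H.b H.b_apply fun k f => ?_) (polyCoeff_comm H.b H.b_apply fun k f => ?_)
  · rw [twistedComm_apply, hx, one_mul, one_mul, mul_neg, sub_neg_eq_add, map_add,
  H.polyCoeff_x_mul,
      H.polyCoeff_mul_x, WeylModel.U_single, two_smul]
    abel
  · rw [twistedComm_apply, hp, one_mul, one_mul, mul_neg, sub_neg_eq_add, map_add,
  H.polyCoeff_p_mul,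
      H.polyCoeff_mul_p, WeylModel.V_single, mul_assoc, two_mul, Finsupp.single_add]
    abel

lemma coinvariant_map (b : B) : H.coinvariant (ε b) = H.coinvariant b := by
  have h := H.regularKoszul hx hp
  have h1 : H.coinvariant 1 = 1 := by
    simp [coinvariant, H.polyCoeff_one, WeylModel.Ψ_single]
  obtain ⟨a, c, hac⟩ := (h.two (b - algebraMap ℂ B (H.coinvariant b))).1 (by
    rw [map_sub, Algebra.algebraMap_eq_smul_one, map_smul, h1, smul_eq_mul, mul_one, sub_self])
  have h2 : H.coinvariant (ε b - algebraMap ℂ B (H.coinvariant b)) = 0 := by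
    refine (h.two _).2 ⟨-ε a, -ε c, ?_⟩
    rw [← AlgEquiv.commutes ε (H.coinvariant b), ← map_sub, ← hac]
    simp only [twistedComm_apply, hx, hp, map_sub, map_mul, map_one, map_neg]
    noncomm_ring
  rw [map_sub, sub_eq_zero, Algebra.algebraMap_eq_smul_one, map_smul, h1, smul_eq_mul,
    mul_one] at h2
  exact h2

/-- The Koszul cohomology of the Weyl algebra. -/
def cohomology : (H.koszulAlgebra hx hp).Cohomology PUnit ℂ where
  Θ₁ := 0
  Θ₂ := H.coinvariant
  scalar := H.scalarKoszul
  regular := H.regularKoszul hx hp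
  invariant₁ _ := rfl
  invariant₂ b := by
    simpa [koszulAlgebra] using H.coinvariant_map hx hp b

end WeylBasis

/-! ### The trigonometric Weyl algebra -/

lemma zpow_mem_adjoin {B : Type} [Ring B] [Algebra ℂ B] (u : Bˣ) (k : ℤ) :
    ((u ^ k : Bˣ) : B) ∈ Algebra.adjoin ℂ {(u : B), ((u⁻¹ : Bˣ) : B)} := by
  rcases k with k | k
  · rw [Int.ofNat_eq_natCast, zpow_natCast, Units.val_pow_eq_pow_val]
    exact Subalgebra.pow_mem _ (Algebra.subset_adjoin (by simp)) k
  · rw [zpow_negSucc, ← inv_pow, Units.val_pow_eq_pow_val]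
    exact Subalgebra.pow_mem _ (Algebra.subset_adjoin (by simp)) _

section TrigRelation

variable {B : Type} [Ring B] [Algebra ℂ B] {u : Bˣ} {p : B}

omit [Algebra ℂ B] in
lemma mul_inv_of_trig (h : (u : B) * p = p * u + u) :
    p * ((u⁻¹ : Bˣ) : B) = ((u⁻¹ : Bˣ) : B) * p + ((u⁻¹ : Bˣ) : B) := by
  have h1 : ((u⁻¹ : Bˣ) : B) * (u * p) * ((u⁻¹ : Bˣ) : B) =
      ((u⁻¹ : Bˣ) : B) * (p * u + u) * ((u⁻¹ : Bˣ) : B) := by rw [h]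
  simpa [mul_add, add_mul, mul_assoc] using h1

lemma mul_zpow_of_trig (h : (u : B) * p = p * u + u) (k : ℤ) :
    p * ((u ^ k : Bˣ) : B) = ((u ^ k : Bˣ) : B) * p - (k : ℂ) • ((u ^ k : Bˣ) : B) := by
  have h1 : p * u = u * p - u := by rw [h, add_sub_cancel_right]
  induction k using Int.induction_on with
  | zero => simp
  | succ k ih =>
    rw [zpow_add_one, Units.val_mul, ← mul_assoc, ih, sub_mul, mul_assoc, h1, smul_mul_assoc,
      Int.cast_add, Int.cast_one, add_smul, one_smul, mul_sub, mul_assoc]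
    abel
  | pred k ih =>
    rw [zpow_sub_one, Units.val_mul, ← mul_assoc, ih, sub_mul, mul_assoc, mul_inv_of_trig h,
      smul_mul_assoc, Int.cast_sub, Int.cast_one, sub_smul, one_smul, mul_add, mul_assoc]
    abel

lemma aeval_mul_of_trig {y : B} {c : ℂ} (h : p * y = y * p + c • y) (f : Polynomial ℂ) :
    Polynomial.aeval p f * y = y * Polynomial.aeval p (Polynomial.taylor c f) := by
  rw [Polynomial.taylor_apply, Polynomial.aeval_comp]
  simp only [map_add, Polynomial.aeval_X, Polynomial.aeval_C]
  induction f using Polynomial.induction_on' with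
  | add f g hf hg => simp only [map_add, add_mul, mul_add, hf, hg]
  | monomial n a =>
    rw [Polynomial.aeval_monomial, Polynomial.aeval_monomial, mul_assoc, ← mul_assoc y,
      ← Algebra.commutes a y, mul_assoc]
    congr 1
    induction n with
    | zero => simp
    | succ n ih =>
      rw [pow_succ, mul_assoc, h, pow_succ, ← mul_assoc, ← ih, mul_add, mul_add, mul_assoc,
        ← Algebra.commutes c, ← Algebra.smul_def, mul_smul_comm]

/-- Generators of the trigonometric Weyl algebra for which the ordered monomials form a basis. -/
structure TrigBasis {B : Type} [Ring B] [Algebra ℂ B] (u : Bˣ) (p : B) where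
  rel : (u : B) * p = p * u + u
  gen : Algebra.adjoin ℂ {(u : B), ((u⁻¹ : Bˣ) : B), p} = ⊤
  b : Module.Basis (ℤ × ℕ) ℂ B
  b_apply : ∀ k l, b (k, l) = ((u ^ k : Bˣ) : B) * p ^ l

namespace TrigBasis

variable (H : TrigBasis u p)

/-- The monomial basis of the trigonometric Weyl algebra. -/
def monomialBasis (H : TrigBasis u p) : MonomialBasis (u : B) ((u⁻¹ : Bˣ) : B) p ℤ ℕ where
  b := H.b
  sK := (· + 1)
  sJ := Nat.succ
  degK := id
  degJ := Nat.cast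
  hsK := add_left_injective 1
  hsJ := Nat.succ_injective
  hdegK k := by simp
  hdegJ k := by simp
  k₀ := 0
  xs k := ((u ^ k : Bˣ) : B)
  xs_mem k := zpow_mem_adjoin u k
  xs_zero := by simp
  x_mul_xs k := by rw [← Units.val_mul, ← zpow_one_add, add_comm]
  xs_mul_x k := by rw [← Units.val_mul, ← zpow_add_one]
  xs_mul_b k j := by simp [H.b_apply]
  p_mul_b j := by simp [H.b_apply, pow_succ']

variable {ε : B ≃ₐ[ℂ] B} (hu : ε u = ((u⁻¹ : Bˣ) : B)) (hp : ε p = -p)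

/-- The Koszul algebra structure of the trigonometric Weyl algebra. -/
def koszulAlgebra : KoszulAlgebra ε where
  x := u
  y := ((u⁻¹ : Bˣ) : B)
  y' := u
  p := p
  z := 1
  z' := 1
  hx := Or.inr ⟨by simp, by simp, rfl, hu⟩
  hp := Or.inl ⟨rfl, rfl, hp⟩
  gen := by
    refine eq_top_iff.2 (H.gen.symm.le.trans (Algebra.adjoin_mono ?_))
    rintro _ (rfl | rfl | rfl) <;> simp
  K := ℤ
  J := ℕ
  basis := H.monomialBasis
  uv := by
    simp only [envComm_eq, mul_sub, sub_mul, Algebra.TensorProduct.tmul_mul_tmul, ← op_mul,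
      one_mul, mul_one, H.rel, mul_inv_of_trig H.rel, TensorProduct.add_tmul, MulOpposite.op_add,
      TensorProduct.tmul_add, Units.inv_mul]
    abel
  AB := by
    have h : (1 : B) ⊗ₜ op (1 : B) = (1 : env B) := rfl
    rw [h, one_mul, mul_one]
  Av := by
    simp only [envComm_eq, mul_sub, sub_mul, Algebra.TensorProduct.tmul_mul_tmul, ← op_mul,
      one_mul, mul_one, H.rel, mul_inv_of_trig H.rel, TensorProduct.add_tmul, MulOpposite.op_add,
      TensorProduct.tmul_add]
    abel
  Bu := by
    have h : (1 : B) ⊗ₜ op (1 : B) = (1 : env B) := rfl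
    rw [h, one_mul, mul_one]

end TrigBasis

end TrigRelation

namespace TrigWeyl

/-- The unit `X`. -/
def u : TrigWeylˣ where
  val := X
  inv := Xinv
  val_inv := by
    have := RingQuot.mkAlgHom_rel ℂ trigWeylRel.relXXinv
    simpa [X, Xinv] using this
  inv_val := by
    have := RingQuot.mkAlgHom_rel ℂ trigWeylRel.relXinvX
    simpa [X, Xinv] using this

lemma u_mul_p : (u : TrigWeyl) * p = p * u + u := by
  have := RingQuot.mkAlgHom_rel ℂ trigWeylRel.relXp
  simpa [u, X, p] using this

lemma adjoin_eq_top : Algebra.adjoin ℂ {(u : TrigWeyl), ((u⁻¹ : TrigWeylˣ) : TrigWeyl), p} = ⊤ := by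
  rw [← adjoin_range_mkAlgHom trigWeylRel]
  congr 1
  ext b
  simp [u, X, Xinv, p, Fin.exists_fin_succ, eq_comm]

/-- The action of the generators on Laurent polynomials. -/
def genAction : Fin 3 → Module.End ℂ (ℤ × ℕ →₀ ℂ) :=
  ![Finsupp.linearCombination ℂ fun i => Finsupp.single (i.1 + 1, i.2) 1,
    Finsupp.linearCombination ℂ fun i => Finsupp.single (i.1 - 1, i.2) 1,
    Finsupp.linearCombination ℂ fun i => Finsupp.single (i.1, i.2 + 1) 1 -
      (i.1 : ℂ) • Finsupp.single i 1]

/-- The action of the trigonometric Weyl algebra on Laurent polynomials. -/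
def action : TrigWeyl →ₐ[ℂ] Module.End ℂ (ℤ × ℕ →₀ ℂ) :=
  RingQuot.liftAlgHom ℂ ⟨FreeAlgebra.lift ℂ genAction, by
    rintro _ _ ⟨⟩ <;> refine Finsupp.lhom_ext' fun ⟨k, l⟩ => LinearMap.ext_ring ?_
    · simp [genAction]
    · simp [genAction]
    · simp [genAction]
      abel⟩

lemma action_u (k : ℤ) (l : ℕ) :
    action u (Finsupp.single (k, l) 1) = Finsupp.single (k + 1, l) 1 := by
  simp [action, u, X, genAction]

lemma action_u_inv (k : ℤ) (l : ℕ) :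
    action ((u⁻¹ : TrigWeylˣ) : TrigWeyl) (Finsupp.single (k, l) 1) =
      Finsupp.single (k - 1, l) 1 := by
  simp [action, u, Xinv, genAction]

lemma action_p (k : ℤ) (l : ℕ) : action p (Finsupp.single (k, l) 1) =
    Finsupp.single (k, l + 1) 1 - (k : ℂ) • Finsupp.single (k, l) 1 := by
  simp [action, p, genAction]

lemma action_u_zpow (k : ℤ) (l : ℕ) :
    action ((u ^ k : TrigWeylˣ) : TrigWeyl) (Finsupp.single (0, l) 1) =
      Finsupp.single (k, l) 1 := by
  induction k using Int.induction_on with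
  | zero => simp
  | succ k ih => rw [add_comm, zpow_one_add, Units.val_mul, map_mul, Module.End.mul_apply, ih,
      action_u, add_comm]
  | pred k ih => rw [sub_eq_neg_add, zpow_add, zpow_neg_one, Units.val_mul, map_mul,
      Module.End.mul_apply, ih, action_u_inv, sub_eq_neg_add]

/-- The basis `X^k p^l` of the trigonometric Weyl algebra. -/
def basis : Module.Basis (ℤ × ℕ) ℂ TrigWeyl :=
  basisOfRep adjoin_eq_top action (fun i => ((u ^ i.1 : TrigWeylˣ) : TrigWeyl) * p ^ i.2)
    (by
      rintro g (rfl | rfl | rfl) ⟨k, l⟩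
      · simp [action_u, ← mul_assoc, ← Units.val_mul, ← zpow_one_add, add_comm]
      · rw [action_u_inv, Finsupp.linearCombination_single, one_smul, ← mul_assoc,
          ← Units.val_mul, ← zpow_neg_one, ← zpow_add, sub_eq_neg_add]
      · simp [action_p, pow_succ', ← mul_assoc, mul_zpow_of_trig u_mul_p, sub_mul])
    (0, 0) (by simp)
    (by
      have hp : ∀ l, action (p ^ l) (Finsupp.single (0, 0) 1) = Finsupp.single (0, l) 1 := by
        intro l
        induction l with
        | zero => simp
        | succ l ih => rw [pow_succ', map_mul, Module.End.mul_apply, ih, action_p]; simp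
      rintro ⟨k, l⟩
      rw [map_mul, Module.End.mul_apply, hp, action_u_zpow])

lemma basis_apply (k : ℤ) (l : ℕ) :
    basis (k, l) = ((u ^ k : TrigWeylˣ) : TrigWeyl) * p ^ l := basisOfRep_apply ..

/-- The monomial basis of the trigonometric Weyl algebra. -/
def trigBasis : TrigBasis u p where
  rel := u_mul_p
  gen := adjoin_eq_top
  b := basis
  b_apply := basis_apply

end TrigWeyl

/-! ### Cohomology of the trigonometric Weyl algebra -/

namespace Polynomial

/-- The backward difference operator. -/
def backwardDiff : Polynomial ℂ →ₗ[ℂ] Polynomial ℂ := LinearMap.id - taylor (-1)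

lemma backwardDiff_apply (f : Polynomial ℂ) : backwardDiff f = f - taylor (-1) f := rfl

lemma backwardDiff_descPochhammer (n : ℕ) : backwardDiff (descPochhammer ℂ (n + 1)) =
    (n + 1 : ℂ) • taylor (-1) (descPochhammer ℂ n) := by
  have h := descPochhammer_succ_comp_X_sub_one (R := ℂ) n
  have h1 : (X - 1 : Polynomial ℂ) = X + C (-1) := by simp [sub_eq_add_neg]
  rw [h1, ← taylor_apply, ← taylor_apply] at h
  rw [backwardDiff_apply, h, sub_sub_cancel, smul_eq_mul, smul_eq_C_mul]
  simp

lemma backwardDiff_surjective : Function.Surjective backwardDiff := by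
  let S : Sequence ℂ := ⟨descPochhammer ℂ, fun n => by
    rw [degree_eq_natDegree (monic_descPochhammer ℂ n).ne_zero, descPochhammer_natDegree]⟩
  have hS : Submodule.span ℂ (Set.range (descPochhammer ℂ)) = ⊤ :=
    S.span fun i => by
      have : (descPochhammer ℂ i).leadingCoeff = 1 := monic_descPochhammer ℂ i
      exact this ▸ isUnit_one
  have h : (⊤ : Submodule ℂ (Polynomial ℂ)) ≤
      (LinearMap.range backwardDiff).comap (taylor (-1)) := by
    rw [← hS, Submodule.span_le]
    rintro _ ⟨n, rfl⟩
    refine ⟨((n : ℂ) + 1)⁻¹ • descPochhammer ℂ (n + 1), ?_⟩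
    rw [map_smul, backwardDiff_descPochhammer, smul_smul,
      inv_mul_cancel₀ n.cast_add_one_ne_zero, one_smul]
  intro f
  have h2 : taylor (-1) (taylor 1 f) ∈ LinearMap.range backwardDiff := h Submodule.mem_top
  rwa [taylor_taylor, neg_add_cancel, taylor_zero] at h2

lemma eq_C_of_backwardDiff_eq_zero {f : Polynomial ℂ} (hf : backwardDiff f = 0) :
    f = C (f.eval 0) := by
  refine eq_of_infinite_eval_eq _ _ ((Set.infinite_range_of_injective
    (Nat.cast_injective (R := ℂ))).mono ?_)
  rintro _ ⟨n, rfl⟩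
  rw [Set.mem_ofPred_eq, eval_C]
  induction n with
  | zero => simp
  | succ n ih =>
    rw [backwardDiff_apply, sub_eq_zero] at hf
    rw [← ih]
    conv_lhs => rw [hf]
    rw [taylor_eval, Nat.cast_succ, add_neg_cancel_right]

end Polynomial

/-! ### The twisted Koszul complex of the trigonometric Weyl algebra on coefficients -/

namespace TrigModel

open Polynomial

/-- The operator `X^k f(p) ↦ X^k f(p) - X^(k-2) f(p+1)`. -/
def U : (ℤ →₀ Polynomial ℂ) →ₗ[ℂ] (ℤ →₀ Polynomial ℂ) :=
  shiftOp (· - 2) LinearMap.id (taylor 1)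

/-- The operator `X^k f ↦ X^k (2 p - k) f`. -/
def V : (ℤ →₀ Polynomial ℂ) →ₗ[ℂ] (ℤ →₀ Polynomial ℂ) :=
  diagOp fun k => LinearMap.mulLeft ℂ (2 * X - C (k : ℂ))

/-- The cokernel of `V`. -/
def Ψ : (ℤ →₀ Polynomial ℂ) →ₗ[ℂ] (ℤ →₀ ℂ) := diagOp fun k => leval ((k : ℂ) / 2)

lemma U_single (k : ℤ) (f : Polynomial ℂ) : U (Finsupp.single k f) =
    Finsupp.single k f - Finsupp.single (k - 2) (taylor 1 f) := by
  rw [U, shiftOp_single, LinearMap.id_apply]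

lemma V_single (k : ℤ) (f : Polynomial ℂ) :
    V (Finsupp.single k f) = Finsupp.single k ((2 * X - C (k : ℂ)) * f) := by
  rw [V, diagOp_single, LinearMap.mulLeft_apply]

lemma Ψ_single (k : ℤ) (f : Polynomial ℂ) :
    Ψ (Finsupp.single k f) = Finsupp.single k (f.eval ((k : ℂ) / 2)) := by
  rw [Ψ, diagOp_single, leval_apply]

lemma V_U (F : ℤ →₀ Polynomial ℂ) : V (U F) = U (V F) := by
  refine LinearMap.congr_fun (f := V ∘ₗ U) (g := U ∘ₗ V) (Finsupp.lhom_ext fun k f => ?_) F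
  have h : taylor 1 (2 * X - C (k : ℂ)) = 2 * X - C (((k - 2 : ℤ)) : ℂ) := by
    have : (2 : Polynomial ℂ) = C 2 := rfl
    rw [this, map_sub, taylor_mul, taylor_X, taylor_C, taylor_C, mul_add, ← C_mul, Int.cast_sub,
      C_sub]
    simp
    ring
  rw [LinearMap.comp_apply, LinearMap.comp_apply, U_single, map_sub, V_single, V_single,
    U_single, taylor_mul, h]

lemma Ψ_U (F : ℤ →₀ Polynomial ℂ) : Ψ (U F) = subShift ℂ (Ψ F) := by
  refine LinearMap.congr_fun (f := Ψ ∘ₗ U) (g := subShift ℂ ∘ₗ Ψ)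
    (Finsupp.lhom_ext fun k f => ?_) F
  rw [LinearMap.comp_apply, LinearMap.comp_apply, U_single, map_sub, Ψ_single, Ψ_single,
    subShift_single, taylor_eval]
  congr 4
  push_cast
  ring

lemma Ψ_eq_zero_iff (F : ℤ →₀ Polynomial ℂ) : Ψ F = 0 ↔ ∃ G, V G = F := by
  refine exists_diagOp_eq_iff (fun k f => ?_) F
  have h2 : 2 * X - C (k : ℂ) = (2 : ℂ) • (X - C ((k : ℂ) / 2)) := by
    rw [smul_sub, smul_C, smul_eq_mul, mul_div_cancel₀ _ two_ne_zero, two_smul, two_mul]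
  rw [leval_apply, ← IsRoot.def, ← dvd_iff_isRoot]
  constructor
  · rintro ⟨g, rfl⟩
    refine ⟨(2⁻¹ : ℂ) • g, ?_⟩
    rw [LinearMap.mulLeft_apply, h2, smul_mul_smul_comm, mul_inv_cancel₀ two_ne_zero, one_smul]
  · rintro ⟨g, rfl⟩
    exact ⟨(2 : ℂ) • g, by rw [LinearMap.mulLeft_apply, h2, smul_mul_assoc, mul_smul_comm]⟩

lemma eq_zero_of_V {F : ℤ →₀ Polynomial ℂ} (hF : V F = 0) : F = 0 := by
  refine eq_zero_of_diagOp_eq_zero (fun k f hf => ?_) hF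
  refine (mul_eq_zero.1 hf).resolve_left fun h => ?_
  have := congrArg (eval (((k : ℂ) + 1) / 2)) h
  simp [mul_div_cancel₀] at this

lemma regularKoszul : RegularKoszul U V (paritySum ℂ ∘ₗ Ψ) :=
  RegularKoszul.symm <| .of_quotient V_U (fun _ => eq_zero_of_V)
    (diagOp_surjective fun _ c => ⟨C c, by simp⟩) Ψ_eq_zero_iff Ψ_U
    (fun _ => eq_zero_of_subShift_eq_zero) paritySum_surjective paritySum_eq_zero_iff

end TrigModel

namespace TrigBasis

variable {B : Type} [Ring B] [Algebra ℂ B] {u : Bˣ} {p : B} (H : TrigBasis u p)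

include H

lemma polyCoeff_zpow (k : ℤ) (f : Polynomial ℂ) :
    polyCoeff H.b (((u ^ k : Bˣ) : B) * Polynomial.aeval p f) = Finsupp.single k f :=
  polyCoeff_mul_aeval H.b H.b_apply k f

lemma aeval_mul_u (f : Polynomial ℂ) :
    Polynomial.aeval p f * u = u * Polynomial.aeval p (Polynomial.taylor (-1) f) :=
  aeval_mul_of_trig (by rw [neg_one_smul, H.rel, add_neg_cancel_right]) f

lemma aeval_mul_u_inv (f : Polynomial ℂ) : Polynomial.aeval p f * ((u⁻¹ : Bˣ) : B) =
    ((u⁻¹ : Bˣ) : B) * Polynomial.aeval p (Polynomial.taylor 1 f) :=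
  aeval_mul_of_trig (by rw [one_smul, mul_inv_of_trig H.rel]) f

lemma inv_mul_mul_u (k : ℤ) (f : Polynomial ℂ) :
    ((u⁻¹ : Bˣ) : B) * (((u ^ k : Bˣ) : B) * Polynomial.aeval p f) * u =
      ((u ^ k : Bˣ) : B) * Polynomial.aeval p (Polynomial.taylor (-1) f) := by
  rw [mul_assoc, mul_assoc, H.aeval_mul_u, ← mul_assoc, ← mul_assoc, ← Units.val_mul,
    ← Units.val_mul, mul_assoc, (Commute.refl u).zpow_left k |>.eq, inv_mul_cancel_left]

lemma inv_mul_mul_u_inv (k : ℤ) (f : Polynomial ℂ) :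
    ((u⁻¹ : Bˣ) : B) * (((u ^ k : Bˣ) : B) * Polynomial.aeval p f) * ((u⁻¹ : Bˣ) : B) =
      ((u ^ (k - 2) : Bˣ) : B) * Polynomial.aeval p (Polynomial.taylor 1 f) := by
  rw [mul_assoc, mul_assoc, H.aeval_mul_u_inv, ← mul_assoc, ← mul_assoc, ← Units.val_mul,
    ← Units.val_mul, ← zpow_neg_one, ← zpow_add, ← zpow_add]
  congr 3
  ring

lemma polyCoeff_mul_p (k : ℤ) (f : Polynomial ℂ) :
    polyCoeff H.b (((u ^ k : Bˣ) : B) * Polynomial.aeval p f * p) =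
      Finsupp.single k (Polynomial.X * f) := by
  rw [← H.polyCoeff_zpow, mul_comm Polynomial.X, map_mul (Polynomial.aeval p), Polynomial.aeval_X,
    mul_assoc]

lemma polyCoeff_p_mul (k : ℤ) (f : Polynomial ℂ) :
    polyCoeff H.b (p * (((u ^ k : Bˣ) : B) * Polynomial.aeval p f)) =
      Finsupp.single k (Polynomial.X * f) - (k : ℂ) • Finsupp.single k f := by
  rw [← H.polyCoeff_zpow, ← H.polyCoeff_zpow, map_mul (Polynomial.aeval p), Polynomial.aeval_X,
    ← mul_assoc, mul_zpow_of_trig H.rel, sub_mul, map_sub, mul_assoc, smul_mul_assoc, map_smul]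

lemma polyCoeff_one : polyCoeff H.b (1 : B) = Finsupp.single 0 1 := by
  rw [← H.polyCoeff_zpow, zpow_zero, map_one (Polynomial.aeval p), Units.val_one, one_mul]

lemma scalarKoszul : ScalarKoszul (twistedComm (u : B) ((u⁻¹ : Bˣ) : B) u) (twistedComm p 1 p)
    (0 : B →ₗ[ℂ] PUnit) := by
  let U : (ℤ →₀ Polynomial ℂ) →ₗ[ℂ] (ℤ →₀ Polynomial ℂ) :=
    diagOp fun _ => Polynomial.backwardDiff
  let V : (ℤ →₀ Polynomial ℂ) →ₗ[ℂ] (ℤ →₀ Polynomial ℂ) :=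
    diagOp fun k => -(k : ℂ) • LinearMap.id
  let P : (ℤ →₀ Polynomial ℂ) →ₗ[ℂ] (ℤ →₀ Polynomial ℂ) :=
    diagOp fun k => (-(k : ℂ))⁻¹ • LinearMap.id
  have hU : ∀ F k, U F k = Polynomial.backwardDiff (F k) := fun F k => diagOp_apply _ _ _
  have hV : ∀ F k, V F k = -(k : ℂ) • F k := fun F k => diagOp_apply _ _ _
  have hP : ∀ F k, P F k = (-(k : ℂ))⁻¹ • F k := fun F k => diagOp_apply _ _ _
  have h0 : ∀ F, U F = 0 → ∀ k, ∃ c, F k = Polynomial.C c := fun F hF k =>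
    ⟨_, Polynomial.eq_C_of_backwardDiff_eq_zero (by rw [← hU, hF, Finsupp.zero_apply])⟩
  have hC : ∀ c : ℂ, c • (1 : Polynomial ℂ) = Polynomial.C c := fun c => by
    rw [Polynomial.smul_eq_C_mul, mul_one]
  refine .of_model (polyCoeff H.b) (U' := U) (V' := V)
    (polyCoeff_comm H.b H.b_apply fun k f => ?_)
    (polyCoeff_comm H.b H.b_apply fun k f => ?_) (fun F => ?_) (fun F hF hF' => ?_)
    (diagOp_surjective fun _ => Polynomial.backwardDiff_surjective)
    fun F hF => ⟨P F, ?_, ?_⟩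
  · rw [twistedComm_apply, Units.inv_mul, one_mul, H.inv_mul_mul_u, map_sub, H.polyCoeff_zpow,
      H.polyCoeff_zpow, ← Finsupp.single_sub, diagOp_single, Polynomial.backwardDiff_apply]
  · rw [twistedComm_apply, one_mul, one_mul, map_sub, H.polyCoeff_p_mul, H.polyCoeff_mul_p,
      diagOp_single, sub_sub_cancel_left, LinearMap.smul_apply,
      LinearMap.id_apply, neg_smul, Finsupp.single_neg, Finsupp.smul_single]
  · ext1 k
    rw [hU, hV, hV, hU, map_smul]
  · obtain ⟨c, hc⟩ := h0 F hF 0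
    refine ⟨c, ?_⟩
    rw [H.polyCoeff_one]
    ext1 k
    by_cases hk : k = 0
    · subst hk
      rw [hc, Finsupp.smul_apply, Finsupp.single_eq_same, hC]
    · have := DFunLike.congr_fun hF' k
      rw [hV, Finsupp.zero_apply, smul_eq_zero, neg_eq_zero, Int.cast_eq_zero] at this
      rw [this.resolve_left hk, Finsupp.smul_apply, Finsupp.single_eq_of_ne hk, smul_zero]
  · ext1 k
    rw [hU, hP, map_smul, ← hU, hF, Finsupp.zero_apply, smul_zero]
  · obtain ⟨c, hc⟩ := h0 F hF 0
    refine ⟨c, ?_⟩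
    rw [H.polyCoeff_one]
    ext1 k
    rw [Finsupp.add_apply, hV, hP, Finsupp.smul_apply]
    by_cases hk : k = 0
    · subst hk
      rw [hc, Int.cast_zero, neg_zero, zero_smul, zero_add, Finsupp.single_eq_same, hC]
    · have : -(k : ℂ) ≠ 0 := neg_ne_zero.2 (Int.cast_ne_zero.2 hk)
      rw [smul_smul, mul_inv_cancel₀ this, one_smul, Finsupp.single_eq_of_ne hk, smul_zero,
        add_zero]

variable {ε : B ≃ₐ[ℂ] B} (hu : ε u = ((u⁻¹ : Bˣ) : B)) (hp : ε p = -p)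

/-- The degree two cohomology classes of the twisted part. -/
def coinvariant : B →ₗ[ℂ] (ZMod 2 →₀ ℂ) :=
  (paritySum ℂ ∘ₗ TrigModel.Ψ) ∘ₗ (polyCoeff H.b).toLinearMap

lemma coinvariant_zpow (k : ℤ) (f : Polynomial ℂ) :
    H.coinvariant (((u ^ k : Bˣ) : B) * Polynomial.aeval p f) =
      Finsupp.single (k : ZMod 2) (f.eval ((k : ℂ) / 2)) := by
  rw [coinvariant, LinearMap.comp_apply, LinearEquiv.coe_coe, H.polyCoeff_zpow,
    LinearMap.comp_apply, TrigModel.Ψ_single, paritySum_single]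

include hu hp

lemma regularKoszul : RegularKoszul (twistedComm (u : B) ((u⁻¹ : Bˣ) : B) (ε u))
    (twistedComm p 1 (ε p)) H.coinvariant := by
  refine TrigModel.regularKoszul.transport (polyCoeff H.b)
    (polyCoeff_comm H.b H.b_apply fun k f => ?_) (polyCoeff_comm H.b H.b_apply fun k f => ?_)
  · rw [twistedComm_apply, hu, Units.inv_mul, one_mul, H.inv_mul_mul_u_inv, map_sub,
      H.polyCoeff_zpow, H.polyCoeff_zpow, TrigModel.U_single]
  · rw [twistedComm_apply, hp, one_mul, one_mul, mul_neg, sub_neg_eq_add, map_add,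
      H.polyCoeff_p_mul, H.polyCoeff_mul_p, TrigModel.V_single, sub_mul, mul_assoc, two_mul,
      Finsupp.single_sub, Finsupp.single_add, Finsupp.smul_single, Polynomial.smul_eq_C_mul]
    abel

omit H in
lemma map_zpow_mul (k : ℤ) (f : Polynomial ℂ) :
    ε (((u ^ k : Bˣ) : B) * Polynomial.aeval p f) =
      ((u ^ (-k) : Bˣ) : B) * Polynomial.aeval p (f.comp (-Polynomial.X)) := by
  have h : Units.map (ε : B →* B) u = u⁻¹ := Units.ext hu
  have h1 : ε ((u ^ k : Bˣ) : B) = ((u ^ (-k) : Bˣ) : B) := by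
    have h2 := congrArg (fun v : Bˣ => (v : B)) (map_zpow (Units.map (ε : B →* B)) u k)
    rw [h, inv_zpow'] at h2
    exact h2
  rw [map_mul, h1, Polynomial.aeval_comp, ← AlgEquiv.coe_toAlgHom, ← Polynomial.aeval_algHom_apply]
  simp [hp]

lemma coinvariant_map (b : B) :
    H.coinvariant (((u⁻¹ : Bˣ) : B) * ε b * ((u⁻¹ : Bˣ) : B)) = H.coinvariant b := by
  have h : H.coinvariant ∘ₗ LinearMap.mulLeft ℂ ((u⁻¹ : Bˣ) : B) ∘ₗ
      LinearMap.mulRight ℂ ((u⁻¹ : Bˣ) : B) ∘ₗ ε.toLinearMap = H.coinvariant := by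
    refine H.b.ext fun ⟨k, l⟩ => ?_
    have h1 : p ^ l = Polynomial.aeval p (Polynomial.X ^ l : Polynomial ℂ) := by simp
    have h2 : (2 : ZMod 2) = 0 := rfl
    simp only [LinearMap.comp_apply, LinearMap.mulLeft_apply, LinearMap.mulRight_apply,
      AlgEquiv.toLinearMap_apply]
    rw [H.b_apply, h1, map_zpow_mul hu hp, ← mul_assoc, H.inv_mul_mul_u_inv,
      H.coinvariant_zpow, H.coinvariant_zpow, Polynomial.taylor_eval, Polynomial.eval_comp]
    congr 1
    · simp [h2, CharTwo.neg_eq]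
    · congr 1
      simp
      ring
  have h3 := LinearMap.congr_fun h b
  simpa [mul_assoc] using h3

/-- The Koszul cohomology of the trigonometric Weyl algebra. -/
def cohomology : (H.koszulAlgebra hu hp).Cohomology PUnit (ZMod 2 →₀ ℂ) where
  Θ₁ := 0
  Θ₂ := H.coinvariant
  scalar := H.scalarKoszul
  regular := H.regularKoszul hu hp
  invariant₁ _ := rfl
  invariant₂ b := by
    simpa [koszulAlgebra] using H.coinvariant_map hu hp b

end TrigBasis

/-! ### The q-Weyl algebra -/

section QRelation

variable {B : Type} [Ring B] [Algebra ℂ B] {q : ℂ} {u v : Bˣ}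

lemma zpow_mul_zpow_of_qComm (hq0 : q ≠ 0) (h : (u : B) * v = q • ((v : B) * u)) (k l : ℤ) :
    ((v ^ l : Bˣ) : B) * ((u ^ k : Bˣ) : B) =
      q ^ (-(k * l)) • (((u ^ k : Bˣ) : B) * ((v ^ l : Bˣ) : B)) := by
  let c : Bˣ := Units.map (algebraMap ℂ B : ℂ →* B) (Units.mk0 q hq0)
  have hc : ∀ w, Commute c w := fun w => Units.ext (Algebra.commutes q (w : B))
  have hcz : ∀ n : ℤ, ((c ^ n : Bˣ) : B) = algebraMap ℂ B (q ^ n) := fun n => by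
    rw [← map_zpow, Units.coe_map, MonoidHom.coe_coe, Units.val_zpow_eq_zpow_val, Units.val_mk0]
  have h1 : SemiconjBy u v (c * v) := Units.ext <| by
    rw [Units.val_mul, h, Algebra.smul_def, ← mul_assoc]
    rfl
  have h2 : SemiconjBy (v ^ l) u ((c ^ l)⁻¹ * u) := by
    have h3 := (h1.zpow_right l).eq
    rw [(hc v).mul_zpow, mul_assoc] at h3
    rw [SemiconjBy, mul_assoc, h3, inv_mul_cancel_left]
  have h4 := (h2.zpow_right k).eq
  rw [((hc u).zpow_left l).inv_left.mul_zpow, ← zpow_neg, ← zpow_mul, mul_assoc] at h4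
  have h5 := congrArg (fun w : Bˣ => (w : B)) h4
  simp only [Units.val_mul, hcz] at h5
  rw [h5, Algebra.smul_def, show -l * k = -(k * l) by ring]

omit [Algebra ℂ B] in
lemma val_mul_val_zpow (u : Bˣ) (k : ℤ) :
    (u : B) * ((u ^ k : Bˣ) : B) = ((u ^ (k + 1) : Bˣ) : B) := by
  rw [← Units.val_mul, ← zpow_one_add, add_comm]

omit [Algebra ℂ B] in
lemma val_inv_mul_val_zpow (u : Bˣ) (k : ℤ) :
    ((u⁻¹ : Bˣ) : B) * ((u ^ k : Bˣ) : B) = ((u ^ (k - 1) : Bˣ) : B) := by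
  rw [← Units.val_mul, ← zpow_neg_one, ← zpow_add, neg_add_eq_sub]

/-- Generators of the q-Weyl algebra for which the ordered monomials form a basis. -/
structure QBasis {B : Type} [Ring B] [Algebra ℂ B] (q : ℂ) (u v : Bˣ) where
  q_ne_zero : q ≠ 0
  rel : (u : B) * v = q • ((v : B) * u)
  gen : Algebra.adjoin ℂ {(u : B), ((u⁻¹ : Bˣ) : B), (v : B), ((v⁻¹ : Bˣ) : B)} = ⊤
  b : Module.Basis (ℤ × ℤ) ℂ B
  b_apply : ∀ k l, b (k, l) = ((u ^ k : Bˣ) : B) * ((v ^ l : Bˣ) : B)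

namespace QBasis

variable (H : QBasis q u v)

/-- The monomial basis of the q-Weyl algebra. -/
def monomialBasis (H : QBasis q u v) :
    MonomialBasis (u : B) ((u⁻¹ : Bˣ) : B) (v : B) ℤ ℤ where
  b := H.b
  sK := (· + 1)
  sJ := (· + 1)
  degK := id
  degJ := id
  hsK := add_left_injective 1
  hsJ := add_left_injective 1
  hdegK k := by simp
  hdegJ k := by simp
  k₀ := 0
  xs k := ((u ^ k : Bˣ) : B)
  xs_mem k := zpow_mem_adjoin u k
  xs_zero := by simp
  x_mul_xs k := by rw [← Units.val_mul, ← zpow_one_add, add_comm]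
  xs_mul_x k := by rw [← Units.val_mul, ← zpow_add_one]
  xs_mul_b k j := by simp [H.b_apply]
  p_mul_b j := by
    rw [H.b_apply, H.b_apply, zpow_zero, Units.val_one, one_mul, one_mul, ← Units.val_mul,
      ← zpow_one_add, add_comm]

variable {ε : B ≃ₐ[ℂ] B} (hu : ε u = ((u⁻¹ : Bˣ) : B)) (hv : ε v = ((v⁻¹ : Bˣ) : B))

include H in
lemma inv_tmul_comm : (((u⁻¹ : Bˣ) : B) ⊗ₜ op (u : B) : env B) * (((v⁻¹ : Bˣ) : B) ⊗ₜ op (v : B)) =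
    (((v⁻¹ : Bˣ) : B) ⊗ₜ op (v : B)) * (((u⁻¹ : Bˣ) : B) ⊗ₜ op (u : B)) := by
  have h := zpow_mul_zpow_of_qComm H.q_ne_zero H.rel (-1) (-1)
  rw [zpow_neg_one, zpow_neg_one, neg_one_mul, neg_neg, zpow_neg_one] at h
  rw [Algebra.TensorProduct.tmul_mul_tmul, Algebra.TensorProduct.tmul_mul_tmul, ← op_mul, ← op_mul,
    H.rel, h, op_smul, TensorProduct.tmul_smul, TensorProduct.smul_tmul', smul_smul,
    mul_inv_cancel₀ H.q_ne_zero, one_smul]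

/-- The Koszul algebra structure of the q-Weyl algebra. -/
def koszulAlgebra : KoszulAlgebra ε where
  x := u
  y := ((u⁻¹ : Bˣ) : B)
  y' := u
  p := v
  z := ((v⁻¹ : Bˣ) : B)
  z' := v
  hx := Or.inr ⟨by simp, by simp, rfl, hu⟩
  hp := Or.inr ⟨by simp, by simp, rfl, hv⟩
  gen := H.gen
  K := ℤ
  J := ℤ
  basis := H.monomialBasis
  uv := by
    have h : (1 : B) ⊗ₜ op (1 : B) = (1 : env B) := rfl
    rw [envComm_eq, envComm_eq, Units.inv_mul, Units.inv_mul, h, mul_sub, sub_mul, sub_mul,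
      mul_sub, sub_mul, sub_mul, H.inv_tmul_comm, mul_one, mul_one, mul_one, one_mul, one_mul]
    abel
  AB := H.inv_tmul_comm
  Av := by
    have h : (1 : B) ⊗ₜ op (1 : B) = (1 : env B) := rfl
    rw [envComm_eq, Units.inv_mul, h, mul_sub, sub_mul, H.inv_tmul_comm, mul_one, one_mul]
  Bu := by
    have h : (1 : B) ⊗ₜ op (1 : B) = (1 : env B) := rfl
    rw [envComm_eq, Units.inv_mul, h, mul_sub, sub_mul, H.inv_tmul_comm, mul_one, one_mul]

end QBasis

end QRelation

namespace QWeyl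

variable (q : ℂ)

/-- The unit `X`. -/
def u : (QWeyl q)ˣ where
  val := X q
  inv := Xinv q
  val_inv := by
    have := RingQuot.mkAlgHom_rel ℂ (qWeylRel.relXXinv (q := q))
    simpa [X, Xinv] using this
  inv_val := by
    have := RingQuot.mkAlgHom_rel ℂ (qWeylRel.relXinvX (q := q))
    simpa [X, Xinv] using this

/-- The unit `P`. -/
def v : (QWeyl q)ˣ where
  val := P q
  inv := Pinv q
  val_inv := by
    have := RingQuot.mkAlgHom_rel ℂ (qWeylRel.relPPinv (q := q))
    simpa [P, Pinv] using this
  inv_val := by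
    have := RingQuot.mkAlgHom_rel ℂ (qWeylRel.relPinvP (q := q))
    simpa [P, Pinv] using this

lemma u_mul_v : (u q : QWeyl q) * v q = q • ((v q : QWeyl q) * u q) := by
  have := RingQuot.mkAlgHom_rel ℂ (qWeylRel.relXP (q := q))
  rw [Algebra.smul_def]
  simpa [u, v, X, P] using this

lemma adjoin_eq_top : Algebra.adjoin ℂ {(u q : QWeyl q), (((u q)⁻¹ : (QWeyl q)ˣ) : QWeyl q),
    (v q : QWeyl q), (((v q)⁻¹ : (QWeyl q)ˣ) : QWeyl q)} = ⊤ := by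
  rw [← adjoin_range_mkAlgHom (qWeylRel q)]
  congr 1
  ext b
  simp [u, v, X, Xinv, P, Pinv, Fin.exists_fin_succ, eq_comm]

/-- The action of the generators on Laurent polynomials. -/
def genAction : Fin 4 → Module.End ℂ (ℤ × ℤ →₀ ℂ) :=
  ![Finsupp.linearCombination ℂ fun i => Finsupp.single (i.1 + 1, i.2) 1,
    Finsupp.linearCombination ℂ fun i => Finsupp.single (i.1 - 1, i.2) 1,
    Finsupp.linearCombination ℂ fun i => q ^ (-i.1) • Finsupp.single (i.1, i.2 + 1) 1,
    Finsupp.linearCombination ℂ fun i => q ^ i.1 • Finsupp.single (i.1, i.2 - 1) 1]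

lemma genAction_zero_single (k l : ℤ) :
    genAction q 0 (Finsupp.single (k, l) 1) = Finsupp.single (k + 1, l) 1 :=
  (Finsupp.linearCombination_single ..).trans (one_smul ..)

lemma genAction_one_single (k l : ℤ) :
    genAction q 1 (Finsupp.single (k, l) 1) = Finsupp.single (k - 1, l) 1 :=
  (Finsupp.linearCombination_single ..).trans (one_smul ..)

lemma genAction_two_single (k l : ℤ) : genAction q 2 (Finsupp.single (k, l) 1) =
    q ^ (-k) • Finsupp.single (k, l + 1) (1 : ℂ) :=
  (Finsupp.linearCombination_single ..).trans (one_smul ..)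

lemma genAction_three_single (k l : ℤ) : genAction q 3 (Finsupp.single (k, l) 1) =
    q ^ k • Finsupp.single (k, l - 1) (1 : ℂ) :=
  (Finsupp.linearCombination_single ..).trans (one_smul ..)

variable {q} (hq : q ≠ 0)

/-- The action of the q-Weyl algebra on Laurent polynomials. -/
def action : QWeyl q →ₐ[ℂ] Module.End ℂ (ℤ × ℤ →₀ ℂ) :=
  RingQuot.liftAlgHom ℂ ⟨FreeAlgebra.lift ℂ (genAction q), by
    rintro _ _ ⟨⟩ <;> refine Finsupp.lhom_ext' fun ⟨k, l⟩ => LinearMap.ext_ring ?_ <;>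
      simp only [map_mul, map_one, FreeAlgebra.lift_ι_apply, AlgHom.commutes,
        LinearMap.comp_apply, Finsupp.lsingle_apply, Module.End.mul_apply, Module.End.one_apply,
        Module.algebraMap_end_apply, genAction_zero_single, genAction_one_single,
        genAction_two_single, genAction_three_single, map_smul, smul_smul, sub_add_cancel,
        add_sub_cancel_right]
    · rw [zpow_neg, mul_inv_cancel₀ (zpow_ne_zero k hq), one_smul]
    · rw [zpow_neg, inv_mul_cancel₀ (zpow_ne_zero k hq), one_smul]
    · rw [← zpow_add_one₀ hq, neg_add, neg_add_cancel_right]⟩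

lemma action_u (k l : ℤ) :
    action hq (u q) (Finsupp.single (k, l) 1) = Finsupp.single (k + 1, l) 1 := by
  simp [action, u, X, genAction_zero_single]

lemma action_u_inv (k l : ℤ) :
    action hq (((u q)⁻¹ : (QWeyl q)ˣ) : QWeyl q) (Finsupp.single (k, l) 1) =
      Finsupp.single (k - 1, l) 1 := by
  simp [action, u, Xinv, genAction_one_single]

lemma action_v (k l : ℤ) :
    action hq (v q) (Finsupp.single (k, l) 1) = q ^ (-k) • Finsupp.single (k, l + 1) 1 := by
  simp [action, v, P, genAction_two_single]

lemma action_v_inv (k l : ℤ) :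
    action hq (((v q)⁻¹ : (QWeyl q)ˣ) : QWeyl q) (Finsupp.single (k, l) 1) =
      q ^ k • Finsupp.single (k, l - 1) 1 := by
  simp [action, v, Pinv, genAction_three_single]

lemma action_u_zpow (k l : ℤ) :
    action hq ((u q ^ k : (QWeyl q)ˣ) : QWeyl q) (Finsupp.single (0, l) 1) =
      Finsupp.single (k, l) 1 := by
  induction k using Int.induction_on with
  | zero => simp
  | succ k ih => rw [add_comm, zpow_one_add, Units.val_mul, map_mul, Module.End.mul_apply, ih,
      action_u, add_comm]
  | pred k ih => rw [sub_eq_neg_add, zpow_add, zpow_neg_one, Units.val_mul, map_mul,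
      Module.End.mul_apply, ih, action_u_inv, sub_eq_neg_add]

lemma action_v_zpow (l : ℤ) :
    action hq ((v q ^ l : (QWeyl q)ˣ) : QWeyl q) (Finsupp.single (0, 0) 1) =
      Finsupp.single (0, l) 1 := by
  induction l using Int.induction_on with
  | zero => simp
  | succ k ih => rw [add_comm, zpow_one_add, Units.val_mul, map_mul, Module.End.mul_apply, ih,
      action_v, add_comm, neg_zero, zpow_zero, one_smul]
  | pred k ih => rw [sub_eq_neg_add, zpow_add, zpow_neg_one, Units.val_mul, map_mul,
      Module.End.mul_apply, ih, action_v_inv, sub_eq_neg_add, zpow_zero, one_smul]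

/-- The basis `X^k P^l` of the q-Weyl algebra. -/
def basis : Module.Basis (ℤ × ℤ) ℂ (QWeyl q) :=
  basisOfRep (adjoin_eq_top q) (action hq)
    (fun i => ((u q ^ i.1 : (QWeyl q)ˣ) : QWeyl q) * ((v q ^ i.2 : (QWeyl q)ˣ) : QWeyl q))
    (by
      rintro g (rfl | rfl | rfl | rfl) ⟨k, l⟩
      · rw [action_u, Finsupp.linearCombination_single, one_smul, ← mul_assoc, val_mul_val_zpow]
      · rw [action_u_inv, Finsupp.linearCombination_single, one_smul, ← mul_assoc,
          val_inv_mul_val_zpow]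
      · have h := zpow_mul_zpow_of_qComm hq (u_mul_v q) k 1
        rw [zpow_one, mul_one] at h
        rw [action_v, map_smul, Finsupp.linearCombination_single, one_smul, ← mul_assoc, h,
          smul_mul_assoc, mul_assoc, val_mul_val_zpow]
      · have h := zpow_mul_zpow_of_qComm hq (u_mul_v q) k (-1)
        rw [zpow_neg_one, mul_neg_one, neg_neg] at h
        rw [action_v_inv, map_smul, Finsupp.linearCombination_single, one_smul, ← mul_assoc, h,
          smul_mul_assoc, mul_assoc, val_inv_mul_val_zpow])
    (0, 0) (by simp)
    (by
      rintro ⟨k, l⟩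
      rw [map_mul, Module.End.mul_apply, action_v_zpow, action_u_zpow])

lemma basis_apply (k l : ℤ) : basis hq (k, l) =
    ((u q ^ k : (QWeyl q)ˣ) : QWeyl q) * ((v q ^ l : (QWeyl q)ˣ) : QWeyl q) := basisOfRep_apply ..

/-- The monomial basis of the q-Weyl algebra. -/
def qBasis : QBasis q (u q) (v q) where
  q_ne_zero := hq
  rel := u_mul_v q
  gen := adjoin_eq_top q
  b := basis hq
  b_apply := basis_apply hq

end QWeyl

/-! ### Cohomology of the q-Weyl algebra -/

lemma ScalarKoszul.of_diagonal {B ι : Type} [Ring B] [Algebra ℂ B] (W : Module.Basis ι ℂ B) {i₀ : ι}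
    (h₀ : W i₀ = 1) {U V : B →ₗ[ℂ] B} {α β : ι → ℂ} (hU : ∀ i, U (W i) = α i • W i)
    (hV : ∀ i, V (W i) = β i • W i) (hα : α i₀ = 0) (hβ : β i₀ = 0)
    (hαβ : ∀ i, i ≠ i₀ → α i ≠ 0 ∨ β i ≠ 0) : ScalarKoszul U V (W.coord i₀) := by
  classical
  have hc : ∀ {T : B →ₗ[ℂ] B} {γ : ι → ℂ}, (∀ i, T (W i) = γ i • W i) →
      ∀ b i, W.repr (T b) i = γ i * W.repr b i := by
    intro T γ hT b i
    refine LinearMap.congr_fun (f := W.coord i ∘ₗ T) (g := γ i • W.coord i)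
      (W.ext fun j => ?_) b
    by_cases hij : j = i <;> simp [hT, hij]
  have hmk : ∀ γ : ι → ℂ, ∃ T : B →ₗ[ℂ] B, ∀ b i, W.repr (T b) i = γ i * W.repr b i :=
    fun γ => ⟨W.constr ℂ fun i => γ i • W i, hc fun i => W.constr_basis ℂ _ i⟩
  obtain ⟨d₁, d₂, bez⟩ : ∃ d₁ d₂ : ι → ℂ, ∀ i, i ≠ i₀ → α i * d₁ i + β i * d₂ i = 1 := by
    refine ⟨fun i => (α i)⁻¹, fun i => if α i = 0 then (β i)⁻¹ else 0, fun i hi => ?_⟩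
    by_cases h : α i = 0
    · simp [h, (hαβ i hi).resolve_left (not_not.2 h)]
    · simp [h]
  obtain ⟨D₁, hD₁⟩ := hmk d₁
  obtain ⟨D₂, hD₂⟩ := hmk d₂
  have hs : ∀ c : ℂ, ∀ i, W.repr (algebraMap ℂ B c) i = if i = i₀ then c else 0 := fun c i => by
    rw [Algebra.algebraMap_eq_smul_one, ← h₀, map_smul, W.repr_self, Finsupp.smul_apply,
      Finsupp.single_apply, smul_eq_mul, mul_ite, mul_one, mul_zero]
    simp only [eq_comm]
  replace hU := hc hU
  replace hV := hc hV
  refine ⟨fun b hb hb' => ⟨W.repr b i₀, W.ext_elem fun i => ?_⟩,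
    fun a b hab => ⟨D₁ a + D₂ b, W.repr a i₀, W.repr b i₀, W.ext_elem fun i => ?_,
      W.ext_elem fun i => ?_⟩,
    fun c => ⟨c • W i₀, by simp⟩,
    fun n => ⟨fun hn => ⟨-D₂ n, D₁ n, W.ext_elem fun i => ?_⟩, ?_⟩⟩
  · rw [hs]
    split_ifs with hi
    · rw [hi]
    · have h1 := hU b i
      have h2 := hV b i
      rw [hb, map_zero, Finsupp.zero_apply] at h1
      rw [hb', map_zero, Finsupp.zero_apply] at h2
      linear_combination -W.repr b i * bez i hi - d₁ i * h1 - d₂ i * h2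
  · have h := congrArg (fun c => W.repr c i) hab
    simp only [hU, hV] at h
    rw [map_add, Finsupp.add_apply, hs, hU, map_add, Finsupp.add_apply, hD₁, hD₂]
    split_ifs with hi
    · rw [hi, hα, zero_mul, zero_add]
    · linear_combination -W.repr a i * bez i hi - d₂ i * h
  · have h := congrArg (fun c => W.repr c i) hab
    simp only [hU, hV] at h
    rw [map_add, Finsupp.add_apply, hs, hV, map_add, Finsupp.add_apply, hD₁, hD₂]
    split_ifs with hi
    · rw [hi, hβ, zero_mul, zero_add]
    · linear_combination -W.repr b i * bez i hi + d₁ i * h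
  · rw [map_neg, map_sub, Finsupp.sub_apply, map_neg, Finsupp.neg_apply, hU, hV, hD₁, hD₂]
    by_cases hi : i = i₀
    · have h : W.repr n i₀ = 0 := hn
      rw [hi, h]
      ring
    · linear_combination W.repr n i * bez i hi
  · rintro ⟨a, b, rfl⟩
    rw [W.coord_apply, map_sub, Finsupp.sub_apply, hU, hV, hα, hβ, zero_mul, zero_mul, sub_zero]

/-! ### The twisted Koszul complex of the q-Weyl algebra on coefficients -/

lemma subShift_diagOp {W : Type} [AddCommGroup W] [Module ℂ W] (T : W →ₗ[ℂ] W) (F : ℤ →₀ W) :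
    subShift W (diagOp (fun _ => T) F) = diagOp (fun _ => T) (subShift W F) := by
  refine LinearMap.congr_fun (f := subShift W ∘ₗ diagOp fun _ => T)
    (g := (diagOp fun _ => T) ∘ₗ subShift W) (Finsupp.lhom_ext fun k f => ?_) F
  rw [LinearMap.comp_apply, LinearMap.comp_apply, diagOp_single, subShift_single,
    subShift_single, map_sub, diagOp_single, diagOp_single]

lemma paritySum_diagOp {W : Type} [AddCommGroup W] [Module ℂ W] (T : W →ₗ[ℂ] W) (F : ℤ →₀ W) :
    paritySum W (diagOp (fun _ => T) F) = diagOp (fun _ => T) (paritySum W F) := by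
  refine LinearMap.congr_fun (f := paritySum W ∘ₗ diagOp fun _ => T)
    (g := (diagOp fun _ => T) ∘ₗ paritySum W) (Finsupp.lhom_ext fun k f => ?_) F
  rw [LinearMap.comp_apply, LinearMap.comp_apply, diagOp_single, paritySum_single,
    paritySum_single, diagOp_single]

/-- The sum over parity classes in both variables. -/
def doubleParitySum : (ℤ →₀ ℤ →₀ ℂ) →ₗ[ℂ] (ZMod 2 →₀ ZMod 2 →₀ ℂ) :=
  (diagOp fun _ => paritySum ℂ) ∘ₗ paritySum (ℤ →₀ ℂ)

lemma doubleParitySum_single (k l : ℤ) :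
    doubleParitySum (Finsupp.single k (Finsupp.single l 1)) =
      Finsupp.single (k : ZMod 2) (Finsupp.single (l : ZMod 2) 1) := by
  rw [doubleParitySum, LinearMap.comp_apply, paritySum_single, diagOp_single, paritySum_single]

lemma regularKoszul_subShift : RegularKoszul (W := ZMod 2 →₀ ZMod 2 →₀ ℂ) (subShift (ℤ →₀ ℂ))
    (diagOp fun _ => subShift ℂ) doubleParitySum := by
  refine .of_quotient (V' := diagOp fun _ : ZMod 2 => subShift ℂ) ?_
    (fun _ => eq_zero_of_subShift_eq_zero) paritySum_surjective paritySum_eq_zero_iff ?_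
    (fun _ => eq_zero_of_diagOp_eq_zero fun _ _ => eq_zero_of_subShift_eq_zero)
    (diagOp_surjective fun _ => paritySum_surjective)
    (exists_diagOp_eq_iff fun _ => paritySum_eq_zero_iff)
  · exact subShift_diagOp (subShift ℂ)
  · exact paritySum_diagOp (subShift ℂ)

namespace QBasis

variable {B : Type} [Ring B] [Algebra ℂ B] {q : ℂ} {u v : Bˣ} (H : QBasis q u v)

/-- The monomials `s^(-kl) u^k v^l`, where `s` is a square root of `q`. -/
def mono (u v : Bˣ) (s : ℂ) (k l : ℤ) : B :=
  s ^ (-(k * l)) • (((u ^ k : Bˣ) : B) * ((v ^ l : Bˣ) : B))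

lemma mono_zero_zero (s : ℂ) : mono u v s 0 0 = 1 := by simp [mono]

lemma mono_one_zero (s : ℂ) : mono u v s 1 0 = u := by simp [mono]

lemma mono_zero_one (s : ℂ) : mono u v s 0 1 = v := by simp [mono]

lemma mono_neg_one_zero (s : ℂ) : mono u v s (-1) 0 = ((u⁻¹ : Bˣ) : B) := by simp [mono]

lemma mono_zero_neg_one (s : ℂ) : mono u v s 0 (-1) = ((v⁻¹ : Bˣ) : B) := by simp [mono]

section Mono

variable {s : ℂ} (hs : s ≠ 0) (hsq : s * s = q)

include H hs hsq

lemma mono_mul_mono (k l m n : ℤ) :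
    mono u v s k l * mono u v s m n = s ^ (k * n - l * m) • mono u v s (k + m) (l + n) := by
  have h := zpow_mul_zpow_of_qComm H.q_ne_zero H.rel m l
  have hsc : s ^ (-(k * l)) * s ^ (-(m * n)) * q ^ (-(m * l)) =
      s ^ (k * n - l * m) * s ^ (-((k + m) * (l + n))) := by
    rw [← hsq, mul_zpow, ← zpow_add₀ hs, ← zpow_add₀ hs, ← zpow_add₀ hs, ← zpow_add₀ hs]
    ring_nf
  rw [mono, mono, mono, smul_mul_smul_comm, mul_assoc, ← mul_assoc ((v ^ l : Bˣ) : B), h,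
    smul_mul_assoc, mul_smul_comm, smul_smul, smul_smul, hsc, zpow_add u, zpow_add v,
    Units.val_mul, Units.val_mul]
  simp only [mul_assoc]

lemma inv_mul_mono_mul_u (k l : ℤ) :
    ((u⁻¹ : Bˣ) : B) * mono u v s k l * u = q ^ (-l) • mono u v s k l := by
  rw [← mono_neg_one_zero s, ← mono_one_zero s, H.mono_mul_mono hs hsq, smul_mul_assoc,
    H.mono_mul_mono hs hsq, smul_smul, ← hsq, mul_zpow]
  ring_nf

lemma inv_mul_mono_mul_v (k l : ℤ) :
    ((v⁻¹ : Bˣ) : B) * mono u v s k l * v = q ^ k • mono u v s k l := by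
  rw [← mono_zero_neg_one s, ← mono_zero_one s, H.mono_mul_mono hs hsq, smul_mul_assoc,
    H.mono_mul_mono hs hsq, smul_smul, ← hsq, mul_zpow]
  ring_nf

lemma inv_mul_mono_mul_u_inv (k l : ℤ) :
    ((u⁻¹ : Bˣ) : B) * mono u v s k l * ((u⁻¹ : Bˣ) : B) = mono u v s (k - 2) l := by
  rw [← mono_neg_one_zero s, H.mono_mul_mono hs hsq, smul_mul_assoc,
    H.mono_mul_mono hs hsq, smul_smul, ← zpow_add₀ hs]
  ring_nf
  rw [zpow_zero, one_smul]

lemma inv_mul_mono_mul_v_inv (k l : ℤ) :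
    ((v⁻¹ : Bˣ) : B) * mono u v s k l * ((v⁻¹ : Bˣ) : B) = mono u v s k (l - 2) := by
  rw [← mono_zero_neg_one s, H.mono_mul_mono hs hsq, smul_mul_assoc,
    H.mono_mul_mono hs hsq, smul_smul, ← zpow_add₀ hs]
  ring_nf
  rw [zpow_zero, one_smul]

end Mono

/-- The basis of rescaled monomials. -/
def monoBasis {s : ℂ} (hs : s ≠ 0) : Module.Basis (ℤ × ℤ) ℂ B :=
  H.b.unitsSMul fun i => Units.mk0 (s ^ (-(i.1 * i.2))) (zpow_ne_zero _ hs)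

lemma monoBasis_apply {s : ℂ} (hs : s ≠ 0) (i : ℤ × ℤ) :
    H.monoBasis hs i = mono u v s i.1 i.2 := by
  rw [monoBasis, Module.Basis.unitsSMul_apply, Units.smul_def, Units.val_mk0, H.b_apply, mono]

section Cohomology

variable {s : ℂ} (hs : s ≠ 0) (hsq : s * s = q)

include hsq in
lemma scalarKoszul (hq : ∀ n : ℕ, 0 < n → q ^ n ≠ 1) :
    ScalarKoszul (twistedComm (u : B) ((u⁻¹ : Bˣ) : B) u) (twistedComm (v : B) ((v⁻¹ : Bˣ) : B) v)
      ((H.monoBasis hs).coord (0, 0)) := by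
  have hz : ∀ k : ℤ, k ≠ 0 → 1 - q ^ k ≠ 0 := fun k hk h => by
    have h1 : q ^ k.natAbs = 1 := by
      rcases Int.natAbs_eq k with h2 | h2 <;> rw [h2, sub_eq_zero] at h
      · rw [← zpow_natCast, ← h]
      · rw [← zpow_natCast, ← inv_inj, ← zpow_neg, ← h, inv_one]
    exact hq _ (Int.natAbs_pos.2 hk) h1
  refine .of_diagonal _ (α := fun i => 1 - q ^ (-i.2)) (β := fun i => 1 - q ^ i.1) ?_
    (fun i => ?_) (fun i => ?_) (by simp) (by simp) fun i hi => ?_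
  · rw [monoBasis_apply, mono_zero_zero]
  · rw [monoBasis_apply, twistedComm_apply, Units.inv_mul, one_mul, H.inv_mul_mono_mul_u hs hsq,
      sub_smul, one_smul]
  · rw [monoBasis_apply, twistedComm_apply, Units.inv_mul, one_mul, H.inv_mul_mono_mul_v hs hsq,
      sub_smul, one_smul]
  · by_cases h : i.2 = 0
    · exact Or.inr (hz _ fun h' => hi (Prod.ext h' h))
    · exact Or.inl (hz _ (neg_ne_zero.2 h))

/-- The coefficients with respect to the rescaled monomials. -/
def coeffEquiv : B ≃ₗ[ℂ] (ℤ →₀ ℤ →₀ ℂ) :=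
  (H.monoBasis hs).repr ≪≫ₗ Finsupp.curryLinearEquiv ℂ

lemma coeffEquiv_mono (k l : ℤ) :
    H.coeffEquiv hs (mono u v s k l) = Finsupp.single k (Finsupp.single l 1) := by
  rw [← H.monoBasis_apply hs (k, l), coeffEquiv, LinearEquiv.trans_apply, Module.Basis.repr_self]
  simp

/-- The degree two cohomology classes of the twisted part. -/
def coinvariant : B →ₗ[ℂ] (ZMod 2 →₀ ZMod 2 →₀ ℂ) :=
  doubleParitySum ∘ₗ (H.coeffEquiv hs).toLinearMap

lemma coinvariant_mono (k l : ℤ) : H.coinvariant hs (mono u v s k l) =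
    Finsupp.single (k : ZMod 2) (Finsupp.single (l : ZMod 2) 1) := by
  rw [coinvariant, LinearMap.comp_apply, LinearEquiv.coe_coe, H.coeffEquiv_mono,
    doubleParitySum_single]

variable {ε : B ≃ₐ[ℂ] B} (hu : ε u = ((u⁻¹ : Bˣ) : B)) (hv : ε v = ((v⁻¹ : Bˣ) : B))

include hu hv in
lemma map_mono (s : ℂ) (k l : ℤ) : ε (mono u v s k l) = mono u v s (-k) (-l) := by
  have h : ∀ w : Bˣ, ε w = ((w⁻¹ : Bˣ) : B) → ∀ k : ℤ,
      ε ((w ^ k : Bˣ) : B) = ((w ^ (-k) : Bˣ) : B) := fun w hw k => by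
    have h1 : Units.map (ε : B →* B) w = w⁻¹ := Units.ext hw
    have h2 := congrArg (fun v : Bˣ => (v : B)) (map_zpow (Units.map (ε : B →* B)) w k)
    rw [h1, inv_zpow'] at h2
    exact h2
  rw [mono, map_smul, map_mul, h u hu, h v hv, mono, neg_mul_neg]

include hu hv hsq in
lemma regularKoszul : RegularKoszul (W := ZMod 2 →₀ ZMod 2 →₀ ℂ)
    (twistedComm (u : B) ((u⁻¹ : Bˣ) : B) (ε u))
    (twistedComm (v : B) ((v⁻¹ : Bˣ) : B) (ε v)) (H.coinvariant hs) := by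
  have h := RegularKoszul.transport (W := ZMod 2 →₀ ZMod 2 →₀ ℂ) (H.coeffEquiv hs)
    (U' := twistedComm (u : B) ((u⁻¹ : Bˣ) : B) (ε u))
    (V' := twistedComm (v : B) ((v⁻¹ : Bˣ) : B) (ε v)) regularKoszul_subShift
  rw [← coinvariant] at h
  refine h (fun b => ?_) fun b => ?_
  · refine LinearMap.congr_fun (f := (H.coeffEquiv hs).toLinearMap ∘ₗ twistedComm _ _ _)
      (g := subShift (ℤ →₀ ℂ) ∘ₗ (H.coeffEquiv hs).toLinearMap)
      ((H.monoBasis hs).ext fun i => ?_) b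
    simp only [LinearMap.comp_apply, LinearEquiv.coe_coe]
    rw [monoBasis_apply, twistedComm_apply, hu, Units.inv_mul, one_mul,
      H.inv_mul_mono_mul_u_inv hs hsq, map_sub, coeffEquiv_mono, coeffEquiv_mono, subShift_single]
  · refine LinearMap.congr_fun (f := (H.coeffEquiv hs).toLinearMap ∘ₗ twistedComm _ _ _)
      (g := (diagOp fun _ => subShift ℂ) ∘ₗ (H.coeffEquiv hs).toLinearMap)
      ((H.monoBasis hs).ext fun i => ?_) b
    simp only [LinearMap.comp_apply, LinearEquiv.coe_coe]
    rw [monoBasis_apply, twistedComm_apply, hv, Units.inv_mul, one_mul,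
      H.inv_mul_mono_mul_v_inv hs hsq, map_sub, coeffEquiv_mono, coeffEquiv_mono, diagOp_single,
      subShift_single, Finsupp.single_sub]

include hu hv hsq in
lemma coord_conj_map (b : B) :
    (H.monoBasis hs).coord (0, 0)
      (((u⁻¹ : Bˣ) : B) * (((v⁻¹ : Bˣ) : B) * ε b * v) * u) = (H.monoBasis hs).coord (0, 0) b := by
  refine LinearMap.congr_fun (f := (H.monoBasis hs).coord (0, 0) ∘ₗ
    LinearMap.mulRight ℂ (u : B) ∘ₗ LinearMap.mulLeft ℂ ((u⁻¹ : Bˣ) : B) ∘ₗ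
    LinearMap.mulRight ℂ (v : B) ∘ₗ LinearMap.mulLeft ℂ ((v⁻¹ : Bˣ) : B) ∘ₗ ε.toLinearMap)
    ((H.monoBasis hs).ext fun i => ?_) b
  simp only [LinearMap.comp_apply, LinearMap.mulLeft_apply, LinearMap.mulRight_apply,
    AlgEquiv.toLinearMap_apply]
  obtain ⟨k, l⟩ := i
  rw [monoBasis_apply, map_mono hu hv, H.inv_mul_mono_mul_v hs hsq, mul_smul_comm,
    smul_mul_assoc, H.inv_mul_mono_mul_u hs hsq, smul_smul, ← H.monoBasis_apply hs (k, l),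
    ← H.monoBasis_apply hs (-k, -l), map_smul, Module.Basis.coord_apply, Module.Basis.coord_apply,
    Module.Basis.repr_self, Module.Basis.repr_self]
  by_cases h : (k, l) = (0, 0)
  · obtain ⟨rfl, rfl⟩ := Prod.ext_iff.1 h
    simp
  · have h' : (-k, -l) ≠ (0, 0) := fun h' => h (by simpa using h')
    rw [Finsupp.single_eq_of_ne' h, Finsupp.single_eq_of_ne' h', smul_zero]

include hu hv hsq in
lemma coinvariant_map (b : B) : H.coinvariant hs
    (((u⁻¹ : Bˣ) : B) * (((v⁻¹ : Bˣ) : B) * ε b * ((v⁻¹ : Bˣ) : B)) * ((u⁻¹ : Bˣ) : B)) =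
      H.coinvariant hs b := by
  refine LinearMap.congr_fun (f := H.coinvariant hs ∘ₗ
    LinearMap.mulRight ℂ ((u⁻¹ : Bˣ) : B) ∘ₗ LinearMap.mulLeft ℂ ((u⁻¹ : Bˣ) : B) ∘ₗ
    LinearMap.mulRight ℂ ((v⁻¹ : Bˣ) : B) ∘ₗ LinearMap.mulLeft ℂ ((v⁻¹ : Bˣ) : B) ∘ₗ
    ε.toLinearMap) ((H.monoBasis hs).ext fun i => ?_) b
  have h2 : (2 : ZMod 2) = 0 := rfl
  simp only [LinearMap.comp_apply, LinearMap.mulLeft_apply, LinearMap.mulRight_apply,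
    AlgEquiv.toLinearMap_apply]
  rw [monoBasis_apply, map_mono hu hv, H.inv_mul_mono_mul_v_inv hs hsq,
    H.inv_mul_mono_mul_u_inv hs hsq, coinvariant_mono, coinvariant_mono]
  simp [h2, CharTwo.neg_eq]

/-- The Koszul cohomology of the q-Weyl algebra. -/
def cohomology (hq : ∀ n : ℕ, 0 < n → q ^ n ≠ 1) :
    (H.koszulAlgebra hu hv).Cohomology ℂ (ZMod 2 →₀ ZMod 2 →₀ ℂ) where
  Θ₁ := (H.monoBasis hs).coord (0, 0)
  Θ₂ := H.coinvariant hs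
  scalar := H.scalarKoszul hs hsq hq
  regular := H.regularKoszul hs hsq hu hv
  invariant₁ b := by
    simpa [koszulAlgebra, mul_assoc] using H.coord_conj_map hs hsq hu hv b
  invariant₂ b := by
    simpa [koszulAlgebra, mul_assoc] using H.coinvariant_map hs hsq hu hv b

end Cohomology

end QBasis

/-- Functions on `ZMod 2` are functions on `Fin 2`. -/
def zmodTwoEquiv : (ZMod 2 →₀ ℂ) ≃ₗ[ℂ] (Fin 2 → ℂ) :=
  LinearEquiv.ofFinrankEq _ _ (by simp)

/-- The one scalar class and the four parity classes of the q-Weyl algebra. -/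
def prodZModTwoEquiv : (ℂ × (ZMod 2 →₀ ZMod 2 →₀ ℂ)) ≃ₗ[ℂ] (Fin 5 → ℂ) :=
  LinearEquiv.ofFinrankEq _ _ (by simp)

/-- Let `q ∈ ℂˣ` be not a root of unity.  Consider the `ℤ/2`-actions
generated by the involutive automorphism `ε` on: the Weyl algebra `𝒜` (`ε(x) = -x`,
`ε(p) = -p`), the trigonometric Weyl algebra `𝔸` (`ε(X) = X⁻¹`, `ε(p) = -p`), and the
`q`-Weyl algebra `𝐀` (`ε(X) = X⁻¹`, `ε(P) = P⁻¹`).  In each case the crossed product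
`ℂ[ℤ/2] ⋉ B` is the algebra `D` with underlying space `B ⊗ ℂ[ℤ/2]` (identified with
`MonoidAlgebra B (ℤ/2)` via the `ℂ`-linear equivalence `e`), and multiplication
`(a ⊗ g)(b ⊗ h) = a·g(b) ⊗ gh`, where `g(b) = b` if `g = 1` and `g(b) = ε(b)` otherwise.
Then `HH^i(ℂ[ℤ/2] ⋉ 𝒜) = HH^i(ℂ[ℤ/2] ⋉ 𝔸) = HH^i(ℂ[ℤ/2] ⋉ 𝐀) = 0` for `i ≠ 0, 2`;
all three `HH^0`'s are `ℂ`; and `HH^2(ℂ[ℤ/2] ⋉ 𝒜) ≅ ℂ`, `HH^2(ℂ[ℤ/2] ⋉ 𝔸) ≅ ℂ²`,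
`HH^2(ℂ[ℤ/2] ⋉ 𝐀) ≅ ℂ⁵`. -/
theorem statement16 (q : ℂ) (hq0 : q ≠ 0) (hq : ∀ n : ℕ, 0 < n → q ^ n ≠ 1)
    -- the action on the Weyl algebra
    (ε₁ : Weyl ≃ₐ[ℂ] Weyl) (hε₁ : ∀ b, ε₁ (ε₁ b) = b)
    (hε₁x : ε₁ Weyl.x = - Weyl.x) (hε₁p : ε₁ Weyl.p = - Weyl.p)
    (D₁ : Type) [Ring D₁] [Algebra ℂ D₁]
    (e₁ : MonoidAlgebra Weyl (Multiplicative (ZMod 2)) ≃ₗ[ℂ] D₁)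
    (he₁ : ∀ (g h : Multiplicative (ZMod 2)) (a b : Weyl),
      e₁ (MonoidAlgebra.single g a) * e₁ (MonoidAlgebra.single h b)
        = e₁ (MonoidAlgebra.single (g * h) (a * (if g = 1 then b else ε₁ b))))
    -- the action on the trigonometric Weyl algebra
    (ε₂ : TrigWeyl ≃ₐ[ℂ] TrigWeyl) (hε₂ : ∀ b, ε₂ (ε₂ b) = b)
    (hε₂X : ε₂ TrigWeyl.X = TrigWeyl.Xinv) (hε₂p : ε₂ TrigWeyl.p = - TrigWeyl.p)
    (D₂ : Type) [Ring D₂] [Algebra ℂ D₂]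
    (e₂ : MonoidAlgebra TrigWeyl (Multiplicative (ZMod 2)) ≃ₗ[ℂ] D₂)
    (he₂ : ∀ (g h : Multiplicative (ZMod 2)) (a b : TrigWeyl),
      e₂ (MonoidAlgebra.single g a) * e₂ (MonoidAlgebra.single h b)
        = e₂ (MonoidAlgebra.single (g * h) (a * (if g = 1 then b else ε₂ b))))
    -- the action on the q-Weyl algebra
    (ε₃ : QWeyl q ≃ₐ[ℂ] QWeyl q) (hε₃ : ∀ b, ε₃ (ε₃ b) = b)
    (hε₃X : ε₃ (QWeyl.X q) = QWeyl.Xinv q) (hε₃P : ε₃ (QWeyl.P q) = QWeyl.Pinv q)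
    (D₃ : Type) [Ring D₃] [Algebra ℂ D₃]
    (e₃ : MonoidAlgebra (QWeyl q) (Multiplicative (ZMod 2)) ≃ₗ[ℂ] D₃)
    (he₃ : ∀ (g h : Multiplicative (ZMod 2)) (a b : QWeyl q),
      e₃ (MonoidAlgebra.single g a) * e₃ (MonoidAlgebra.single h b)
        = e₃ (MonoidAlgebra.single (g * h) (a * (if g = 1 then b else ε₃ b)))) :
    (∀ i : ℕ, i ≠ 0 → i ≠ 2 →
      Limits.IsZero (HHcoh D₁ i) ∧ Limits.IsZero (HHcoh D₂ i) ∧ Limits.IsZero (HHcoh D₃ i)) ∧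
    Nonempty (HHcoh D₁ 0 ≅ ModuleCat.of ℂ ℂ) ∧
    Nonempty (HHcoh D₂ 0 ≅ ModuleCat.of ℂ ℂ) ∧
    Nonempty (HHcoh D₃ 0 ≅ ModuleCat.of ℂ ℂ) ∧
    Nonempty (HHcoh D₁ 2 ≅ ModuleCat.of ℂ ℂ) ∧
    Nonempty (HHcoh D₂ 2 ≅ ModuleCat.of ℂ (Fin 2 → ℂ)) ∧
    Nonempty (HHcoh D₃ 2 ≅ ModuleCat.of ℂ (Fin 5 → ℂ)) := by
  obtain ⟨C₁⟩ := exists_crossedProduct e₁ he₁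
  obtain ⟨C₂⟩ := exists_crossedProduct e₂ he₂
  obtain ⟨C₃⟩ := exists_crossedProduct e₃ he₃
  obtain ⟨s, hs⟩ := IsAlgClosed.exists_pow_nat_eq q two_pos
  have hs0 : s ≠ 0 := by
    rintro rfl
    exact hq0 (by rw [← hs, zero_pow two_ne_zero])
  have : Nontrivial Weyl := Weyl.basis.repr.toEquiv.nontrivial
  have : Nontrivial TrigWeyl := TrigWeyl.basis.repr.toEquiv.nontrivial
  have : Nontrivial (QWeyl q) := (QWeyl.basis hq0).repr.toEquiv.nontrivial
  have H₁ := Weyl.weylBasis.cohomology hε₁x hε₁p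
  have H₂ := TrigWeyl.trigBasis.cohomology hε₂X hε₂p
  have H₃ := (QWeyl.qBasis hq0).cohomology hs0 (by rw [← sq, hs]) hε₃X hε₃P hq
  exact ⟨fun i h0 h2 => ⟨KoszulAlgebra.isZero_HHcoh H₁ C₁ i h0 h2,
      KoszulAlgebra.isZero_HHcoh H₂ C₂ i h0 h2, KoszulAlgebra.isZero_HHcoh H₃ C₃ i h0 h2⟩,
    KoszulAlgebra.nonempty_HHcoh_zero_iso H₁ C₁, KoszulAlgebra.nonempty_HHcoh_zero_iso H₂ C₂,
    KoszulAlgebra.nonempty_HHcoh_zero_iso H₃ C₃,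
    KoszulAlgebra.nonempty_HHcoh_two_iso H₁ C₁ LinearEquiv.uniqueProd,
    KoszulAlgebra.nonempty_HHcoh_two_iso H₂ C₂ (LinearEquiv.uniqueProd.trans zmodTwoEquiv),
    KoszulAlgebra.nonempty_HHcoh_two_iso H₃ C₃ prodZModTwoEquiv⟩
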